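/- Let s, t ≥ 1 be real numbers, let a₁, …, aₙ be positive rational numbers with aᵢ = pᵢ/qᵢ where pᵢ, qᵢ are positive integers satisfying log max(pᵢ, qᵢ) ≤ s for all i, and let b₁, …, bₙ be integers with log |bᵢ| ≤ t for all i. Set Λ = b₁·log a₁ + b₂·log a₂ + ⋯ + bₙ·log aₙ, and set C(n) = 18·(n+1)!·n^{n+1}·32^{n+2}·log(2n). If Λ ≠ 0, then |Λ| ≥ exp(−C(n)·t·sⁿ). -/

import Mathlib

namespace BW
open Complex

/-- norm bound for `1 + cos w`. -/
lemma norm_one_add_cos_le (w : ℂ) : ‖1 + Complex.cos w‖ ≤ 2 * Real.exp ‖w‖ := by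
  have h1 : ‖Complex.cos w‖ ≤ Real.exp ‖w‖ := by
    rw [Complex.cos, norm_div]
    have a : ‖Complex.exp (w * I)‖ ≤ Real.exp ‖w‖ := by
      refine (Complex.norm_exp_le_exp_norm _).trans ?_
      simp
    have b : ‖Complex.exp (-w * I)‖ ≤ Real.exp ‖w‖ := by
      refine (Complex.norm_exp_le_exp_norm _).trans ?_
      simp
    have := norm_add_le (Complex.exp (w * I)) (Complex.exp (-w * I))
    have h2 : ‖(2 : ℂ)‖ = 2 := by simp
    rw [h2, div_le_iff₀ (by norm_num)]
    linarith
  have h2 : (1 : ℝ) ≤ Real.exp ‖w‖ := Real.one_le_exp (norm_nonneg _)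
  have h3 := norm_add_le 1 (Complex.cos w)
  simp only [norm_one] at h3
  linarith

lemma hasDerivAt_ofReal_comp {G : ℂ → ℂ} {g : ℂ} {x : ℝ} (h : HasDerivAt G g (x : ℂ)) :
    HasDerivAt (fun y : ℝ => G (y : ℂ)) g x := h.comp_ofReal

/-- The interpolating function fixing the integers and flat at the odd integers. -/
lemma exists_psi (M : ℕ) : ∃ ψ : ℂ → ℂ, Differentiable ℂ ψ ∧ (∀ l : ℤ, ψ l = l) ∧
    (∀ l : ℤ, Odd l → ((2 * M : ℕ) : ℕ∞) ≤ analyticOrderAt (deriv ψ) (l : ℂ)) ∧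
    (∀ z, ‖ψ z‖ ≤ ‖z‖ * (2 ^ M * Real.exp (Real.pi * M * ‖z‖))) ∧
    (∀ y : ℝ, ‖ψ y‖ ≤ |y| * 2 ^ M) := by
  set F : ℂ → ℂ := fun z => (1 + Complex.cos (Real.pi * z)) ^ M with hF
  have hFd : Differentiable ℂ F := by
    intro z; simp only [hF]; fun_prop
  obtain ⟨G0, hG0⟩ := Differentiable.isExactOn_univ hFd
  set G : ℂ → ℂ := fun z => G0 z - G0 0 with hG
  have hGd : ∀ z, HasDerivAt G (F z) z := fun z => (hG0 z (Set.mem_univ z)).sub_const _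
  have hG00 : G 0 = 0 := by simp [hG]
  have hper : ∀ z, F (z + 2) = F z := by
    intro z
    simp only [hF]
    congr 2
    rw [show (Real.pi : ℂ) * (z + 2) = Real.pi * z + 2 * Real.pi by ring, Complex.cos_add_two_pi]
  have heven : ∀ z, F (-z) = F z := by
    intro z
    simp only [hF]
    congr 2
    rw [show (Real.pi : ℂ) * (-z) = -(Real.pi * z) by ring, Complex.cos_neg]
  have hshift : ∀ z w, G (z + 2) - G z = G (w + 2) - G w := by
    have hd : ∀ z, HasDerivAt (fun z => G (z + 2) - G z) 0 z := by
      intro z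
      have h1 : HasDerivAt (fun z => G (z + 2)) (F (z + 2)) z := (hGd (z + 2)).comp_add_const z 2
      have h2 := h1.sub (hGd z)
      rw [hper, sub_self] at h2
      exact h2
    exact fun z w => is_const_of_deriv_eq_zero (fun z => (hd z).differentiableAt)
      (fun z => (hd z).deriv) z w
  have hodd : ∀ z, G (-z) = - G z := by
    have hd : ∀ z, HasDerivAt (fun z => G (-z) + G z) 0 z := by
      intro z
      have h1 : HasDerivAt (fun z => G (-z)) (F (-z) * (-1)) z := by
        have := (hGd (-z)).comp z (hasDerivAt_neg z)
        exact this
      have h2 := h1.add (hGd z)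
      rw [heven] at h2
      rw [show F z * -1 + F z = 0 by ring] at h2
      exact h2
    intro z
    have := is_const_of_deriv_eq_zero (fun z => (hd z).differentiableAt)
      (fun z => (hd z).deriv) z 0
    simp only [neg_zero, hG00, add_zero] at this
    exact eq_neg_of_add_eq_zero_left this
  have hstep : ∀ z, G (z + 2) = G z + 2 * G 1 := by
    intro z
    have h := hshift z (-1)
    rw [hodd 1, show (-1 : ℂ) + 2 = 1 by norm_num] at h
    linear_combination h
  have hnat : ∀ n : ℕ, G n = n * G 1 ∧ G (n + 1 : ℕ) = (n + 1 : ℕ) * G 1 := by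
    intro n
    induction n with
    | zero => simp [hG00]
    | succ k ih =>
      refine ⟨ih.2, ?_⟩
      have h := hstep (k : ℂ)
      rw [ih.1] at h
      have : ((k + 1 + 1 : ℕ) : ℂ) = (k : ℂ) + 2 := by push_cast; ring
      rw [this, h]; ring
  have hintG : ∀ l : ℤ, G l = l * G 1 := by
    intro l
    obtain ⟨n, rfl | rfl⟩ := l.eq_nat_or_neg
    · simpa using (hnat n).1
    · push_cast
      rw [hodd, (hnat n).1]; ring
  have hG1 : 1 ≤ ‖G 1‖ := by
    refine le_trans ?_ (Complex.re_le_norm (G 1))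
    let u : ℝ → ℝ := fun x => (G x).re - (x + M * (Real.sin (Real.pi * x) / Real.pi))
    have hu : ∀ x, HasDerivAt u (((1 + Real.cos (Real.pi * x)) ^ M) -
        (1 + M * Real.cos (Real.pi * x))) x := by
      intro x
      have h1 : HasDerivAt (fun y : ℝ => (G y).re) (F x).re x := (hGd x).real_of_complex
      have h2 : (F x).re = (1 + Real.cos (Real.pi * x)) ^ M := by
        have : F x = (((1 + Real.cos (Real.pi * x)) ^ M : ℝ) : ℂ) := by
          simp only [hF]; push_cast; rfl
        rw [this, Complex.ofReal_re]
      rw [h2] at h1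
      have h3 : HasDerivAt (fun y : ℝ => Real.sin (Real.pi * y) / Real.pi)
          (Real.cos (Real.pi * x)) x := by
        have := ((Real.hasDerivAt_sin (Real.pi * x)).comp x
          ((hasDerivAt_id x).const_mul Real.pi)).div_const Real.pi
        rw [mul_one, mul_div_assoc, div_self Real.pi_ne_zero, mul_one] at this
        exact this
      exact h1.sub ((hasDerivAt_id x).add (h3.const_mul (M : ℝ)))
    have hmono : Monotone u := by
      refine monotone_of_deriv_nonneg (fun x => (hu x).differentiableAt) (fun x => ?_)
      rw [(hu x).deriv]
      have := one_add_mul_le_pow (a := Real.cos (Real.pi * x))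
        (by linarith [Real.neg_one_le_cos (Real.pi * x)]) M
      linarith
    have h01 := hmono (zero_le_one)
    simp only [u] at h01
    simp [hG00] at h01
    exact h01
  have hG1ne : G 1 ≠ 0 := by
    intro h; rw [h, norm_zero] at hG1; linarith
  have hderiv : ∀ z, HasDerivAt (fun z => G z / G 1) (F z / G 1) z := fun z => (hGd z).div_const _
  refine ⟨fun z => G z / G 1, fun z => (hderiv z).differentiableAt, ?_, ?_, ?_, ?_⟩
  · intro l
    simp only
    rw [hintG]; field_simp
  · intro l hl
    have h1 : deriv (fun z => G z / G 1) = fun z => F z / G 1 := funext fun z => (hderiv z).deriv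
    rw [h1]
    set c : ℂ → ℂ := fun z => 1 + Complex.cos (Real.pi * z) with hc
    have hcd : Differentiable ℂ c := by intro z; simp only [hc]; fun_prop
    have hca : AnalyticAt ℂ c l := hcd.analyticAt _
    have hcos : Complex.cos (Real.pi * (l : ℂ)) = -1 := by
      obtain ⟨k, rfl⟩ := hl
      have : (Real.pi : ℂ) * ((2 * k + 1 : ℤ) : ℂ) = Real.pi + k * (2 * Real.pi) := by
        push_cast; ring
      rw [this, Complex.cos_add_int_mul_two_pi, Complex.cos_pi]
    have hsin : Complex.sin (Real.pi * (l : ℂ)) = 0 := by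
      rw [mul_comm]; exact Complex.sin_int_mul_pi l
    have hcl : c l = 0 := by simp only [hc]; rw [hcos]; norm_num
    have hc' : ∀ z, HasDerivAt c (-Complex.sin (Real.pi * z) * Real.pi) z := by
      intro z
      have := ((Complex.hasDerivAt_cos (Real.pi * z)).comp z
          ((hasDerivAt_id z).const_mul (Real.pi : ℂ))).const_add 1
      rw [mul_one] at this
      exact this
    have hord : (2 : ℕ∞) ≤ analyticOrderAt c l := by
      have h2 := hca.analyticOrderAt_deriv_add_one
      simp only [hcl, sub_zero] at h2
      have h3 : deriv c l = 0 := by rw [(hc' l).deriv, hsin]; simp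
      have h4 : (1 : ℕ∞) ≤ analyticOrderAt (deriv c) l := by
        rw [Order.one_le_iff_ne_zero]
        exact (hca.deriv.analyticOrderAt_ne_zero).2 h3
      have : analyticOrderAt c l = analyticOrderAt (deriv c) l + 1 := h2.symm
      rw [this]
      calc (2 : ℕ∞) = 1 + 1 := by norm_num
        _ ≤ _ := by gcongr
    have hFc : (fun z => F z / G 1) = (c ^ M) * (fun _ => (G 1)⁻¹) := by
      funext z; simp [hF, hc, div_eq_mul_inv]
    rw [hFc, analyticOrderAt_mul (hca.pow M) analyticAt_const, analyticOrderAt_pow hca]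
    refine le_trans ?_ le_self_add
    rw [nsmul_eq_mul]
    push_cast
    rw [mul_comm]
    gcongr
  · intro z
    have hb : ∀ w ∈ Metric.closedBall (0 : ℂ) ‖z‖, ‖deriv G w‖ ≤
        2 ^ M * Real.exp (Real.pi * M * ‖z‖) := by
      intro w hw
      rw [(hGd w).deriv]
      simp only [hF, norm_pow]
      have h1 := norm_one_add_cos_le (Real.pi * w)
      have hw' : ‖w‖ ≤ ‖z‖ := by simpa using hw
      have h2 : ‖(Real.pi : ℂ) * w‖ ≤ Real.pi * ‖z‖ := by
        rw [norm_mul, Complex.norm_real, Real.norm_of_nonneg Real.pi_pos.le]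
        gcongr
      calc _ ≤ (2 * Real.exp (Real.pi * ‖z‖)) ^ M := by
            gcongr
            exact h1.trans (by gcongr)
        _ = _ := by
            rw [mul_pow, ← Real.exp_nat_mul]
            congr 2; ring
    have := Convex.norm_image_sub_le_of_norm_deriv_le (f := G)
      (fun w _ => (hGd w).differentiableAt) hb (convex_closedBall 0 ‖z‖)
      (x := 0) (y := z) (by simp) (by simp)
    rw [hG00, sub_zero, sub_zero] at this
    simp only [norm_div]
    rw [div_le_iff₀ (by linarith)]
    have h0 : 0 ≤ ‖z‖ * (2 ^ M * Real.exp (Real.pi * M * ‖z‖)) := by positivity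
    nlinarith
  · intro y
    have hb : ∀ w ∈ (Set.univ : Set ℝ), ‖deriv (fun y : ℝ => G y) w‖ ≤ 2 ^ M := by
      intro w _
      rw [(hasDerivAt_ofReal_comp (hGd w)).deriv]
      simp only [hF, norm_pow]
      gcongr
      have : (1 : ℂ) + Complex.cos (Real.pi * w) = ((1 + Real.cos (Real.pi * w) : ℝ) : ℂ) := by
        push_cast; rfl
      rw [this, Complex.norm_real, Real.norm_eq_abs, abs_le]
      constructor <;> linarith [Real.neg_one_le_cos (Real.pi * w), Real.cos_le_one (Real.pi * w)]
    have := Convex.norm_image_sub_le_of_norm_deriv_le (f := fun y : ℝ => G y)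
      (fun w _ => (hasDerivAt_ofReal_comp (hGd w)).differentiableAt) hb convex_univ
      (x := 0) (y := y) (by simp) (by simp)
    simp only [Complex.ofReal_zero, hG00, sub_zero] at this
    simp only [norm_div]
    rw [div_le_iff₀ (by linarith)]
    rw [Real.norm_eq_abs] at this
    have h0 : 0 ≤ |y| * 2 ^ M := by positivity
    nlinarith

lemma exists_div_pow {f : ℂ → ℂ} (hf : Differentiable ℂ f) (a : ℂ) (M : ℕ)
    (h : (M : ℕ∞) ≤ analyticOrderAt f a) :
    ∃ g : ℂ → ℂ, Differentiable ℂ g ∧ ∀ z, f z = (z - a) ^ M * g z := by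
  induction M with
  | zero => exact ⟨f, hf, by simp⟩
  | succ M ih =>
    obtain ⟨g, hg, hfg⟩ := ih (le_trans (by gcongr; omega) h)
    have hga : g a = 0 := by
      have hfeq : f = (fun z => (z - a)) ^ M * g := by funext z; simp [hfg]
      have hsub : AnalyticAt ℂ (fun z => z - a) a := by fun_prop
      have hsub1 : analyticOrderAt (fun z : ℂ => z - a) a = 1 := by
        have : AnalyticAt ℂ (fun z : ℂ => z - a) a := hsub
        rw [show (1 : ℕ∞) = ((1 : ℕ) : ℕ∞) by simp, this.analyticOrderAt_eq_natCast]
        exact ⟨fun _ => 1, analyticAt_const, by simp, by simp⟩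
      rw [hfeq, analyticOrderAt_mul (hsub.pow M) (hg.analyticAt a), analyticOrderAt_pow hsub,
        hsub1] at h
      by_contra hne
      have h0 : analyticOrderAt g a = 0 := by
        by_contra h1
        exact hne (((hg.analyticAt a).analyticOrderAt_ne_zero).1 h1)
      rw [h0, add_zero, nsmul_eq_mul, mul_one] at h
      have : M + 1 ≤ M := by exact_mod_cast h
      omega
    refine ⟨dslope g a, ?_, ?_⟩
    · have : DifferentiableOn ℂ (dslope g a) Set.univ :=
        (Complex.differentiableOn_dslope (by simp)).2 hg.differentiableOn
      exact differentiableOn_univ.1 this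
    · intro z
      have h1 := sub_smul_dslope g a z
      rw [smul_eq_mul, hga, sub_zero] at h1
      rw [hfg, pow_succ, mul_assoc, h1]

lemma exists_div_prod {f : ℂ → ℂ} (hf : Differentiable ℂ f) (M : ℕ) (Z : Finset ℂ)
    (h : ∀ l ∈ Z, (M : ℕ∞) ≤ analyticOrderAt f l) :
    ∃ g : ℂ → ℂ, Differentiable ℂ g ∧ ∀ z, f z = (∏ l ∈ Z, (z - l)) ^ M * g z := by
  classical
  induction Z using Finset.induction_on with
  | empty => exact ⟨f, hf, by simp⟩
  | insert a s ha ih =>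
    obtain ⟨g, hg, hfg⟩ := ih (fun l hl => h l (Finset.mem_insert_of_mem hl))
    have hord : (M : ℕ∞) ≤ analyticOrderAt g a := by
      have h1 := h a (Finset.mem_insert_self _ _)
      set q : ℂ → ℂ := fun z => (∏ l ∈ s, (z - l)) ^ M with hq
      have hqd : AnalyticAt ℂ q a := by
        have : Differentiable ℂ q := by simp only [hq]; fun_prop
        exact this.analyticAt a
      have hfeq : f = q * g := by funext z; simp [hfg, hq]
      have hq0 : analyticOrderAt q a = 0 := by
        by_contra hne
        have := (hqd.analyticOrderAt_ne_zero).1 hne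
        simp only [hq] at this
        rcases Nat.eq_zero_or_pos M with rfl | hM
        · simp at this
        · have h3 := eq_zero_of_pow_eq_zero this
          rw [Finset.prod_eq_zero_iff] at h3
          obtain ⟨l, hl, hl0⟩ := h3
          exact ha (by rwa [sub_eq_zero.1 hl0])
      rwa [hfeq, analyticOrderAt_mul hqd (hg.analyticAt a), hq0, zero_add] at h1
    obtain ⟨g', hg', hgg⟩ := exists_div_pow hg a M hord
    refine ⟨g', hg', fun z => ?_⟩
    rw [hfg, hgg, Finset.prod_insert ha, mul_pow]
    ring

/-- Schwarz lemma with a symmetric set of real zeros. -/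
lemma schwarz {f : ℂ → ℂ} (hf : Differentiable ℂ f) (M : ℕ) (Z : Finset ℝ)
    (hsym : ∀ l ∈ Z, -l ∈ Z) (A R H Q y : ℝ) (hA : ∀ l ∈ Z, |l| ≤ A) (hA0 : 0 ≤ A) (hAR : A < R)
    (h : ∀ l ∈ Z, (M : ℕ∞) ≤ analyticOrderAt f (l : ℂ))
    (hH : ∀ z : ℂ, ‖z‖ = R → ‖f z‖ ≤ H) (hyR : |y| ≤ R) (hyQ : y ^ 2 ≤ Q) (hAQ : A ^ 2 ≤ Q) :
    ‖f y‖ ^ 2 * (R ^ 2 - A ^ 2) ^ (M * Z.card) ≤ H ^ 2 * Q ^ (M * Z.card) := by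
  classical
  set Zc : Finset ℂ := Z.map ⟨fun x : ℝ => (x : ℂ), Complex.ofReal_injective⟩ with hZc
  obtain ⟨g, hg, hfg⟩ := exists_div_prod hf M Zc (by
    intro l hl
    simp only [hZc, Finset.mem_map, Function.Embedding.coeFn_mk] at hl
    obtain ⟨x, hx, rfl⟩ := hl
    exact h x hx)
  have hprod : ∀ z : ℂ, ∏ l ∈ Zc, (z - l) = ∏ l ∈ Z, (z - (l : ℂ)) := by
    intro z; simp [hZc, Finset.prod_map]
  have hneg : ∀ z : ℂ, ∏ l ∈ Z, (z - (l : ℂ)) = ∏ l ∈ Z, (z + (l : ℂ)) := by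
    intro z
    refine Finset.prod_nbij' (fun l => -l) (fun l => -l) hsym hsym (by simp) (by simp) ?_
    intro a _; simp [sub_eq_add_neg]
  have hsq : ∀ z : ℂ, ‖∏ l ∈ Z, (z - (l : ℂ))‖ ^ 2 = ∏ l ∈ Z, ‖z ^ 2 - (l : ℂ) ^ 2‖ := by
    intro z
    rw [sq]
    nth_rewrite 2 [hneg]
    rw [norm_prod, norm_prod, ← Finset.prod_mul_distrib]
    refine Finset.prod_congr rfl fun l _ => ?_
    rw [← norm_mul]; congr 1; ring
  have hR0 : 0 < R := lt_of_le_of_lt hA0 hAR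
  have hRA : 0 < R ^ 2 - A ^ 2 := by nlinarith
  have hlow : ∀ z : ℂ, ‖z‖ = R → (R ^ 2 - A ^ 2) ^ Z.card ≤ ‖∏ l ∈ Z, (z - (l : ℂ))‖ ^ 2 := by
    intro z hz
    rw [hsq, ← Finset.prod_const]
    refine Finset.prod_le_prod (fun _ _ => hRA.le) (fun l hl => ?_)
    have h1 := norm_sub_norm_le (z ^ 2) ((l : ℂ) ^ 2)
    rw [norm_pow, norm_pow, hz, Complex.norm_real, Real.norm_eq_abs] at h1
    have : |l| ^ 2 ≤ A ^ 2 := by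
      have := hA l hl
      have := abs_nonneg l
      gcongr
    linarith
  have hup : ‖∏ l ∈ Z, ((y : ℂ) - (l : ℂ))‖ ^ 2 ≤ Q ^ Z.card := by
    rw [hsq, ← Finset.prod_const]
    refine Finset.prod_le_prod (fun _ _ => norm_nonneg _) (fun l hl => ?_)
    have : ((y : ℂ) ^ 2 - (l : ℂ) ^ 2) = ((y ^ 2 - l ^ 2 : ℝ) : ℂ) := by push_cast; rfl
    rw [this, Complex.norm_real, Real.norm_eq_abs, abs_le]
    have h1 : l ^ 2 ≤ A ^ 2 := sq_le_sq' (by linarith [neg_le_of_abs_le (hA l hl)])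
      (le_of_abs_le (hA l hl))
    constructor <;> nlinarith [sq_nonneg y, sq_nonneg l]
  -- maximum principle for g
  have hH0 : 0 ≤ H := (norm_nonneg _).trans (hH (R : ℂ) (by simp [abs_of_pos hR0]))
  have hgb : ∀ z : ℂ, ‖z‖ = R → ‖g z‖ ≤ Real.sqrt (H ^ 2 / (R ^ 2 - A ^ 2) ^ (M * Z.card)) := by
    intro z hz
    apply Real.le_sqrt_of_sq_le
    rw [le_div_iff₀ (by positivity)]
    have h1 := hH z hz
    rw [hfg, hprod, norm_mul, norm_pow] at h1
    have h2 := hlow z hz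
    calc ‖g z‖ ^ 2 * (R ^ 2 - A ^ 2) ^ (M * Z.card)
        = ‖g z‖ ^ 2 * ((R ^ 2 - A ^ 2) ^ Z.card) ^ M := by rw [← pow_mul, mul_comm M]
      _ ≤ ‖g z‖ ^ 2 * (‖∏ l ∈ Z, (z - (l : ℂ))‖ ^ 2) ^ M := by gcongr
      _ = (‖∏ l ∈ Z, (z - (l : ℂ))‖ ^ M * ‖g z‖) ^ 2 := by ring
      _ ≤ H ^ 2 := by gcongr
  have hgy : ‖g y‖ ≤ Real.sqrt (H ^ 2 / (R ^ 2 - A ^ 2) ^ (M * Z.card)) := by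
    refine Complex.norm_le_of_forall_mem_frontier_norm_le (U := Metric.ball (0 : ℂ) R)
      Metric.isBounded_ball hg.diffContOnCl ?_ ?_
    · intro z hz
      rw [frontier_ball _ hR0.ne'] at hz
      exact hgb z (by simpa using hz)
    · rw [closure_ball _ hR0.ne']
      simpa using hyR
  have hgy2 : ‖g y‖ ^ 2 * (R ^ 2 - A ^ 2) ^ (M * Z.card) ≤ H ^ 2 := by
    rw [← le_div_iff₀ (by positivity)]
    calc ‖g y‖ ^ 2 ≤ (Real.sqrt (H ^ 2 / (R ^ 2 - A ^ 2) ^ (M * Z.card))) ^ 2 := by gcongr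
      _ = _ := Real.sq_sqrt (by positivity)
  have hQ0 : 0 ≤ Q := (sq_nonneg y).trans hyQ
  rw [hfg, hprod, norm_mul, norm_pow]
  calc (‖∏ l ∈ Z, ((y : ℂ) - (l : ℂ))‖ ^ M * ‖g y‖) ^ 2 * (R ^ 2 - A ^ 2) ^ (M * Z.card)
      = (‖∏ l ∈ Z, ((y : ℂ) - (l : ℂ))‖ ^ 2) ^ M *
        (‖g y‖ ^ 2 * (R ^ 2 - A ^ 2) ^ (M * Z.card)) := by ring
    _ ≤ (Q ^ Z.card) ^ M * H ^ 2 := by gcongr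
    _ = H ^ 2 * Q ^ (M * Z.card) := by rw [← pow_mul, mul_comm M]; ring

end BW


namespace BW
open Finset

/-- logarithm of the rational number with exponent vector `l`. -/
noncomputable def theta {P : Type} [Fintype P] (pr : P → ℕ) (l : P → ℤ) : ℝ :=
  ∑ p, (l p : ℝ) * Real.log (pr p)

/-- the rational number with exponent vector `l`. -/
noncomputable def rt {P : Type} [Fintype P] (pr : P → ℕ) (l : P → ℤ) : ℚ :=
  ∏ p, (pr p : ℚ) ^ (l p)

section
variable {P : Type} [Fintype P] {pr : P → ℕ}

lemma theta_add (a b : P → ℤ) : theta pr (a + b) = theta pr a + theta pr b := by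
  simp [theta, add_mul, Finset.sum_add_distrib]

lemma theta_sub (a b : P → ℤ) : theta pr (a - b) = theta pr a - theta pr b := by
  simp [theta, sub_mul, Finset.sum_sub_distrib]

lemma theta_zero : theta pr 0 = 0 := by simp [theta]

lemma theta_smul (k : ℤ) (a : P → ℤ) : theta pr (k • a) = k * theta pr a := by
  simp [theta, Finset.mul_sum, mul_assoc]

lemma theta_neg (a : P → ℤ) : theta pr (-a) = - theta pr a := by
  simp [theta, Finset.sum_neg_distrib]

lemma exp_theta (hp : ∀ p, (pr p).Prime) (l : P → ℤ) :
    Real.exp (theta pr l) = ((rt pr l : ℚ) : ℝ) := by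
  rw [theta, rt, Real.exp_sum]
  push_cast
  refine Finset.prod_congr rfl fun p _ => ?_
  have : (0 : ℝ) < pr p := by exact_mod_cast (hp p).pos
  rw [mul_comm, ← Real.rpow_def_of_pos this, Real.rpow_intCast]

lemma rt_pos (hp : ∀ p, (pr p).Prime) (l : P → ℤ) : 0 < rt pr l :=
  Finset.prod_pos fun p _ => zpow_pos (by exact_mod_cast (hp p).pos) _

/-- valuations -/
lemma padicVal_rt (hp : ∀ p, (pr p).Prime) (hinj : Function.Injective pr) (l : P → ℤ) (p : P) :
    padicValRat (pr p) (rt pr l) = l p := by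
  classical
  have : Fact (pr p).Prime := ⟨hp p⟩
  have key : ∀ s : Finset P, padicValRat (pr p) (∏ q ∈ s, (pr q : ℚ) ^ (l q)) =
      if p ∈ s then l p else 0 := by
    intro s
    induction s using Finset.induction_on with
    | empty => simp
    | insert a s ha ih =>
      rw [Finset.prod_insert ha, padicValRat.mul, ih, padicValRat.zpow]
      · by_cases h : p = a
        · subst h
          simp [ha, padicValRat.self (hp p).one_lt]
        · have h1 : padicValRat (pr p) (pr a : ℚ) = 0 := by
            rw [padicValRat.of_nat]
            have : Fact (pr a).Prime := ⟨hp a⟩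
            have := padicValNat_primes (p := pr p) (q := pr a) (fun h' => h (hinj h'))
            exact_mod_cast this
          simp [h1, h]
      · exact zpow_ne_zero _ (by exact_mod_cast (hp a).ne_zero)
      · exact Finset.prod_ne_zero_iff.2 fun q _ =>
          zpow_ne_zero _ (by exact_mod_cast (hp q).ne_zero)
  have h := key Finset.univ
  rw [if_pos (Finset.mem_univ p)] at h
  exact h

lemma rt_not_sq (hp : ∀ p, (pr p).Prime) (hinj : Function.Injective pr) (l : P → ℤ)
    (hl : ¬ ∃ ν : P → ℤ, l = 2 • ν) (b : ℚ) : b ^ 2 ≠ rt pr l := by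
  intro h
  apply hl
  refine ⟨fun p => padicValRat (pr p) b, ?_⟩
  funext p
  have : Fact (pr p).Prime := ⟨hp p⟩
  rw [← padicVal_rt hp hinj l p, ← h, padicValRat.pow]
  simp

/-- `exp (theta l / 2)` -/
noncomputable def sqt (pr : P → ℕ) (l : P → ℤ) : ℝ := Real.exp (theta pr l / 2)

lemma sqt_pos (l : P → ℤ) : 0 < sqt pr l := Real.exp_pos _

lemma sqt_add (a b : P → ℤ) : sqt pr (a + b) = sqt pr a * sqt pr b := by
  rw [sqt, sqt, sqt, ← Real.exp_add, theta_add, add_div]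

lemma sqt_two (hp : ∀ p, (pr p).Prime) (a : P → ℤ) : sqt pr (2 • a) = ((rt pr a : ℚ) : ℝ) := by
  rw [sqt, ← exp_theta hp, show (2 • a) = a + a from two_nsmul a, theta_add]; congr 1; ring

lemma sqt_sq (hp : ∀ p, (pr p).Prime) (a : P → ℤ) : sqt pr a ^ 2 = ((rt pr a : ℚ) : ℝ) := by
  rw [sqt, ← exp_theta hp, ← Real.exp_nat_mul]; congr 1; push_cast; ring

/-- The multiquadratic field. -/
lemma exists_field (hp : ∀ p, (pr p).Prime) (𝓛 : AddSubgroup (P → ℤ)) (D : ℕ)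
    (rep : Fin D → P → ℤ) (hrep : ∀ μ ∈ 𝓛, ∃ i, ∃ ν, μ = rep i + 2 • ν) :
    ∃ K : IntermediateField ℚ ℝ, FiniteDimensional ℚ K ∧ Module.finrank ℚ K ≤ D ∧
      ∀ μ ∈ 𝓛, sqt pr μ ∈ K := by
  set S : Set ℝ := (sqt pr) '' (𝓛 : Set (P → ℤ)) with hS
  have hSalg : ∀ x ∈ S, IsAlgebraic ℚ x := by
    rintro _ ⟨μ, _, rfl⟩
    rw [isAlgebraic_iff_isIntegral]
    refine IsIntegral.of_pow (n := 2) (by norm_num) ?_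
    rw [sqt_sq hp]
    exact isIntegral_algebraMap (R := ℚ) (x := rt pr μ)
  set W : Submodule ℚ ℝ := Submodule.span ℚ (Set.range fun i => sqt pr (rep i)) with hW
  have hcl : (Submonoid.closure S : Set ℝ) = S := by
    let M : Submonoid ℝ :=
      { carrier := S
        one_mem' := ⟨0, 𝓛.zero_mem, by simp [sqt, theta_zero]⟩
        mul_mem' := by
          rintro _ _ ⟨a, ha, rfl⟩ ⟨b, hb, rfl⟩
          exact ⟨a + b, 𝓛.add_mem ha hb, sqt_add a b⟩ }
    have : Submonoid.closure S = M := Submonoid.closure_eq M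
    rw [this]; rfl
  set K := IntermediateField.adjoin ℚ S with hK
  have hle : Subalgebra.toSubmodule K.toSubalgebra ≤ W := by
    rw [hK, IntermediateField.adjoin_toSubalgebra_of_isAlgebraic hSalg, Algebra.adjoin_eq_span, hcl,
      Submodule.span_le]
    rintro _ ⟨μ, hμ, rfl⟩
    obtain ⟨i, ν, h⟩ := hrep μ hμ
    rw [h, sqt_add, sqt_two hp, mul_comm]
    have : sqt pr (rep i) ∈ W := Submodule.subset_span ⟨i, rfl⟩
    have h2 := W.smul_mem (rt pr ν) this
    rwa [Rat.smul_def] at h2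
  have : Module.Finite ℚ W := Module.Finite.span_of_finite ℚ (Set.finite_range _)
  have hfin : FiniteDimensional ℚ (Subalgebra.toSubmodule K.toSubalgebra) :=
    Submodule.finiteDimensional_of_le hle
  refine ⟨K, hfin, ?_, ?_⟩
  · have h1 : Module.finrank ℚ (Subalgebra.toSubmodule K.toSubalgebra) ≤ Module.finrank ℚ W :=
      Submodule.finrank_mono hle
    have h2 : Module.finrank ℚ W ≤ D := by
      have := finrank_range_le_card (R := ℚ) (fun i => sqt pr (rep i))
      simpa [Set.finrank] using this
    exact h1.trans h2
  · intro μ hμ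
    exact IntermediateField.subset_adjoin ℚ S ⟨μ, hμ, rfl⟩

lemma rt_nat (e : P → ℤ) (he : ∀ p, 0 ≤ e p) : ∃ N : ℕ, rt pr e = N := by
  refine ⟨∏ p, (pr p) ^ (e p).toNat, ?_⟩
  rw [rt]; push_cast
  refine Finset.prod_congr rfl fun p _ => ?_
  rw [← zpow_natCast, Int.toNat_of_nonneg (he p)]

/-- Liouville inequality for multiquadratic numbers. -/
lemma liouville (hp : ∀ p, (pr p).Prime) (𝓛 : AddSubgroup (P → ℤ)) (D : ℕ)
    (rep : Fin D → P → ℤ) (hrep : ∀ μ ∈ 𝓛, ∃ i, ∃ ν, μ = rep i + 2 • ν)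
    {ι : Type} (I : Finset ι) (A : ι → ℤ) (μ : ι → P → ℤ) (hμ : ∀ i ∈ I, μ i ∈ 𝓛)
    (e : P → ℤ) (he : ∀ i ∈ I, ∀ p, 0 ≤ e p + μ i p)
    (hx : ∑ i ∈ I, A i * sqt pr (μ i) ≠ 0) (H : ℝ) (hH : ∑ i ∈ I, |(A i : ℝ)| * sqt pr (μ i) ≤ H) :
    1 ≤ |∑ i ∈ I, A i * sqt pr (μ i)| * H ^ (D - 1) * sqt pr e ^ D := by
  obtain ⟨K, hKf, hKD, hKm⟩ := exists_field hp 𝓛 D rep hrep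
  have := hKf
  have : NumberField K := { to_charZero := inferInstance, to_finiteDimensional := hKf }
  set x : ℝ := ∑ i ∈ I, A i * sqt pr (μ i) with hxdef
  have hxK : x ∈ K := sum_mem fun i hi => mul_mem (intCast_mem K (A i)) (hKm _ (hμ i hi))
  let xK : K := ⟨x, hxK⟩
  let yK : K := (algebraMap ℚ K (rt pr e)) * xK ^ 2
  have hcpos : 0 < sqt pr e := sqt_pos e
  have hyK : ((yK : K) : ℝ) = (sqt pr e * x) ^ 2 := by
    simp only [yK, xK]
    rw [mul_pow, sqt_sq hp]; rfl
  have hy_int : IsIntegral ℤ yK := by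
    have h1 : IsIntegral ℤ (sqt pr e * x) := by
      rw [hxdef, Finset.mul_sum]
      refine IsIntegral.sum _ fun i hi => ?_
      rw [show sqt pr e * (A i * sqt pr (μ i)) = A i * sqt pr (e + μ i) by rw [sqt_add]; ring]
      refine IsIntegral.mul (isIntegral_algebraMap (R := ℤ) (x := A i)) ?_
      refine IsIntegral.of_pow (n := 2) (by norm_num) ?_
      obtain ⟨N, hN⟩ := rt_nat (pr := pr) (e + μ i) (fun p => by simpa using he i hi p)
      rw [sqt_sq hp, hN]
      have := isIntegral_algebraMap (R := ℤ) (A := ℝ) (x := (N : ℤ))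
      simpa using this
    have h2 : IsIntegral ℤ ((yK : K) : ℝ) := by rw [hyK]; exact h1.pow 2
    have hinj : Function.Injective (K.val.restrictScalars ℤ) := Subtype.val_injective
    exact (isIntegral_algHom_iff (K.val.restrictScalars ℤ) hinj).1 h2
  have hyne : yK ≠ 0 := by
    intro h
    have h2 : ((yK : K) : ℝ) = 0 := by rw [h]; rfl
    rw [hyK] at h2
    have := eq_zero_of_pow_eq_zero h2
    rcases mul_eq_zero.1 this with h3 | h3
    · exact hcpos.ne' h3
    · exact hx h3
  obtain ⟨N, hN⟩ := IsIntegrallyClosed.isIntegral_iff.1 (Algebra.isIntegral_norm ℚ hy_int)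
  have hNne : N ≠ 0 := by
    rintro rfl
    rw [map_zero] at hN
    exact hyne (Algebra.norm_eq_zero_iff.1 hN.symm)
  have hprod := Algebra.norm_eq_prod_embeddings ℚ ℂ yK
  have hH0 : 0 ≤ H := le_trans (Finset.sum_nonneg fun i _ =>
    mul_nonneg (abs_nonneg _) (sqt_pos (pr := pr) (μ i)).le) hH
  -- bounds for the conjugates
  have hconj : ∀ σ : K →ₐ[ℚ] ℂ, ‖σ xK‖ ≤ H := by
    intro σ
    have hxs : xK = ∑ i ∈ I.attach, (A i : K) * ⟨sqt pr (μ i), hKm _ (hμ i i.2)⟩ := by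
      apply Subtype.ext
      simp only [xK, hxdef]
      push_cast
      rw [← Finset.sum_attach]
    rw [hxs, map_sum]
    refine (norm_sum_le _ _).trans ?_
    refine le_trans (le_of_eq ?_) hH
    rw [← Finset.sum_attach I (fun i => |(A i : ℝ)| * sqt pr (μ i))]
    refine Finset.sum_congr rfl fun i _ => ?_
    rw [map_mul, norm_mul, map_intCast, Complex.norm_intCast]
    congr 1
    have h2 : (⟨sqt pr (μ i), hKm _ (hμ i i.2)⟩ : K) ^ 2 = algebraMap ℚ K (rt pr (μ i)) := by
      apply Subtype.ext
      push_cast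
      rw [sqt_sq hp]; rfl
    have h3 := congrArg (fun z => ‖σ z‖) h2
    simp only [map_pow, norm_pow, AlgHom.commutes] at h3
    have h4 : ‖(algebraMap ℚ ℂ) (rt pr (μ i))‖ = sqt pr (μ i) ^ 2 := by
      rw [sqt_sq hp]
      have : (algebraMap ℚ ℂ) (rt pr (μ i)) = (((rt pr (μ i) : ℚ) : ℝ) : ℂ) := by simp
      rw [this, Complex.norm_real, Real.norm_of_nonneg]
      exact_mod_cast (rt_pos hp _).le
    rw [h4] at h3
    exact (pow_left_inj₀ (norm_nonneg _) (sqt_pos _).le two_ne_zero).1 h3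
  have hσy : ∀ σ : K →ₐ[ℚ] ℂ, ‖σ yK‖ = (sqt pr e * ‖σ xK‖) ^ 2 := by
    intro σ
    simp only [yK]
    rw [map_mul, AlgHom.commutes, map_pow, norm_mul, norm_pow, mul_pow, sqt_sq hp]
    congr 1
    have : (algebraMap ℚ ℂ) (rt pr e) = (((rt pr e : ℚ) : ℝ) : ℂ) := by simp
    rw [this, Complex.norm_real, Real.norm_of_nonneg]
    exact_mod_cast (rt_pos hp _).le
  let σ0 : K →ₐ[ℚ] ℂ := (Complex.ofRealAm.restrictScalars ℚ).comp K.val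
  have hσ0 : ‖σ0 xK‖ = |x| := by
    have : σ0 xK = (x : ℂ) := rfl
    rw [this, Complex.norm_real, Real.norm_eq_abs]
  classical
  set δ := Module.finrank ℚ K with hδ
  have hcard : Fintype.card (K →ₐ[ℚ] ℂ) = δ := AlgHom.card ℚ K ℂ
  have hδpos : 1 ≤ δ := Module.finrank_pos
  have hmain : 1 ≤ (sqt pr e * |x|) ^ 2 * ((sqt pr e * H) ^ 2) ^ (δ - 1) := by
    have h1 : (1 : ℝ) ≤ ‖(algebraMap ℚ ℂ) (Algebra.norm ℚ yK)‖ := by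
      rw [← hN]
      simp only [algebraMap_int_eq, eq_intCast, map_intCast, Complex.norm_intCast]
      exact_mod_cast Int.one_le_abs hNne
    rw [hprod, norm_prod, ← Finset.mul_prod_erase _ _ (Finset.mem_univ σ0), hσy, hσ0] at h1
    refine h1.trans ?_
    gcongr
    calc ∏ σ ∈ univ.erase σ0, ‖σ yK‖ ≤ ∏ σ ∈ univ.erase σ0, (sqt pr e * H) ^ 2 := by
          refine Finset.prod_le_prod (fun _ _ => norm_nonneg _) fun σ _ => ?_
          rw [hσy]
          have := hconj σ
          gcongr
      _ = _ := by
          rw [Finset.prod_const, Finset.card_erase_of_mem (Finset.mem_univ _), Finset.card_univ,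
            hcard]
  have hmain2 : 1 ≤ (sqt pr e * |x|) * (sqt pr e * H) ^ (δ - 1) := by
    have : ((sqt pr e * |x|) * (sqt pr e * H) ^ (δ - 1)) ^ 2 =
      (sqt pr e * |x|) ^ 2 * ((sqt pr e * H) ^ 2) ^ (δ - 1) := by ring
    rw [← this] at hmain
    exact (one_le_sq_iff₀ (by positivity)).1 hmain
  have hxH : |x| ≤ H := by rw [← hσ0]; exact hconj σ0
  have hcH : 1 ≤ sqt pr e * H := by
    by_contra hlt
    push Not at hlt
    have h1 : (sqt pr e * H) ^ (δ - 1) ≤ 1 := pow_le_one₀ (by positivity) hlt.le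
    have h2 : sqt pr e * |x| < 1 := lt_of_le_of_lt (by gcongr) hlt
    have h3 : 0 ≤ sqt pr e * |x| := by positivity
    nlinarith [pow_nonneg (show 0 ≤ sqt pr e * H by positivity) (δ - 1)]
  calc (1 : ℝ) ≤ (sqt pr e * |x|) * (sqt pr e * H) ^ (δ - 1) := hmain2
    _ ≤ (sqt pr e * |x|) * (sqt pr e * H) ^ (D - 1) := by
        have := pow_le_pow_right₀ hcH (show δ - 1 ≤ D - 1 by omega)
        gcongr
    _ = |x| * H ^ (D - 1) * sqt pr e ^ (D - 1 + 1) := by ring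
    _ = _ := by rw [Nat.sub_add_cancel (hδpos.trans hKD)]

lemma trace_sq_zero (K : IntermediateField ℚ ℝ) [FiniteDimensional ℚ K] (r : ℚ)
    (hr : ∀ b : ℚ, b ^ 2 ≠ r) (x : K) (hx : x ^ 2 = algebraMap ℚ K r) :
    Algebra.trace ℚ K x = 0 := by
  rw [trace_eq_finrank_mul_minpoly_nextCoeff]
  have hirr := X_pow_sub_C_irreducible_of_prime Nat.prime_two hr
  have hmin := minpoly.eq_of_irreducible_of_monic (x := x) hirr (by simp [hx])
    (Polynomial.monic_X_pow_sub_C _ two_ne_zero)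
  rw [← hmin, Polynomial.nextCoeff_of_natDegree_pos (by simp)]
  simp [Polynomial.coeff_X_pow]

/-- Independence of square roots: each class modulo 2 contributes zero. -/
lemma sqrt_indep (hp : ∀ p, (pr p).Prime) (hinj : Function.Injective pr)
    {ι : Type} (I : Finset ι) (A : ι → ℚ) (μ : ι → P → ℤ)
    (hx : ∑ i ∈ I, (A i : ℝ) * sqt pr (μ i) = 0) (i0 : ι)
    [DecidablePred fun i => ∃ ν, μ i - μ i0 = 2 • ν] :
    ∑ i ∈ I with ∃ ν, μ i - μ i0 = 2 • ν, (A i : ℝ) * sqt pr (μ i) = 0 := by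
  classical
  let e := Fintype.equivFin (P → Fin 2)
  obtain ⟨K, hKf, -, hKm⟩ := exists_field hp (⊤ : AddSubgroup (P → ℤ)) _
    (fun k p => ((e.symm k p : Fin 2) : ℤ)) (by
      intro μ _
      refine ⟨e fun p => ⟨(μ p % 2).toNat, by omega⟩, fun p => μ p / 2, ?_⟩
      funext p
      have h2 : (2 • fun p => μ p / 2 : P → ℤ) p = 2 * (μ p / 2) := by
        rw [Pi.smul_apply, nsmul_eq_mul]; rfl
      rw [Pi.add_apply, h2]
      simp only [Equiv.symm_apply_apply]
      omega)
  have := hKf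
  let g : (P → ℤ) → K := fun ν => ⟨sqt pr ν, hKm ν trivial⟩
  have hx2 : ∑ i ∈ I, A i • g (μ i - μ i0) = 0 := by
    apply Subtype.ext
    have h1 : ∀ i, (((A i • g (μ i - μ i0) : K)) : ℝ) = (A i : ℝ) * sqt pr (μ i) * sqt pr (-μ i0) := by
      intro i
      have : (((A i • g (μ i - μ i0) : K)) : ℝ) = (A i : ℝ) * sqt pr (μ i - μ i0) := by
        show A i • (sqt pr (μ i - μ i0)) = _
        rw [Rat.smul_def]
      rw [this, sub_eq_add_neg, sqt_add]; ring
    rw [AddSubmonoidClass.coe_finset_sum, Finset.sum_congr rfl fun i _ => h1 i, ← Finset.sum_mul, hx, zero_mul]; rfl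
  have htr := congrArg (Algebra.trace ℚ K) hx2
  rw [map_sum, map_zero] at htr
  have hodd : ∀ i ∈ I, (¬ ∃ ν, μ i - μ i0 = 2 • ν) →
      Algebra.trace ℚ K (A i • g (μ i - μ i0)) = 0 := by
    intro i _ h
    rw [map_smul, trace_sq_zero K (rt pr (μ i - μ i0)) (rt_not_sq hp hinj _ h), smul_zero]
    apply Subtype.ext
    show sqt pr _ ^ 2 = _
    rw [sqt_sq hp]; rfl
  rw [← Finset.sum_filter_add_sum_filter_not I (fun i => ∃ ν, μ i - μ i0 = 2 • ν),
    Finset.sum_eq_zero (s := filter (fun i => ¬ ∃ ν, μ i - μ i0 = 2 • ν) I) (fun i hi => by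
      rw [Finset.mem_filter] at hi
      exact hodd i hi.1 hi.2), add_zero] at htr
  have heven : ∀ i ∈ I.filter (fun i => ∃ ν, μ i - μ i0 = 2 • ν), ∃ r : ℚ, (r : ℝ) = sqt pr (μ i - μ i0) ∧
      Algebra.trace ℚ K (A i • g (μ i - μ i0)) = (Module.finrank ℚ K : ℚ) * (A i * r) := by
    intro i hi
    rw [Finset.mem_filter] at hi
    obtain ⟨ν, hν⟩ := hi.2
    refine ⟨rt pr ν, ?_, ?_⟩
    · rw [hν, sqt_two hp]
    · have : A i • g (μ i - μ i0) = algebraMap ℚ K (A i * rt pr ν) := by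
        apply Subtype.ext
        show A i • (sqt pr (μ i - μ i0)) = (((A i * rt pr ν) : ℚ) : ℝ)
        rw [Rat.smul_def, hν, sqt_two hp]; push_cast; rfl
      rw [this, Algebra.trace_algebraMap, nsmul_eq_mul]
  choose! r hr1 hr2 using heven
  rw [Finset.sum_congr rfl hr2, ← Finset.mul_sum] at htr
  have hfr : (Module.finrank ℚ K : ℚ) ≠ 0 := by
    have : 0 < Module.finrank ℚ K := Module.finrank_pos
    exact_mod_cast this.ne'
  have h0 := (mul_eq_zero.1 htr).resolve_left hfr
  have h0' : ∑ i ∈ I with ∃ ν, μ i - μ i0 = 2 • ν, (A i : ℝ) * (r i : ℝ) = 0 := by exact_mod_cast h0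
  calc _ = ∑ i ∈ I with ∃ ν, μ i - μ i0 = 2 • ν, ((A i : ℝ) * (r i : ℝ)) * sqt pr (μ i0) := by
        refine Finset.sum_congr rfl fun i hi => ?_
        rw [hr1 i hi, mul_assoc, ← sqt_add]; simp
    _ = 0 := by rw [← Finset.sum_mul, h0', zero_mul]

end
end BW


namespace BW
open Polynomial Finset

lemma smeval_eq_eval₂_aux {R : Type*} [CommRing R] (x : R) (p : ℤ[X]) :
    p.smeval x = p.eval₂ (Int.castRingHom R) x := by
  rw [← Polynomial.aeval_eq_smeval, Polynomial.aeval_def]; rfl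

lemma fact_mul_choose {R : Type*} [CommRing R] [BinomialRing R] (x : R) (a : ℕ) :
    (a.factorial : R) * Ring.choose x a = ∏ i ∈ range a, (x - i) := by
  have h := Ring.descPochhammer_eq_factorial_smul_choose x a
  rw [nsmul_eq_mul] at h
  rw [← h, ← descPochhammer_eval_eq_prod_range, ← descPochhammer_map (Int.castRingHom R),
    eval_map, smeval_eq_eval₂_aux x]

/-- integer polynomials inside `ℚ[X]` -/
noncomputable abbrev ZP : Subring ℚ[X] := Polynomial.liftsRing (Int.castRingHom ℚ)

lemma C_int_mem (k : ℤ) : (C (k : ℚ)) ∈ ZP := by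
  refine ⟨C k, ?_⟩; simp

lemma X_mem_ZP : (X : ℚ[X]) ∈ ZP := ⟨X, by simp⟩

lemma coeff_of_mem_ZP {p : ℚ[X]} (hp : p ∈ ZP) (j : ℕ) : ∃ k : ℤ, p.coeff j = k := by
  obtain ⟨q, rfl⟩ := hp
  exact ⟨q.coeff j, by simp⟩

lemma choose_dX_mem (d : ℕ) (a : ℕ) (hd : ∀ i, 1 ≤ i → i ≤ a → i ∣ d) :
    Ring.choose (C (d : ℚ) * X) a ∈ ZP := by
  cases a with
  | zero => rw [Ring.choose_zero_right]; exact one_mem _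
  | succ a =>
    have h1 : (a.factorial : ℚ[X]) * ∏ i ∈ range a, (C ((d / (i + 1) : ℕ) : ℚ) * X - 1) =
        ∏ i ∈ range a, (C (d : ℚ) * X - ((i + 1 : ℕ) : ℚ[X])) := by
      have : (a.factorial : ℚ[X]) = ∏ i ∈ range a, ((i + 1 : ℕ) : ℚ[X]) := by
        rw [← Finset.prod_range_add_one_eq_factorial]; push_cast; rfl
      rw [this, ← Finset.prod_mul_distrib]
      refine Finset.prod_congr rfl fun i hi => ?_
      have hi' := Finset.mem_range.1 hi
      obtain ⟨k, hk⟩ := hd (i + 1) (by omega) (by omega)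
      rw [hk, Nat.mul_div_cancel_left _ (by omega)]
      simp only [Nat.cast_mul, map_mul, map_natCast]
      push_cast
      ring
    have h2 : ((a + 1).factorial : ℚ[X]) * Ring.choose (C (d : ℚ) * X) (a + 1) =
        ((a + 1).factorial : ℚ[X]) * (C ((d / (a + 1) : ℕ) : ℚ) * X *
          ∏ i ∈ range a, (C ((d / (i + 1) : ℕ) : ℚ) * X - 1)) := by
      rw [fact_mul_choose, Finset.prod_range_succ', ← h1, Nat.factorial_succ]
      obtain ⟨k, hk⟩ := hd (a + 1) (by omega) le_rfl
      have h3 : ((d : ℕ) : ℚ[X]) = ((a + 1 : ℕ) : ℚ[X]) * ((d / (a + 1) : ℕ) : ℚ[X]) := by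
        rw [hk, Nat.mul_div_cancel_left _ (by omega)]; push_cast; ring
      simp only [map_natCast, Nat.cast_mul, Nat.cast_zero, sub_zero]
      rw [h3]; ring
    have hne : ((a + 1).factorial : ℚ[X]) ≠ 0 := by exact_mod_cast (Nat.factorial_ne_zero _)
    rw [mul_left_cancel₀ hne h2]
    refine mul_mem (mul_mem (C_int_mem ((d / (a + 1) : ℕ) : ℤ)) X_mem_ZP) ?_
    exact prod_mem fun i _ => sub_mem (mul_mem (C_int_mem ((d / (i + 1) : ℕ) : ℤ)) X_mem_ZP)
      (one_mem _)

/-- Feldman polynomials -/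
noncomputable def Bp (k0 r : ℕ) : ℚ[X] :=
  Ring.choose X k0 ^ (r / k0) * Ring.choose X (r % k0)

lemma Bp_integral (k0 : ℕ) (d : ℕ) (hd : ∀ i, 1 ≤ i → i ≤ k0 → i ∣ d) (hk0 : 0 < k0)
    (c : ℕ) (x0 : ℚ) (hc : ∀ a, ∃ k : ℤ, (c : ℚ) ^ a * Ring.choose x0 a = k) (r j : ℕ) :
    ∃ k : ℤ, (c : ℚ) ^ r * (d : ℚ) ^ j * (hasseDeriv j (Bp k0 r)).eval x0 = k := by
  have hb : ∀ i ≤ k0, C ((c : ℚ) ^ i) * Ring.choose (C (d : ℚ) * X + C x0) i ∈ ZP := by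
    intro i hi
    rw [Ring.add_choose_eq i (Commute.all _ _), Finset.mul_sum]
    refine sum_mem fun ab hab => ?_
    rw [HasAntidiagonal.mem_antidiagonal] at hab
    rw [← Ring.map_choose C x0]
    obtain ⟨k, hk⟩ := hc ab.2
    have : C ((c : ℚ) ^ i) * (Ring.choose (C (d : ℚ) * X) ab.1 * C (Ring.choose x0 ab.2)) =
        C (((c ^ ab.1 : ℕ) : ℤ) : ℚ) * C (k : ℚ) * Ring.choose (C (d : ℚ) * X) ab.1 := by
      rw [← hk, ← hab, pow_add]
      simp only [map_mul, Int.cast_natCast, Nat.cast_pow, Int.cast_pow]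
      ring
    rw [this]
    exact mul_mem (mul_mem (C_int_mem _) (C_int_mem _))
      (choose_dX_mem d _ fun i h1 h2 => hd i h1 (by omega))
  have hcomp : ∀ i, (Ring.choose (X : ℚ[X]) i).comp (C (d : ℚ) * X + C x0) =
      Ring.choose (C (d : ℚ) * X + C x0) i := by
    intro i
    have := Ring.map_choose (compRingHom (C (d : ℚ) * X + C x0)) (X : ℚ[X]) i
    simpa using this
  have hmem : C ((c : ℚ) ^ r) * (Bp k0 r).comp (C (d : ℚ) * X + C x0) ∈ ZP := by
    have : C ((c : ℚ) ^ r) * (Bp k0 r).comp (C (d : ℚ) * X + C x0) =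
        (C ((c : ℚ) ^ k0) * Ring.choose (C (d : ℚ) * X + C x0) k0) ^ (r / k0) *
        (C ((c : ℚ) ^ (r % k0)) * Ring.choose (C (d : ℚ) * X + C x0) (r % k0)) := by
      rw [Bp, mul_comp, pow_comp, hcomp, hcomp]
      nth_rewrite 1 [← Nat.div_add_mod r k0]
      rw [pow_add, pow_mul, map_mul, map_pow C ((c : ℚ) ^ k0)]
      ring
    rw [this]
    exact mul_mem (pow_mem (hb k0 le_rfl) _) (hb _ (Nat.mod_lt _ hk0).le)
  obtain ⟨k, hk⟩ := coeff_of_mem_ZP hmem j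
  refine ⟨k, ?_⟩
  rw [← hk, coeff_C_mul]
  have h1 : (Bp k0 r).comp (C (d : ℚ) * X + C x0) = (taylor x0 (Bp k0 r)).comp (C (d : ℚ) * X) := by
    rw [taylor_apply, comp_assoc]; simp
  rw [h1, comp_C_mul_X_coeff, taylor_coeff]
  ring

lemma choose_int (l : ℤ) (a : ℕ) : ∃ k : ℤ, ((1 : ℕ) : ℚ) ^ a * Ring.choose (l : ℚ) a = k := by
  refine ⟨Ring.choose l a, ?_⟩
  have := Ring.map_choose (Int.castRingHom ℚ) l a
  simp only [eq_intCast] at this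
  rw [this]; simp

lemma choose_half (J : ℕ) (l : ℤ) (a : ℕ) :
    ∃ k : ℤ, ((2 ^ (J + 1) : ℕ) : ℚ) ^ a * Ring.choose ((l : ℚ) / 2 ^ J) a = k := by
  obtain ⟨v, o, ho, hfac⟩ := Nat.exists_eq_two_pow_mul_odd (Nat.factorial_ne_zero a)
  have hv : v ≤ a := by
    have h1 := sub_one_mul_padicValNat_factorial (p := 2) a
    have : padicValNat 2 a.factorial = v := by
      rw [hfac, padicValNat.mul (by positivity) (by rintro rfl; simp at ho)]
      have : padicValNat 2 o = 0 := padicValNat.eq_zero_of_not_dvd (by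
        rw [← even_iff_two_dvd]; exact Nat.not_even_iff_odd.2 ho)
      simp [this]
    rw [this] at h1
    omega
  set N : ℤ := ∏ i ∈ range a, (l - i * 2 ^ J) with hN
  have hcop : IsCoprime ((2 : ℤ) ^ J) (o : ℤ) := by
    apply IsCoprime.pow_left
    have : Nat.Coprime 2 o := (Nat.coprime_two_left).2 ho
    exact_mod_cast Nat.isCoprime_iff_coprime.2 this
  obtain ⟨u, w, huw⟩ := hcop
  have hmod : (u ^ a * N) ≡ ∏ i ∈ range a, (u * l - i) [ZMOD o] := by
    have : u ^ a * N = ∏ i ∈ range a, (u * (l - i * 2 ^ J)) := by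
      rw [Finset.prod_mul_distrib, Finset.prod_const, card_range]
    rw [this]
    refine Int.ModEq.prod fun i _ => ?_
    have : u * (l - i * 2 ^ J) = (u * l - i) + o * (w * i) := by
      linear_combination (-(i : ℤ)) * huw
    rw [this]
    simp [Int.ModEq]
  have hdvd : (o : ℤ) ∣ u ^ a * N := by
    rw [(Int.modEq_zero_iff_dvd).symm]
    refine hmod.trans ((Int.modEq_zero_iff_dvd).2 ?_)
    rw [← fact_mul_choose, hfac]
    push_cast
    exact Dvd.dvd.mul_right (Dvd.intro_left _ rfl) _
  have hcu : IsCoprime (o : ℤ) (u ^ a) := by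
    apply IsCoprime.pow_right
    exact ⟨w, 2 ^ J, by linear_combination huw⟩
  obtain ⟨M, hM⟩ := hcu.dvd_of_dvd_mul_left hdvd
  refine ⟨2 ^ (a - v) * M, ?_⟩
  have hfne : ((a.factorial : ℕ) : ℚ) ≠ 0 := by exact_mod_cast Nat.factorial_ne_zero a
  apply mul_left_cancel₀ hfne
  have hp : ((2 : ℚ) ^ J) ^ a * ∏ i ∈ range a, ((l : ℚ) / 2 ^ J - i) = (N : ℚ) := by
    rw [hN, ← card_range a, ← Finset.prod_const, card_range, ← Finset.prod_mul_distrib]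
    push_cast
    refine Finset.prod_congr rfl fun i _ => ?_
    field_simp
  calc (a.factorial : ℚ) * (((2 ^ (J + 1) : ℕ) : ℚ) ^ a * Ring.choose ((l : ℚ) / 2 ^ J) a)
      = ((2 ^ (J + 1) : ℕ) : ℚ) ^ a * ((a.factorial : ℚ) * Ring.choose ((l : ℚ) / 2 ^ J) a) := by ring
    _ = 2 ^ a * (((2 : ℚ) ^ J) ^ a * ∏ i ∈ range a, ((l : ℚ) / 2 ^ J - i)) := by
        rw [fact_mul_choose]; push_cast; rw [pow_succ, mul_pow]; ring
    _ = 2 ^ a * N := by rw [hp]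
    _ = _ := by
        rw [hM, hfac]; push_cast
        rw [show (2 : ℚ) ^ a = 2 ^ v * 2 ^ (a - v) by rw [← pow_add]; congr 1; omega]
        ring

lemma choose_X_eq (a : ℕ) : Ring.choose (X : ℚ[X]) a =
    C ((a.factorial : ℚ)⁻¹) * ∏ i ∈ range a, (X - C (i : ℚ)) := by
  have h := fact_mul_choose (X : ℚ[X]) a
  have hfne : (a.factorial : ℚ) ≠ 0 := by exact_mod_cast Nat.factorial_ne_zero a
  have : ∏ i ∈ range a, ((X : ℚ[X]) - C (i : ℚ)) = ∏ i ∈ range a, ((X : ℚ[X]) - i) := by simp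
  rw [this, ← h, ← mul_assoc, ← map_natCast C, ← map_mul, inv_mul_cancel₀ hfne]
  simp

lemma choose_X_natDegree (a : ℕ) : (Ring.choose (X : ℚ[X]) a).natDegree = a := by
  rw [choose_X_eq, natDegree_C_mul (by
    have : (a.factorial : ℚ) ≠ 0 := by exact_mod_cast Nat.factorial_ne_zero a
    exact inv_ne_zero this), natDegree_prod _ _ fun i _ => X_sub_C_ne_zero _]
  simp only [natDegree_X_sub_C, sum_const, card_range, smul_eq_mul, mul_one]

lemma choose_X_ne (a : ℕ) : Ring.choose (X : ℚ[X]) a ≠ 0 := by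
  rw [choose_X_eq]
  refine mul_ne_zero ?_ (Finset.prod_ne_zero_iff.2 fun i _ => X_sub_C_ne_zero _)
  have : (a.factorial : ℚ) ≠ 0 := by exact_mod_cast Nat.factorial_ne_zero a
  simpa using this

lemma Bp_ne (k0 r : ℕ) : Bp k0 r ≠ 0 := mul_ne_zero (pow_ne_zero _ (choose_X_ne _)) (choose_X_ne _)

lemma Bp_natDegree (k0 r : ℕ) : (Bp k0 r).natDegree = r := by
  rw [Bp, natDegree_mul (pow_ne_zero _ (choose_X_ne _)) (choose_X_ne _), natDegree_pow,
    choose_X_natDegree, choose_X_natDegree, mul_comm, Nat.div_add_mod]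

/-- A nontrivial combination of Feldman polynomials is nonzero. -/
lemma Bp_combo_ne (k0 L0 : ℕ) (c : ℕ → ℚ) (h : ∃ r < L0, c r ≠ 0) :
    ∑ r ∈ range L0, C (c r) * Bp k0 r ≠ 0 := by
  classical
  obtain ⟨r, ⟨hr, hcr⟩, hmax⟩ : ∃ r, (r < L0 ∧ c r ≠ 0) ∧ ∀ r', r' < L0 → c r' ≠ 0 → r' ≤ r := by
    set S := (range L0).filter fun r => c r ≠ 0 with hS
    have hne : S.Nonempty := by
      obtain ⟨r, h1, h2⟩ := h
      exact ⟨r, by simp [hS, h1, h2]⟩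
    refine ⟨S.max' hne, ?_, fun r' h1 h2 => Finset.le_max' _ _ (by simp [hS, h1, h2])⟩
    have := S.max'_mem hne
    simpa [hS] using this
  intro h0
  have h1 := congrArg (fun p => coeff p r) h0
  simp only [finsetSum_coeff, coeff_C_mul, coeff_zero] at h1
  rw [Finset.sum_eq_single r] at h1
  · have : (Bp k0 r).coeff r ≠ 0 := by
      have h2 := leadingCoeff_ne_zero.2 (Bp_ne k0 r)
      rwa [leadingCoeff, Bp_natDegree] at h2
    exact (mul_ne_zero hcr this) h1
  · intro b hb hbr
    by_cases hc : c b = 0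
    · simp [hc]
    · have : b ≤ r := hmax b (by simpa using hb) hc
      rw [coeff_eq_zero_of_natDegree_lt (by rw [Bp_natDegree]; omega), mul_zero]
  · intro hn; simp [hr] at hn

lemma aeval_choose (z : ℂ) (a : ℕ) (ρ : ℝ) (hz : ‖z‖ ≤ ρ) :
    ‖aeval z (Ring.choose (X : ℚ[X]) a)‖ ≤ (ρ + a) ^ a / a.factorial := by
  rw [choose_X_eq, map_mul, map_prod, norm_mul, norm_prod, aeval_C, div_eq_inv_mul]
  have h1 : ‖(algebraMap ℚ ℂ) ((a.factorial : ℚ)⁻¹)‖ = ((a.factorial : ℝ))⁻¹ := by simp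
  rw [h1]
  gcongr
  calc _ ≤ ∏ i ∈ range a, (ρ + a) := by
        refine Finset.prod_le_prod (fun _ _ => norm_nonneg _) fun i hi => ?_
        simp only [map_sub, aeval_X, aeval_C]
        refine (norm_sub_le _ _).trans ?_
        have : ‖(algebraMap ℚ ℂ) (i : ℚ)‖ = (i : ℝ) := by simp
        rw [this]
        have : (i : ℝ) ≤ a := by exact_mod_cast (Finset.mem_range.1 hi).le
        linarith
    _ = _ := by simp

lemma pow_div_fact_le (x : ℝ) (hx : 0 ≤ x) (a : ℕ) : x ^ a / a.factorial ≤ Real.exp x :=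
  Real.pow_div_factorial_le_exp x hx a

lemma aeval_Bp_le (k0 r : ℕ) (hk0 : 0 < k0) (z : ℂ) (ρ : ℝ) (hz : ‖z‖ ≤ ρ) :
    ‖aeval z (Bp k0 r)‖ ≤ (1 + ρ / k0) ^ r * Real.exp (r + k0) := by
  have hρ : 0 ≤ ρ := (norm_nonneg z).trans hz
  have hk : (0 : ℝ) < k0 := by exact_mod_cast hk0
  have gen : ∀ a ≤ k0, ‖aeval z (Ring.choose (X : ℚ[X]) a)‖ ≤ (1 + ρ / k0) ^ a * Real.exp k0 := by
    intro a ha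
    refine (aeval_choose z a ρ hz).trans ?_
    have h1 : (ρ + a) ^ a ≤ ((1 + ρ / k0) * k0) ^ a := by
      have : (1 + ρ / k0) * k0 = ρ + k0 := by field_simp; ring
      rw [this]
      have : (a : ℝ) ≤ k0 := by exact_mod_cast ha
      gcongr
    calc (ρ + a) ^ a / a.factorial ≤ ((1 + ρ / k0) * k0) ^ a / a.factorial := by gcongr
      _ = (1 + ρ / k0) ^ a * ((k0 : ℝ) ^ a / a.factorial) := by rw [mul_pow]; ring
      _ ≤ _ := by
          have := pow_div_fact_le (k0 : ℝ) hk.le a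
          gcongr
  rw [Bp, map_mul, map_pow, norm_mul, norm_pow]
  calc _ ≤ ((1 + ρ / k0) ^ k0 * Real.exp k0) ^ (r / k0) *
        ((1 + ρ / k0) ^ (r % k0) * Real.exp k0) := by
        have h1 := gen k0 le_rfl
        have h2 := gen (r % k0) (Nat.mod_lt _ hk0).le
        gcongr
    _ = (1 + ρ / k0) ^ (k0 * (r / k0) + r % k0) * Real.exp ((k0 * (r / k0) : ℕ) + k0) := by
        rw [mul_pow, ← Real.exp_nat_mul, pow_add, pow_mul, Real.exp_add]
        push_cast
        rw [mul_comm ((r / k0 : ℕ) : ℝ) (k0 : ℝ)]; ring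
    _ ≤ _ := by
        rw [Nat.div_add_mod]
        have : ((k0 * (r / k0) : ℕ) : ℝ) ≤ r := by exact_mod_cast Nat.mul_div_le r k0
        gcongr

lemma iteratedDeriv_aeval (p : ℚ[X]) (j : ℕ) :
    iteratedDeriv j (fun z : ℂ => aeval z p) = fun z => aeval z (derivative^[j] p) := by
  induction j with
  | zero => simp
  | succ j ih =>
    rw [iteratedDeriv_succ, ih]
    funext z
    rw [Function.iterate_succ_apply', Polynomial.deriv_aeval]

lemma hasse_Bp_le (k0 r j : ℕ) (hk0 : 0 < k0) (z : ℂ) (ρ : ℝ) (hz : ‖z‖ ≤ ρ) :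
    ‖aeval z (hasseDeriv j (Bp k0 r))‖ ≤ (1 + (ρ + 1) / k0) ^ r * Real.exp (r + k0) := by
  have hd : Differentiable ℂ (fun w : ℂ => aeval w (Bp k0 r)) := Polynomial.differentiable_aeval _
  have := Complex.norm_iteratedDeriv_le_of_forall_mem_sphere_norm_le (c := z) (R := 1)
    (C := (1 + (ρ + 1) / k0) ^ r * Real.exp (r + k0))
    (f := fun w : ℂ => aeval w (Bp k0 r)) j one_pos hd.diffContOnCl (by
      intro w hw
      refine aeval_Bp_le k0 r hk0 w (ρ + 1) ?_
      have h1 : ‖w - z‖ = 1 := by simpa [dist_eq_norm] using hw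
      calc ‖w‖ = ‖z + (w - z)‖ := by congr 1; ring
        _ ≤ ‖z‖ + ‖w - z‖ := norm_add_le _ _
        _ ≤ _ := by rw [h1]; linarith)
  rw [iteratedDeriv_aeval, ← factorial_smul_hasseDeriv] at this
  have h2 : (aeval z) ((j.factorial • hasseDeriv j) (Bp k0 r)) =
      (j.factorial : ℂ) * aeval z (hasseDeriv j (Bp k0 r)) := by
    rw [LinearMap.smul_apply, map_nsmul, nsmul_eq_mul]
  simp only [h2, one_pow, div_one, norm_mul, Complex.norm_natCast] at this
  have hf : (0 : ℝ) < j.factorial := by exact_mod_cast Nat.factorial_pos j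
  exact le_of_mul_le_mul_left this hf

lemma exists_lcm (k0 : ℕ) : ∃ d : ℕ, 0 < d ∧ (∀ i, 1 ≤ i → i ≤ k0 → i ∣ d) ∧
    Real.log d ≤ (Real.log 4 + 4) * k0 := by
  refine ⟨k0.lcmUpto, ?_, ?_, ?_⟩
  · exact Nat.lcmUpto_pos k0
  · intro i h1 h2
    exact Finset.dvd_lcm (f := id) (Finset.mem_Icc.2 ⟨h1, h2⟩)
  · rw [← Chebyshev.psi_eq_log_lcmUpto]
    exact Chebyshev.psi_le_const_mul_self (by positivity)

end BW


namespace BW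
open Finset

/-- Lattice data. -/
structure Lat (P : Type) [Fintype P] (m : ℕ) where
  pr : P → ℕ
  hp : ∀ p, (pr p).Prime
  hinj : Function.Injective pr
  v : Fin m → P → ℤ
  c : Fin m → (P → ℤ) →+ ℝ
  hc : ∀ i j, c i (v j) = if i = j then 1 else 0
  s : ℝ
  hs : 1 ≤ s
  hpos : ∀ i, ∑ p, max (v i p : ℝ) 0 * Real.log (pr p) ≤ s
  hneg : ∀ i, ∑ p, max (-(v i p : ℝ)) 0 * Real.log (pr p) ≤ s

namespace Lat
variable {P : Type} [Fintype P] {m : ℕ} (Λ : Lat P m)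

lemma lg_pos (p : P) : Real.log 2 ≤ Real.log (Λ.pr p) :=
  Real.log_le_log (by norm_num) (by exact_mod_cast (Λ.hp p).two_le)

lemma lg_pos' (p : P) : 0 < Real.log (Λ.pr p) :=
  lt_of_lt_of_le (Real.log_pos (by norm_num)) (Λ.lg_pos p)

/-- the lattice -/
def lat : AddSubgroup (P → ℤ) where
  carrier := {l | ∀ p, (l p : ℝ) = ∑ i, Λ.c i l * Λ.v i p}
  zero_mem' := by intro p; simp
  add_mem' := by
    intro a b ha hb p
    simp only [Pi.add_apply, Int.cast_add, map_add, add_mul, sum_add_distrib]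
    rw [← ha p, ← hb p]
  neg_mem' := by
    intro a ha p
    simp only [Pi.neg_apply, Int.cast_neg, map_neg, neg_mul, sum_neg_distrib]
    rw [← ha p]

lemma mem_lat {l : P → ℤ} : l ∈ Λ.lat ↔ ∀ p, (l p : ℝ) = ∑ i, Λ.c i l * Λ.v i p := Iff.rfl

lemma v_mem (i : Fin m) : Λ.v i ∈ Λ.lat := by
  intro p; simp [Λ.hc]

lemma pure' {l : P → ℤ} (k : ℕ) (hk : k ≠ 0) (h : k • l ∈ Λ.lat) : l ∈ Λ.lat := by
  intro p
  have := h p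
  have e : ∀ i, Λ.c i (k • l) = k * Λ.c i l := fun i => by rw [map_nsmul]; simp
  simp only [e, Pi.smul_apply] at this
  simp only [mul_assoc, ← mul_sum] at this
  rw [nsmul_eq_mul] at this
  push_cast at this
  exact mul_left_cancel₀ (by exact_mod_cast hk) this

/-- sum of abs logs -/
noncomputable def w : ℝ := ∑ i, |theta Λ.pr (Λ.v i)|
/-- sum of heights -/
noncomputable def h : ℝ := ∑ i, ∑ p, |(Λ.v i p : ℝ)| * Real.log (Λ.pr p)

lemma w_nonneg : 0 ≤ Λ.w := sum_nonneg fun _ _ => abs_nonneg _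
lemma h_nonneg : 0 ≤ Λ.h := sum_nonneg fun _ _ => sum_nonneg fun p _ =>
  mul_nonneg (abs_nonneg _) (Λ.lg_pos' p).le

lemma theta_v (i : Fin m) : theta Λ.pr (Λ.v i) = ∑ p, max (Λ.v i p : ℝ) 0 * Real.log (Λ.pr p)
    - ∑ p, max (-(Λ.v i p : ℝ)) 0 * Real.log (Λ.pr p) := by
  rw [theta, ← sum_sub_distrib]
  refine sum_congr rfl fun p _ => ?_
  rw [← sub_mul]; congr 1
  rcases le_total (Λ.v i p : ℝ) 0 with h | h
  · rw [max_eq_right h, max_eq_left (by linarith)]; ring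
  · rw [max_eq_left h, max_eq_right (by linarith)]; ring

lemma abs_v (i : Fin m) : ∑ p, |(Λ.v i p : ℝ)| * Real.log (Λ.pr p) =
    ∑ p, max (Λ.v i p : ℝ) 0 * Real.log (Λ.pr p)
    + ∑ p, max (-(Λ.v i p : ℝ)) 0 * Real.log (Λ.pr p) := by
  rw [← sum_add_distrib]
  refine sum_congr rfl fun p _ => ?_
  rw [← add_mul]; congr 1
  rcases le_total (Λ.v i p : ℝ) 0 with h | h
  · rw [max_eq_right h, max_eq_left (by linarith), abs_of_nonpos h]; ring
  · rw [max_eq_left h, max_eq_right (by linarith), abs_of_nonneg h]; ring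

lemma pos_nonneg (f : P → ℝ) : 0 ≤ ∑ p, max (f p) 0 * Real.log (Λ.pr p) :=
  sum_nonneg fun p _ => mul_nonneg (le_max_right _ _) (Λ.lg_pos' p).le

lemma wh_le : Λ.w + Λ.h ≤ 2 * m * Λ.s := by
  rw [w, h, ← sum_add_distrib]
  have : ∀ i ∈ (univ : Finset (Fin m)), |theta Λ.pr (Λ.v i)| +
      ∑ p, |(Λ.v i p : ℝ)| * Real.log (Λ.pr p) ≤ 2 * Λ.s := by
    intro i _
    rw [theta_v, abs_v]
    have h1 := Λ.hpos i
    have h2 := Λ.hneg i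
    rcases abs_cases (∑ p, max (Λ.v i p : ℝ) 0 * Real.log (Λ.pr p)
    - ∑ p, max (-(Λ.v i p : ℝ)) 0 * Real.log (Λ.pr p)) with h | h <;> linarith
  refine (sum_le_card_nsmul _ _ _ this).trans ?_
  simp; linarith

lemma w_le : Λ.w ≤ m * Λ.s := by
  rw [w]
  have : ∀ i ∈ (univ : Finset (Fin m)), |theta Λ.pr (Λ.v i)| ≤ Λ.s := by
    intro i _
    rw [theta_v]
    have h1 := Λ.hpos i
    have h2 := Λ.hneg i
    have h3 := Λ.pos_nonneg (fun p => (Λ.v i p : ℝ))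
    have h4 := Λ.pos_nonneg (fun p => -(Λ.v i p : ℝ))
    rw [abs_le]; constructor <;> linarith
  refine (sum_le_card_nsmul _ _ _ this).trans ?_
  simp

lemma v_le (i : Fin m) (p : P) : |(Λ.v i p : ℝ)| * Real.log 2 ≤ Λ.s := by
  have h0 : |(Λ.v i p : ℝ)| * Real.log 2 ≤ |(Λ.v i p : ℝ)| * Real.log (Λ.pr p) :=
    mul_le_mul_of_nonneg_left (Λ.lg_pos p) (abs_nonneg _)
  have h3 := single_le_sum (f := fun p => max (Λ.v i p : ℝ) 0 * Real.log (Λ.pr p)) (s := univ)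
    (fun p _ => mul_nonneg (le_max_right _ _) (Λ.lg_pos' p).le) (mem_univ p)
  have h4 := single_le_sum (f := fun p => max (-(Λ.v i p : ℝ)) 0 * Real.log (Λ.pr p)) (s := univ)
    (fun p _ => mul_nonneg (le_max_right _ _) (Λ.lg_pos' p).le) (mem_univ p)
  have h1 := Λ.hpos i
  have h2 := Λ.hneg i
  rcases le_total (Λ.v i p : ℝ) 0 with h | h
  · rw [max_eq_left (by linarith : 0 ≤ -(Λ.v i p : ℝ))] at h4
    rw [abs_of_nonpos h] at *; linarith
  · rw [max_eq_left h] at h3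
    rw [abs_of_nonneg h] at *; linarith

lemma coord_le {l : P → ℤ} (hl : l ∈ Λ.lat) {x : ℝ} (hx : ∀ i, |Λ.c i l| ≤ x) (p : P) :
    |(l p : ℝ)| * Real.log 2 ≤ m * x * Λ.s := by
  have hl2 : (0 : ℝ) < Real.log 2 := Real.log_pos (by norm_num)
  rw [hl p]
  calc _ ≤ (∑ i, |Λ.c i l * Λ.v i p|) * Real.log 2 :=
        mul_le_mul_of_nonneg_right (abs_sum_le_sum_abs _ _) hl2.le
    _ = ∑ i, |Λ.c i l| * (|(Λ.v i p : ℝ)| * Real.log 2) := by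
        rw [sum_mul]; simp only [abs_mul, mul_assoc]
    _ ≤ ∑ _i : Fin m, x * Λ.s := by
        refine sum_le_sum fun i _ => ?_
        exact mul_le_mul (hx i) (Λ.v_le i p) (by positivity) ((abs_nonneg _).trans (hx i))
    _ = _ := by simp; ring

lemma box_finite (x : ℝ) : {l : P → ℤ | l ∈ Λ.lat ∧ ∀ i, |Λ.c i l| ≤ x}.Finite := by
  classical
  have hl2 : (0 : ℝ) < Real.log 2 := Real.log_pos (by norm_num)
  refine Set.Finite.subset (Set.finite_Icc (fun _ : P => -⌈m * x * Λ.s / Real.log 2⌉)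
    (fun _ : P => ⌈m * x * Λ.s / Real.log 2⌉)) ?_
  rintro l ⟨hl, hx⟩
  have : ∀ p, |l p| ≤ ⌈m * x * Λ.s / Real.log 2⌉ := by
    intro p
    have := Λ.coord_le hl hx p
    rw [← le_div_iff₀ hl2] at this
    have h3 := this.trans (Int.le_ceil _)
    exact_mod_cast h3
  exact ⟨fun p => (abs_le.mp (this p)).1, fun p => (abs_le.mp (this p)).2⟩

/-- boxes -/
noncomputable def box (x : ℝ) : Finset (P → ℤ) := (Λ.box_finite x).toFinset

lemma mem_box {x : ℝ} {l : P → ℤ} : l ∈ Λ.box x ↔ l ∈ Λ.lat ∧ ∀ i, |Λ.c i l| ≤ x := by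
  simp [box]

lemma zero_mem_box {x : ℝ} (hx : 0 ≤ x) : 0 ∈ Λ.box x := by
  rw [mem_box]; exact ⟨Λ.lat.zero_mem, by simpa using fun _ => hx⟩

lemma add_mem_box {x y : ℝ} {a b : P → ℤ} (ha : a ∈ Λ.box x) (hb : b ∈ Λ.box y) :
    a + b ∈ Λ.box (x + y) := by
  rw [mem_box] at *
  refine ⟨Λ.lat.add_mem ha.1 hb.1, fun i => ?_⟩
  rw [map_add]
  exact (abs_add_le _ _).trans (add_le_add (ha.2 i) (hb.2 i))

lemma box_trivial {x : ℝ} (hx : m * x * Λ.s < Real.log 2) {l : P → ℤ} (hl : l ∈ Λ.box x) : l = 0 := by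
  rw [mem_box] at hl
  have hl2 : (0 : ℝ) < Real.log 2 := Real.log_pos (by norm_num)
  funext p
  have := Λ.coord_le hl.1 hl.2 p
  have h1 : |(l p : ℝ)| < 1 := by
    by_contra h; push Not at h; nlinarith
  have h2 : |l p| < 1 := by exact_mod_cast h1
  simpa using Int.abs_lt_one_iff.mp h2

lemma theta_eq {l : P → ℤ} (hl : l ∈ Λ.lat) :
    theta Λ.pr l = ∑ i, Λ.c i l * theta Λ.pr (Λ.v i) := by
  simp only [theta, mul_sum]
  rw [sum_comm]
  refine sum_congr rfl fun p _ => ?_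
  rw [hl p, sum_mul]
  simp only [mul_assoc]

lemma theta_le {x : ℝ} {l : P → ℤ} (hl : l ∈ Λ.box x) : |theta Λ.pr l| ≤ x * Λ.w := by
  rw [mem_box] at hl
  rw [Λ.theta_eq hl.1, w, mul_sum]
  refine (abs_sum_le_sum_abs _ _).trans (sum_le_sum fun i _ => ?_)
  rw [abs_mul]
  exact mul_le_mul_of_nonneg_right (hl.2 i) (abs_nonneg _)


lemma card_box_ge (L : ℕ) : (2 * L + 1) ^ m ≤ (Λ.box L).card := by
  classical
  have : (Fintype.piFinset fun _ : Fin m => Icc (-(L : ℤ)) L).card = (2 * L + 1) ^ m := by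
    rw [Fintype.card_piFinset]; simp
    congr 1; omega
  rw [← this]
  have key : ∀ (a : Fin m → ℤ) i, Λ.c i (∑ j, a j • Λ.v j) = a i := by
    intro a i
    rw [map_sum]; simp only [map_zsmul, Λ.hc]; simp
  refine card_le_card_of_injOn (fun a => ∑ i, a i • Λ.v i) ?_ ?_
  · intro a ha
    simp only [mem_coe, Fintype.mem_piFinset, mem_Icc] at ha
    simp only [mem_coe]
    rw [mem_box]
    refine ⟨Λ.lat.sum_mem fun i _ => Λ.lat.zsmul_mem (Λ.v_mem i) _, fun i => ?_⟩
    rw [key]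
    have := abs_le.mpr (ha i)
    exact_mod_cast this
  · intro a _ b _ h
    funext i
    have := congrArg (Λ.c i) h
    simp only [key] at this
    exact_mod_cast this

lemma card_box_cover (N : ℕ) {x : ℝ} (hx : 0 < x) :
    (Λ.box (N * x)).card ≤ (2 * N + 1) ^ m * (Λ.box x).card := by
  classical
  set f : (P → ℤ) → Fin m → ℤ := fun l i => ⌊(Λ.c i l + N * x) / x⌋ with hf
  have h1 := card_le_mul_card_image (f := f) (Λ.box (N * x)) (Λ.box x).card ?_
  · refine h1.trans ?_
    rw [mul_comm]
    refine Nat.mul_le_mul_right _ ?_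
    have : (Fintype.piFinset fun _ : Fin m => Icc (0 : ℤ) (2 * N)).card = (2 * N + 1) ^ m := by
      rw [Fintype.card_piFinset]; simp
      congr 1
    rw [← this]
    refine card_le_card ?_
    intro y hy
    obtain ⟨l, hl, rfl⟩ := mem_image.mp hy
    rw [mem_box] at hl
    simp only [Fintype.mem_piFinset, mem_Icc, hf]
    intro i
    have := abs_le.mp (hl.2 i)
    constructor
    · apply Int.floor_nonneg.mpr; apply div_nonneg _ hx.le; linarith
    · rw [← Int.cast_le (R := ℝ)]
      refine (Int.floor_le _).trans ?_
      rw [div_le_iff₀ hx]; push_cast; linarith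
  · intro a ha
    obtain ⟨l0, hl0, rfl⟩ := mem_image.mp ha
    refine card_le_card_of_injOn (fun l => l - l0) ?_ ?_
    · intro l hl
      simp only [coe_filter, Set.mem_ofPred_eq] at hl
      simp only [mem_coe]
      rw [mem_box] at hl0 hl ⊢
      refine ⟨Λ.lat.sub_mem hl.1.1 hl0.1, fun i => ?_⟩
      have h2 := congrFun hl.2 i
      simp only [hf] at h2
      have h3 := Int.abs_sub_lt_one_of_floor_eq_floor h2
      rw [← sub_div, abs_div, abs_of_pos hx, div_lt_one hx] at h3
      rw [map_sub]
      refine le_of_lt (lt_of_eq_of_lt ?_ h3)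
      congr 1; ring
    · intro a _ b _ h
      simpa using h

end Lat
end BW


namespace BW
open Finset

namespace Lat
variable {P : Type} [Fintype P] {m : ℕ} (Λ : Lat P m)

lemma box_mono {x y : ℝ} (h : x ≤ y) : Λ.box x ⊆ Λ.box y := by
  intro l hl
  rw [mem_box] at *
  exact ⟨hl.1, fun i => (hl.2 i).trans h⟩

lemma exists_reps : ∃ rep : Fin (2 ^ m) → P → ℤ, ∀ μ ∈ Λ.lat, ∃ i, ∃ ν, μ = rep i + 2 • ν := by
  classical
  let red : (P → ℤ) → P → ZMod 2 := fun l p => (l p : ZMod 2)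
  have hred : ∀ a b : P → ℤ, red a = red b → ∃ ν, a = b + 2 • ν := by
    intro a b h
    have : ∀ p, ∃ z : ℤ, a p - b p = 2 * z := by
      intro p
      have := congrFun h p
      simp only [red] at this
      rw [ZMod.intCast_eq_intCast_iff_dvd_sub] at this
      obtain ⟨z, hz⟩ := this
      exact ⟨-z, by push_cast at hz; linarith⟩
    choose ν hν using this
    refine ⟨ν, ?_⟩
    funext p
    have := hν p
    simp
    linarith
  let S : Finset (P → ZMod 2) := univ.filter fun y => ∃ μ ∈ Λ.lat, red μ = y
  have hS : ∀ y : P → ZMod 2, ∃ μ, y ∈ S → μ ∈ Λ.lat ∧ red μ = y := by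
    intro y
    by_cases hy : y ∈ S
    · obtain ⟨μ, h1, h2⟩ := (mem_filter.mp hy).2
      exact ⟨μ, fun _ => ⟨h1, h2⟩⟩
    · exact ⟨0, fun h => absurd h hy⟩
  choose g hg using hS
  have hcard : S.card ≤ 2 ^ m := by
    set R : ℝ := 1 + ∑ y ∈ S, ∑ i, |Λ.c i (g y)| with hR
    have hR1 : 1 ≤ R := by
      rw [hR]; have : 0 ≤ ∑ y ∈ S, ∑ i, |Λ.c i (g y)| := by positivity
      linarith
    have hgR : ∀ y ∈ S, g y ∈ Λ.box R := by
      intro y hy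
      rw [mem_box]
      refine ⟨(hg y hy).1, fun i => ?_⟩
      have h1 := single_le_sum (f := fun i => |Λ.c i (g y)|) (s := univ) (fun _ _ => abs_nonneg _)
        (mem_univ i)
      have h2 := single_le_sum (f := fun y => ∑ i, |Λ.c i (g y)|) (s := S)
        (fun _ _ => by positivity) hy
      linarith
    have step : ∀ x : ℝ, S.card * (Λ.box x).card ≤ (Λ.box (2 * x + R)).card := by
      intro x
      rw [← card_product]
      refine card_le_card_of_injOn (fun q => q.2 + q.2 + g q.1) ?_ ?_
      · intro q hq
        obtain ⟨h1, h2⟩ := mem_product.mp hq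
        have := Λ.add_mem_box (Λ.add_mem_box h2 h2) (hgR _ h1)
        rw [two_mul]; exact this
      · intro q hq q' hq' h
        have h1 := (mem_product.mp hq).1
        have h1' := (mem_product.mp hq').1
        simp only at h
        have e : q.1 = q'.1 := by
          rw [← (hg _ h1).2, ← (hg _ h1').2]
          funext p
          have h3 := congrFun h p
          simp only [Pi.add_apply] at h3
          simp only [red]
          rw [ZMod.intCast_eq_intCast_iff_dvd_sub]
          exact ⟨q.2 p - q'.2 p, by push_cast; linarith⟩
        rw [e] at h
        have h4 : q.2 + q.2 = q'.2 + q'.2 := add_right_cancel h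
        refine Prod.ext e ?_
        funext p
        have h3 := congrFun h4 p
        simp only [Pi.add_apply] at h3
        linarith
    have iter : ∀ k : ℕ, S.card ^ k * (Λ.box R).card ≤ (Λ.box ((2 ^ (k + 1) - 1) * R)).card := by
      intro k
      induction k with
      | zero => rw [pow_zero, one_mul]; refine card_le_card (Λ.box_mono ?_); norm_num
      | succ k ih =>
        rw [pow_succ', mul_assoc]
        refine (Nat.mul_le_mul_left _ ih).trans ((step _).trans (card_le_card (Λ.box_mono ?_)))
        rw [pow_succ 2 (k + 1)]; linarith
    have hub : ∀ k : ℕ, S.card ^ k ≤ (5 ^ m) * (2 ^ m) ^ k := by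
      intro k
      have h1 := iter k
      have h2 : (Λ.box ((2 ^ (k + 1) - 1) * R)).card ≤ (Λ.box ((2 ^ (k + 1) : ℕ) * R)).card := by
        refine card_le_card (Λ.box_mono ?_)
        push_cast; linarith
      have h3 := Λ.card_box_cover (2 ^ (k + 1)) (x := R) (by linarith)
      have h4 : 0 < (Λ.box R).card := card_pos.mpr ⟨0, Λ.zero_mem_box (by linarith)⟩
      have h5 := Nat.le_of_mul_le_mul_right (h1.trans (h2.trans h3)) h4
      refine h5.trans ?_
      rw [← pow_mul, mul_comm m k, pow_mul, ← mul_pow]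
      refine Nat.pow_le_pow_left ?_ _
      have : 1 ≤ 2 ^ k := Nat.one_le_two_pow
      rw [pow_succ]; omega
    by_contra hlt
    push Not at hlt
    have hr : (1 : ℝ) < S.card / 2 ^ m := by
      rw [one_lt_div (by positivity)]; exact_mod_cast hlt
    obtain ⟨k, hk⟩ := pow_unbounded_of_one_lt ((5 : ℝ) ^ m) hr
    have := hub k
    rw [div_pow, lt_div_iff₀ (by positivity)] at hk
    have h6 : ((S.card : ℝ)) ^ k ≤ 5 ^ m * (2 ^ m) ^ k := by exact_mod_cast this
    linarith
  have hSc : Fintype.card S ≤ Fintype.card (Fin (2 ^ m)) := by simpa using hcard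
  have hSne : Nonempty S := ⟨⟨red 0, by simp only [S, mem_filter, mem_univ, true_and]; exact ⟨0, Λ.lat.zero_mem, rfl⟩⟩⟩
  obtain ⟨e⟩ := Function.Embedding.nonempty_of_card_le hSc
  refine ⟨fun i => g (Function.invFun e i : S).1, fun μ hμ => ?_⟩
  have hm : red μ ∈ S := by simp only [S, mem_filter, mem_univ, true_and]; exact ⟨μ, hμ, rfl⟩
  refine ⟨e ⟨red μ, hm⟩, ?_⟩
  apply hred
  beta_reduce
  rw [Function.leftInverse_invFun e.injective]
  exact (hg _ hm).2.symm

/-- linear forms vanishing at β -/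
def gam (β : P → ℤ) (p0 p : P) : (P → ℤ) →+ ℤ where
  toFun l := l p * β p0 - l p0 * β p
  map_zero' := by simp
  map_add' := by intro a b; simp; ring

lemma gam_apply (β : P → ℤ) (p0 p : P) (l : P → ℤ) : gam β p0 p l = l p * β p0 - l p0 * β p := rfl

lemma exists_gam (β : P → ℤ) (hβ : β ∈ Λ.lat) (p0 : P) (h0 : β p0 ≠ 0) :
    ∃ (q : Fin (m - 1) → P) (cc : Fin (m - 1) → ℝ), ∀ l ∈ Λ.lat,
      theta Λ.pr l = ∑ i, cc i * gam β p0 (q i) l + (l p0 / β p0 : ℝ) * theta Λ.pr β := by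
  classical
  set g : P → Fin m → ℝ := fun p i => gam β p0 p (Λ.v i) with hg
  have hgl : ∀ l ∈ Λ.lat, ∀ p, (gam β p0 p l : ℝ) = ∑ i, Λ.c i l * g p i := by
    intro l hl p
    simp only [hg, gam_apply]
    push_cast
    rw [hl p, hl p0]
    simp only [sum_mul, mul_sub, sum_sub_distrib, mul_assoc]
  have hβi : ∃ i, Λ.c i β ≠ 0 := by
    by_contra h
    push Not at h
    have := hβ p0
    simp only [h, zero_mul, sum_const_zero] at this
    exact h0 (by exact_mod_cast this)
  have hm : 0 < m := by obtain ⟨i, _⟩ := hβi; exact i.pos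
  let φ : (Fin m → ℝ) →ₗ[ℝ] ℝ := ∑ i, Λ.c i β • LinearMap.proj i
  have hφ : ∀ x, φ x = ∑ i, Λ.c i β * x i := by intro x; simp [φ]
  have hφ0 : φ ≠ 0 := by
    obtain ⟨i, hi⟩ := hβi
    intro h
    have := congrArg (fun f => f (Pi.single i 1)) h
    simp only [hφ, LinearMap.zero_apply] at this
    rw [Finset.sum_eq_single i] at this
    · simp at this; exact hi this
    · intro j _ hj; simp [hj]
    · simp
  have hsub : Submodule.span ℝ (Set.range g) ≤ LinearMap.ker φ := by
    rw [Submodule.span_le]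
    rintro _ ⟨p, rfl⟩
    simp only [SetLike.mem_coe, LinearMap.mem_ker, hφ]
    rw [← hgl β hβ p, gam_apply]
    push_cast; ring
  have hker : Module.finrank ℝ (LinearMap.ker φ) + 1 = m := by
    have := LinearMap.finrank_range_add_finrank_ker φ
    have h2 : LinearMap.range φ = ⊤ := LinearMap.range_eq_top.mpr (LinearMap.surjective hφ0)
    rw [h2, finrank_top] at this
    simp at this
    omega
  have hrk : Module.finrank ℝ (Submodule.span ℝ (Set.range g)) ≤ m - 1 := by
    have := Submodule.finrank_mono hsub
    omega
  obtain ⟨κ, a, hinj, hspan, hli⟩ := exists_linearIndependent' ℝ g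
  have : Finite κ := Finite.of_injective a hinj
  have := Fintype.ofFinite κ
  have hκ : Fintype.card κ ≤ m - 1 := by
    rw [← finrank_span_eq_card hli, hspan]; exact hrk
  have : ∃ q : Fin (m - 1) → P, Submodule.span ℝ (Set.range g) ≤ Submodule.span ℝ (Set.range (g ∘ q)) := by
    rcases isEmpty_or_nonempty κ with hE | hE
    · refine ⟨fun _ => p0, ?_⟩
      rw [← hspan, Set.range_eq_empty, Submodule.span_empty]; exact bot_le
    · obtain ⟨e⟩ := Function.Embedding.nonempty_of_card_le (α := κ) (β := Fin (m - 1)) (by simpa using hκ)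
      refine ⟨fun i => a (Function.invFun e i), ?_⟩
      rw [← hspan]
      refine Submodule.span_mono ?_
      rintro _ ⟨k, rfl⟩
      refine ⟨e k, ?_⟩
      simp [Function.leftInverse_invFun e.injective k]
  obtain ⟨q, hq⟩ := this
  have hmem : ∑ p, (Real.log (Λ.pr p) / β p0) • g p ∈ Submodule.span ℝ (Set.range (g ∘ q)) :=
    hq (Submodule.sum_mem _ fun p _ => Submodule.smul_mem _ _ (Submodule.subset_span ⟨p, rfl⟩))
  rw [Submodule.mem_span_range_iff_exists_fun] at hmem
  obtain ⟨cc, hcc⟩ := hmem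
  refine ⟨q, cc, fun l hl => ?_⟩
  have h0' : (β p0 : ℝ) ≠ 0 := by exact_mod_cast h0
  have e1 : ∑ i, cc i * (gam β p0 (q i) l : ℝ) = ∑ i, Λ.c i l * (∑ j, cc j • (g ∘ q) j) i := by
    simp only [hgl l hl, Finset.sum_apply, Pi.smul_apply, smul_eq_mul, mul_sum, Function.comp]
    rw [sum_comm]
    refine sum_congr rfl fun i _ => sum_congr rfl fun j _ => ?_
    ring
  have e2 : ∑ i, Λ.c i l * (∑ p, (Real.log (Λ.pr p) / β p0) • g p) i
      = ∑ p, (Real.log (Λ.pr p) / β p0) * (gam β p0 p l : ℝ) := by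
    simp only [hgl l hl, Finset.sum_apply, Pi.smul_apply, smul_eq_mul, mul_sum]
    rw [sum_comm]
    refine sum_congr rfl fun i _ => sum_congr rfl fun j _ => ?_
    ring
  rw [e1, hcc, e2]
  simp only [theta, mul_sum]
  rw [← sum_add_distrib]
  refine sum_congr rfl fun p _ => ?_
  rw [gam_apply]
  push_cast
  field_simp
  ring

end Lat
end BW


namespace BW
open Finset

section count

/-- exponent vectors of total degree `< D` -/
def tset (k D : ℕ) : Finset (Fin k → ℕ) :=
  (Fintype.piFinset fun _ => range D).filter fun τ => ∑ i, τ i < D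

lemma mem_tset {k D : ℕ} {τ : Fin k → ℕ} : τ ∈ tset k D ↔ ∑ i, τ i < D := by
  simp only [tset, mem_filter, Fintype.mem_piFinset, mem_range, and_iff_right_iff_imp]
  intro h i
  exact lt_of_le_of_lt (single_le_sum (f := τ) (fun _ _ => Nat.zero_le _) (mem_univ i)) h

lemma hockey (k T : ℕ) : ∑ j ∈ range T, (T - j + k - 1).choose k = (T + k).choose (k + 1) := by
  induction T with
  | zero => simp
  | succ T ih =>
    rw [sum_range_succ', show T + 1 + k = (T + k) + 1 by ring, Nat.choose_succ_succ, ← ih, add_comm]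
    congr 1
    · congr 1; omega
    · refine sum_congr rfl fun j _ => ?_
      congr 1; omega

lemma card_tset (k : ℕ) : ∀ D, (tset k D).card ≤ (D + k - 1).choose k := by
  induction k with
  | zero =>
    intro D
    refine (card_le_one.mpr fun a _ b _ => Subsingleton.elim _ _).trans ?_
    simp
  | succ k ih =>
    intro D
    classical
    have hsub : tset (k + 1) D ⊆ (range D).biUnion fun j =>
        (tset k (D - j)).image (fun τ => (Fin.cons j τ : Fin (k + 1) → ℕ)) := by
      intro τ hτ
      rw [mem_tset, Fin.sum_univ_succ] at hτ
      simp only [mem_biUnion, mem_range, mem_image]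
      refine ⟨τ 0, by omega, Fin.tail τ, ?_, Fin.cons_self_tail τ⟩
      rw [mem_tset]
      have : ∑ i, Fin.tail τ i = ∑ i : Fin k, τ i.succ := rfl
      omega
    refine (card_le_card hsub).trans (card_biUnion_le.trans ?_)
    have : ∑ j ∈ range D, ((tset k (D - j)).image
        (fun τ => (Fin.cons j τ : Fin (k + 1) → ℕ))).card ≤
        ∑ j ∈ range D, (D - j + k - 1).choose k :=
      sum_le_sum fun j _ => card_image_le.trans (ih _)
    rw [hockey] at this
    exact this

end count

section kill
variable {X : Type} {k : ℕ}

lemma kill_poly (I : Finset X) (c : X → ℝ) (g : X → Fin k → ℝ) (D : ℝ)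
    (h : ∀ τ : Fin k → ℕ, ((∑ i, τ i : ℕ) : ℝ) < D → ∑ l ∈ I, c l * ∏ i, g l i ^ τ i = 0)
    (f : MvPolynomial (Fin k) ℝ) (hf : (f.totalDegree : ℝ) < D) :
    ∑ l ∈ I, c l * MvPolynomial.eval (g l) f = 0 := by
  simp only [MvPolynomial.eval_eq', mul_sum]
  rw [sum_comm]
  refine sum_eq_zero fun d hd => ?_
  have h1 := MvPolynomial.le_totalDegree hd
  rw [Finsupp.sum_fintype _ _ (fun _ => rfl)] at h1
  have h2 := h d (lt_of_le_of_lt (by exact_mod_cast h1) hf)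
  calc _ = f.coeff d * ∑ l ∈ I, c l * ∏ i, g l i ^ d i := by
        rw [mul_sum]; refine sum_congr rfl fun l _ => ?_; ring
    _ = 0 := by rw [h2, mul_zero]

lemma kill_affine (I : Finset X) (c : X → ℝ) (g : X → Fin k → ℝ) (D : ℝ)
    (h : ∀ τ : Fin k → ℕ, ((∑ i, τ i : ℕ) : ℝ) < D → ∑ l ∈ I, c l * ∏ i, g l i ^ τ i = 0)
    (a : ℝ) (b : Fin k → ℝ) (τ : Fin k → ℕ) (hτ : ((∑ i, τ i : ℕ) : ℝ) < D) :
    ∑ l ∈ I, c l * ∏ i, (a * g l i + b i) ^ τ i = 0 := by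
  classical
  have := kill_poly I c g D h (∏ i, (MvPolynomial.C a * MvPolynomial.X i + MvPolynomial.C (b i)) ^ τ i) ?_
  · simpa using this
  · refine lt_of_le_of_lt ?_ hτ
    norm_cast
    refine (MvPolynomial.totalDegree_finsetProd _ _).trans (sum_le_sum fun i _ => ?_)
    refine (MvPolynomial.totalDegree_pow _ _).trans ?_
    have h1 : (MvPolynomial.C a * MvPolynomial.X i + MvPolynomial.C (b i) :
        MvPolynomial (Fin k) ℝ).totalDegree ≤ 1 := by
      refine (MvPolynomial.totalDegree_add _ _).trans (max_le ?_ (by simp))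
      refine (MvPolynomial.totalDegree_mul _ _).trans ?_
      simp
    nlinarith

end kill

section rank
variable {P : Type} [Fintype P] {k : ℕ}

/-- monomials in the linear forms -/
def qm (γ : Fin k → (P → ℤ) →+ ℤ) (τ : Fin k → ℕ) (l : P → ℤ) : ℤ := ∏ i, (γ i l) ^ τ i

/-- span of the monomials on a finite set -/
def WW (γ : Fin k → (P → ℤ) →+ ℤ) (F : Finset (P → ℤ)) (D : ℕ) : Submodule ℝ (F → ℝ) :=
  Submodule.span ℝ (Set.range fun τ : {τ : Fin k → ℕ // ∑ i, τ i < D} =>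
    fun l : F => (qm γ τ.1 l.1 : ℝ))

/-- rank -/
noncomputable def rk (γ : Fin k → (P → ℤ) →+ ℤ) (F : Finset (P → ℤ)) (D : ℕ) : ℕ :=
  Module.finrank ℝ (WW γ F D)

variable (γ : Fin k → (P → ℤ) →+ ℤ)

lemma rk_mono (F : Finset (P → ℤ)) {D D' : ℕ} (h : D ≤ D') : rk γ F D ≤ rk γ F D' := by
  refine Submodule.finrank_mono (Submodule.span_mono ?_)
  rintro _ ⟨τ, rfl⟩
  exact ⟨⟨τ.1, lt_of_lt_of_le τ.2 h⟩, rfl⟩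

lemma exists_span (F : Finset (P → ℤ)) (D : ℕ) : ∃ Ts : Finset (Fin k → ℕ), Ts.card = rk γ F D ∧
    (∀ τ ∈ Ts, ∑ i, τ i < D) ∧ ∀ c : (P → ℤ) → ℝ, (∀ τ ∈ Ts, ∑ l ∈ F, c l * qm γ τ l = 0) →
      ∀ τ : Fin k → ℕ, ∑ i, τ i < D → ∑ l ∈ F, c l * qm γ τ l = 0 := by
  classical
  obtain ⟨κ, a, hinj, hspan, hli⟩ := exists_linearIndependent' ℝ
    (fun τ : {τ : Fin k → ℕ // ∑ i, τ i < D} => fun l : F => (qm γ τ.1 l.1 : ℝ))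
  have hfin : Finite κ := hli.finite
  have := Fintype.ofFinite κ
  refine ⟨univ.image fun j => (a j).1, ?_, ?_, ?_⟩
  · rw [card_image_of_injective _ (fun x y h => hinj (Subtype.val_injective h)), rk, WW, ← hspan,
      finrank_span_eq_card hli]
    rfl
  · intro τ hτ
    obtain ⟨j, _, rfl⟩ := mem_image.mp hτ
    exact (a j).2
  · intro c hc τ hτ
    let φ : (F → ℝ) →ₗ[ℝ] ℝ := ∑ l : F, c l.1 • LinearMap.proj l
    have hφ : ∀ x : F → ℝ, φ x = ∑ l : F, c l.1 * x l := by intro x; simp [φ]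
    have hφ' : ∀ τ : Fin k → ℕ, φ (fun l : F => (qm γ τ l.1 : ℝ)) = ∑ l ∈ F, c l * qm γ τ l := by
      intro τ
      rw [hφ, ← sum_coe_sort F]
    have hle : WW γ F D ≤ LinearMap.ker φ := by
      rw [WW, ← hspan, Submodule.span_le]
      rintro _ ⟨j, rfl⟩
      simp only [SetLike.mem_coe, LinearMap.mem_ker, Function.comp]
      rw [hφ']
      exact hc _ (mem_image.mpr ⟨j, mem_univ _, rfl⟩)
    have := hle (Submodule.subset_span ⟨⟨τ, hτ⟩, rfl⟩)
    rw [LinearMap.mem_ker] at this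
    rw [← hφ', this]

lemma rk_le_tset (F : Finset (P → ℤ)) (D : ℕ) : rk γ F D ≤ (D + k - 1).choose k := by
  classical
  obtain ⟨Ts, h1, h2, -⟩ := exists_span γ F D
  rw [← h1]
  refine (card_le_card fun τ hτ => ?_).trans (card_tset k D)
  exact mem_tset.mpr (h2 τ hτ)

lemma rk_pos (F : Finset (P → ℤ)) (hF : F.Nonempty) (D : ℕ) (hD : 0 < D) : 1 ≤ rk γ F D := by
  by_contra h
  obtain ⟨Ts, h1, h2, h3⟩ := exists_span γ F D
  have : Ts = ∅ := by rw [← card_eq_zero]; omega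
  subst this
  have := h3 (fun _ => 1) (by simp) 0 (by simpa using hD)
  simp [qm] at this
  exact hF.ne_empty this

lemma conv_zero (E F : Finset (P → ℤ)) (a c : (P → ℤ) → ℝ) (hc : ∀ l, l ∉ E → c l = 0)
    (hne : ∃ l, c l ≠ 0) (h : ∀ l, ∑ μ ∈ F, a μ * c (l - μ) = 0) : ∀ μ ∈ F, a μ = 0 := by
  classical
  let A : AddMonoidAlgebra ℝ (P → ℤ) := ∑ μ ∈ F, AddMonoidAlgebra.single μ (a μ)
  let Cc : AddMonoidAlgebra ℝ (P → ℤ) := ∑ μ ∈ E, AddMonoidAlgebra.single μ (c μ)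
  have hC : ∀ l, Cc.coeff l = c l := by
    intro l
    simp only [Cc, AddMonoidAlgebra.coeff_sum, AddMonoidAlgebra.coeff_single, Finsupp.finsetSum_apply,
      Finsupp.single_apply]
    rw [sum_ite_eq' E l]
    split_ifs with hh
    · rfl
    · exact (hc l hh).symm
  have hA : ∀ l ∈ F, A.coeff l = a l := by
    intro l hl
    simp only [A, AddMonoidAlgebra.coeff_sum, AddMonoidAlgebra.coeff_single, Finsupp.finsetSum_apply,
      Finsupp.single_apply]
    rw [sum_ite_eq' F l, if_pos hl]
  have hAC : A * Cc = 0 := by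
    ext l
    have : (A * Cc).coeff l = ∑ μ ∈ F, a μ * c (l - μ) := by
      simp only [A, sum_mul, AddMonoidAlgebra.coeff_sum, Finsupp.finsetSum_apply]
      refine sum_congr rfl fun μ _ => ?_
      rw [AddMonoidAlgebra.coeff_single_mul_apply, hC]
      congr 2; abel
    rw [this, h]; simp
  have hCne : Cc ≠ 0 := by
    obtain ⟨l, hl⟩ := hne
    intro h0
    apply hl
    rw [← hC, h0]; simp
  have hA0 : A = 0 := by
    rcases mul_eq_zero.mp hAC with h1 | h1
    · exact h1
    · exact absurd h1 hCne
  intro μ hμ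
  rw [← hA μ hμ, hA0]; simp

lemma rk_drop (E F G : Finset (P → ℤ)) (hG : ∀ a ∈ E, ∀ b ∈ F, a + b ∈ G) (D : ℕ)
    (c : (P → ℤ) → ℝ) (hc : ∀ l, l ∉ E → c l = 0) (hne : ∃ l, c l ≠ 0)
    (hk : ∀ τ : Fin k → ℕ, ∑ i, τ i < D → ∑ l ∈ E, c l * qm γ τ l = 0) :
    rk γ G D + F.card ≤ G.card := by
  classical
  let u : F → G → ℝ := fun μ l => c (l.1 - μ.1)
  have hu : LinearIndependent ℝ u := by
    rw [Fintype.linearIndependent_iff]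
    intro a ha
    let a' : (P → ℤ) → ℝ := fun μ => if h : μ ∈ F then a ⟨μ, h⟩ else 0
    have ha' : ∀ μ : F, a' μ.1 = a μ := fun μ => by simp [a']
    have := conv_zero E F a' c hc hne ?_
    · intro μ; rw [← ha']; exact this μ.1 μ.2
    · intro l
      by_cases hl : l ∈ G
      · have h1 := congrFun ha ⟨l, hl⟩
        simp only [Finset.sum_apply, Pi.smul_apply, smul_eq_mul, u, Pi.zero_apply] at h1
        rw [← h1, ← sum_coe_sort F]
        refine sum_congr rfl fun μ _ => ?_
        rw [ha']
      · refine sum_eq_zero fun μ hμ => ?_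
        rw [hc, mul_zero]
        intro h2
        apply hl
        have := hG _ h2 _ hμ
        rwa [sub_add_cancel] at this
  have horth : ∀ x ∈ WW γ G D, ∀ y ∈ Submodule.span ℝ (Set.range u), ∑ l, x l * y l = 0 := by
    intro x hx y hy
    refine Submodule.span_induction ?_ ?_ ?_ ?_ hx
    · rintro _ ⟨τ, rfl⟩
      refine Submodule.span_induction ?_ ?_ ?_ ?_ hy
      · rintro _ ⟨μ, rfl⟩
        simp only [u]
        have h1 : ∑ l : G, (qm γ τ.1 l.1 : ℝ) * c (l.1 - μ.1) = ∑ l ∈ E, c l * qm γ τ.1 (l + μ.1) := by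
          rw [sum_coe_sort G (fun l => (qm γ τ.1 l : ℝ) * c (l - μ.1))]
          symm
          refine sum_of_injOn (fun l => l + μ.1) (fun a _ b _ h => by simpa using h) ?_ ?_ ?_
          · intro l hl; exact hG _ hl _ μ.2
          · intro l hl hl2
            rw [hc, mul_zero]
            intro h3
            exact hl2 ⟨l - μ.1, h3, by simp⟩
          · intro l hl
            simp [mul_comm]
        rw [h1]
        have h2 := kill_affine E c (fun l i => (γ i l : ℝ)) D ?_ 1 (fun i => (γ i μ.1 : ℝ)) τ.1
          (by exact_mod_cast τ.2)
        · rw [← h2]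
          refine sum_congr rfl fun l _ => ?_
          simp [qm]
        · intro τ' hτ'
          have := hk τ' (by exact_mod_cast hτ')
          rw [← this]
          refine sum_congr rfl fun l _ => ?_
          simp [qm]
      · simp
      · intro y z _ _ h1 h2
        simp only [Pi.add_apply, mul_add, sum_add_distrib, h1, h2, add_zero]
      · intro r y _ h1
        simp only [Pi.smul_apply, smul_eq_mul]
        rw [← mul_zero r, ← h1, mul_sum]
        refine sum_congr rfl fun l _ => by ring
    · simp
    · intro y z _ _ h1 h2
      simp only [Pi.add_apply, add_mul, sum_add_distrib, h1, h2, add_zero]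
    · intro r y _ h1
      simp only [Pi.smul_apply, smul_eq_mul]
      rw [← mul_zero r, ← h1, mul_sum]
      refine sum_congr rfl fun l _ => by ring
  have hdis : Disjoint (WW γ G D) (Submodule.span ℝ (Set.range u)) := by
    rw [Submodule.disjoint_def]
    intro x hx hx'
    have := horth x hx x hx'
    rw [sum_eq_zero_iff_of_nonneg (fun _ _ => mul_self_nonneg _)] at this
    funext l
    exact mul_self_eq_zero.mp (this l (mem_univ _))
  have := Submodule.finrank_add_finrank_le_of_disjoint hdis
  rw [finrank_span_eq_card hu] at this
  simpa [rk] using this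

end rank
end BW


namespace BW
open Finset

section selection
variable {P : Type} [Fintype P] {m k : ℕ} (Λ : Lat P m) (γ : Fin k → (P → ℤ) →+ ℤ)

/-- smallness of rank -/
def selA (K ε L : ℝ) : Prop :=
  ∑ j ∈ range ⌈K * L⌉₊, (rk γ (Λ.box L) (⌈K * L⌉₊ - j) : ℝ) ≤ ε * ⌈K * L⌉₊ * (Λ.box L).card

/-- separation -/
def selB (K ϕ L : ℝ) (J : ℕ) : Prop :=
  ∀ c : (P → ℤ) → ℝ, (∀ τ : Fin k → ℕ, ((∑ i, τ i : ℕ) : ℝ) < ϕ * ⌈K * L⌉₊ / 2 →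
    ∑ l ∈ Λ.box (2 * L / 2 ^ J), c l * qm γ τ l = 0) → ∀ l ∈ Λ.box (2 * L / 2 ^ J), c l = 0

lemma selA_lower (K ε L : ℝ) (hK : 0 < K) (hL : 0 < L) (hε1 : ε < 1) (h : selA Λ γ K ε L) :
    Real.log 2 ≤ m * L * Λ.s := by
  by_contra hlt
  push Not at hlt
  have hbox : Λ.box L = {0} := by
    refine subset_antisymm (fun l hl => ?_) (fun l hl => ?_)
    · rw [mem_singleton]; exact Λ.box_trivial hlt hl
    · rw [mem_singleton] at hl; rw [hl]; exact Λ.zero_mem_box hL.le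
  rw [selA, hbox] at h
  set T := ⌈K * L⌉₊ with hT
  have hT0 : 0 < T := Nat.ceil_pos.mpr (mul_pos hK hL)
  have h1 : ∑ j ∈ range T, (1 : ℝ) ≤ ∑ j ∈ range T, (rk γ {0} (T - j) : ℝ) := by
    refine sum_le_sum fun j hj => ?_
    rw [mem_range] at hj
    exact_mod_cast rk_pos γ {0} (singleton_nonempty _) (T - j) (by omega)
  simp at h1 h
  have : (0 : ℝ) < T := by exact_mod_cast hT0
  nlinarith

lemma exists_small (ε : ℝ) (hε : 0 < ε) (N : ℕ) (hN : 2 ≤ N)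
    (h2 : ((2 * N + 1) ^ m : ℝ) ≤ (1 + ε) ^ (N - 1)) (x : ℝ) (hx : 0 < x) :
    ∃ i : ℕ, 1 ≤ i ∧ i + 1 ≤ N ∧ ((Λ.box ((i + 1 : ℕ) * x)).card : ℝ) - (Λ.box (i * x)).card
      ≤ ε * (Λ.box ((i + 1 : ℕ) * x)).card := by
  by_contra hcon
  push Not at hcon
  have hpos : (0 : ℝ) < (Λ.box x).card := by
    exact_mod_cast card_pos.mpr ⟨0, Λ.zero_mem_box hx.le⟩
  have key : ∀ i, i + 1 ≤ N → (1 + ε) ^ i * (Λ.box x).card ≤ (Λ.box ((i + 1 : ℕ) * x)).card ∧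
      (0 < i → (1 + ε) ^ i * (Λ.box x).card < (Λ.box ((i + 1 : ℕ) * x)).card) := by
    intro i
    induction i with
    | zero => intro _; simp
    | succ i ih =>
      intro hi
      have h3 := (ih (by omega)).1
      have h4 := hcon (i + 1) (by omega) hi
      have h5 : (1 + ε) * (Λ.box ((i + 1 : ℕ) * x)).card < (Λ.box ((i + 1 + 1 : ℕ) * x)).card := by
        set a : ℝ := ((Λ.box ((i + 1 : ℕ) * x)).card : ℝ)
        set b : ℝ := ((Λ.box ((i + 1 + 1 : ℕ) * x)).card : ℝ)
        have hb : 0 ≤ b := by positivity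
        have h5a : (1 + ε) * a < (1 + ε) * ((1 - ε) * b) :=
          mul_lt_mul_of_pos_left (by linarith) (by linarith)
        nlinarith [mul_nonneg (sq_nonneg ε) hb]
      have h6 : (1 + ε) ^ (i + 1) * (Λ.box x).card < (Λ.box ((i + 1 + 1 : ℕ) * x)).card := by
        rw [pow_succ']
        refine lt_of_le_of_lt ?_ h5
        rw [mul_assoc]
        exact mul_le_mul_of_nonneg_left h3 (by linarith)
      exact ⟨h6.le, fun _ => h6⟩
  have h7 := Λ.card_box_cover N hx
  have h7' : ((Λ.box (N * x)).card : ℝ) ≤ (2 * N + 1) ^ m * (Λ.box x).card := by exact_mod_cast h7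
  obtain ⟨M, rfl⟩ : ∃ M, N = M + 1 := ⟨N - 1, by omega⟩
  rw [Nat.add_sub_cancel] at h2
  have hM : 0 < M := by omega
  have h8 := (key M le_rfl).2 hM
  have h9 : ((2 * ((M + 1 : ℕ) : ℝ) + 1) ^ m) * (Λ.box x).card ≤ (1 + ε) ^ M * (Λ.box x).card :=
      mul_le_mul_of_nonneg_right h2 hpos.le
  linarith

theorem selection (K ε ϕ : ℝ) (hK : 0 < K) (hε : 0 < ε) (hε1 : ε < 1) (hϕ : 0 < ϕ) (hϕ1 : ϕ ≤ 1)
    (N J : ℕ) (hN : 2 ≤ N) (h1 : (4 * N : ℝ) ≤ ϕ * 2 ^ J)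
    (h2 : ((2 * N + 1) ^ m : ℝ) ≤ (1 + ε) ^ (N - 1)) (L : ℝ) (hL : 0 < L) (hA : selA Λ γ K ε L) :
    ∃ L', 0 < L' ∧ L' ≤ L ∧ selA Λ γ K ε L' ∧ selB Λ γ K ϕ L' J ∧ Real.log 2 ≤ m * L' * Λ.s := by
  have hl2 : (0 : ℝ) < Real.log 2 := Real.log_pos (by norm_num)
  have main : ∀ n : ℕ, ∀ L, 0 < L → selA Λ γ K ε L → m * L * Λ.s < 2 ^ n * Real.log 2 →
      ∃ L', 0 < L' ∧ L' ≤ L ∧ selA Λ γ K ε L' ∧ selB Λ γ K ϕ L' J ∧ Real.log 2 ≤ m * L' * Λ.s := by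
    intro n
    induction n with
    | zero =>
      intro L hL hA hlt
      have := selA_lower Λ γ K ε L hK hL hε1 hA
      simp at hlt
      linarith
    | succ n ih =>
      intro L hL hA hlt
      by_cases hB : selB Λ γ K ϕ L J
      · exact ⟨L, hL, le_rfl, hA, hB, selA_lower Λ γ K ε L hK hL hε1 hA⟩
      · rw [selB] at hB
        push Not at hB
        obtain ⟨c, hc, l0, hl0, hcl⟩ := hB
        set x := 2 * L / 2 ^ J with hx
        have hx0 : 0 < x := by positivity
        obtain ⟨i, hi1, hiN, hi⟩ := exists_small Λ ε hε N hN h2 x hx0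
        set L' := ((i + 1 : ℕ) : ℝ) * x with hL'
        have hL'0 : 0 < L' := by positivity
        have hL'L : L' ≤ ϕ * L / 2 := by
          have h3 : ((i + 1 : ℕ) : ℝ) ≤ N := by exact_mod_cast hiN
          calc L' ≤ N * x := mul_le_mul_of_nonneg_right h3 hx0.le
            _ = (4 * N) * L / 2 / 2 ^ J := by rw [hx]; ring
            _ ≤ (ϕ * 2 ^ J) * L / 2 / 2 ^ J := by gcongr
            _ = _ := by field_simp
        have hA' : selA Λ γ K ε L' := by
          rw [selA]
          set T' := ⌈K * L'⌉₊ with hT'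
          classical
          have hr := rk_drop γ (Λ.box x) (Λ.box (i * x)) (Λ.box L') (by
            intro a ha b hb
            have := Λ.add_mem_box ha hb
            rw [hL']; push_cast; rw [add_mul, one_mul, add_comm]; exact this) T'
            (fun l => if l ∈ Λ.box x then c l else 0) (by intro l hl; simp [hl])
            ⟨l0, by simp [hl0, hcl]⟩ (by
              intro τ hτ
              rw [← hc τ ?_]
              · refine sum_congr rfl fun l hl => by simp [hl]
              · have h4 : ((∑ i, τ i : ℕ) : ℝ) < K * L' := Nat.lt_ceil.mp hτ
                refine lt_of_lt_of_le h4 ?_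
                have h5 := Nat.le_ceil (K * L)
                nlinarith)
          have hr' : (rk γ (Λ.box L') T' : ℝ) ≤ ε * (Λ.box L').card := by
            refine le_trans ?_ hi
            have : (rk γ (Λ.box L') T' : ℝ) + (Λ.box (i * x)).card ≤ (Λ.box L').card := by
              exact_mod_cast hr
            linarith
          calc _ ≤ ∑ j ∈ range T', (rk γ (Λ.box L') T' : ℝ) := by
                refine sum_le_sum fun j _ => ?_
                exact_mod_cast rk_mono γ _ (Nat.sub_le _ _)
            _ = T' * rk γ (Λ.box L') T' := by simp
            _ ≤ T' * (ε * (Λ.box L').card) := by gcongr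
            _ = _ := by ring
        have hle : L' ≤ L / 2 := by nlinarith
        obtain ⟨L'', a1, a2, a3⟩ := ih L' hL'0 hA' (by
          have hms : 0 ≤ m * Λ.s := mul_nonneg (Nat.cast_nonneg _) (by linarith [Λ.hs])
          rw [pow_succ] at hlt
          nlinarith)
        exact ⟨L'', a1, by linarith, a3⟩
  obtain ⟨n, hn⟩ := pow_unbounded_of_one_lt (m * L * Λ.s / Real.log 2) (by norm_num : (1 : ℝ) < 2)
  rw [div_lt_iff₀ hl2] at hn
  exact main n L hL hA hn

/-- the start -/
lemma selA_start (hk : k + 1 = m) (K ε : ℝ) (hK : 0 < K) (L : ℕ) (hL : 0 < L)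
    (h : (K * L + m) ^ m ≤ m.factorial * ε * (K * L) * (2 * L + 1) ^ m) (hε : 0 < ε) :
    selA Λ γ K ε L := by
  rw [selA]
  set T := ⌈K * L⌉₊ with hT
  have hKL : 0 < K * L := by positivity
  have hT1 : (K * L : ℝ) ≤ T := Nat.le_ceil _
  have hT2 : (T : ℝ) < K * L + 1 := Nat.ceil_lt_add_one hKL.le
  have h1 : ∑ j ∈ range T, (rk γ (Λ.box L) (T - j) : ℝ) ≤ ((T + k).choose (k + 1) : ℝ) := by
    rw [← hockey]
    push_cast
    refine sum_le_sum fun j _ => ?_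
    exact_mod_cast rk_le_tset γ _ _
  refine h1.trans ((Nat.choose_le_pow_div _ _).trans ?_)
  rw [hk, div_le_iff₀ (by positivity)]
  have h2 : ((T + k : ℕ) : ℝ) ≤ K * L + m := by
    rw [← hk]; push_cast; linarith
  calc (((T + k : ℕ) : ℝ)) ^ m ≤ (K * L + m) ^ m := by gcongr
    _ ≤ m.factorial * ε * (K * L) * (2 * L + 1) ^ m := h
    _ ≤ m.factorial * ε * T * (Λ.box L).card := by
        have : ((2 * L + 1) ^ m : ℝ) ≤ (Λ.box L).card := by exact_mod_cast Λ.card_box_ge L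
        gcongr
    _ = _ := by ring

end selection
end BW


namespace BW
open Finset Polynomial

lemma exists_psiJ (M J : ℕ) : ∃ ψ : ℂ → ℂ, Differentiable ℂ ψ ∧
    (∀ l : ℤ, ψ ((l : ℂ) / 2 ^ J) = (l : ℂ) / 2 ^ J) ∧
    (∀ l : ℤ, Odd l → ((2 * M : ℕ) : ℕ∞) ≤ analyticOrderAt (deriv ψ) ((l : ℂ) / 2 ^ J)) ∧
    (∀ z, ‖ψ z‖ ≤ ‖z‖ * (2 ^ M * Real.exp (Real.pi * M * (2 ^ J * ‖z‖)))) ∧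
    (∀ y : ℝ, ‖ψ y‖ ≤ |y| * 2 ^ M) := by
  obtain ⟨ψ, h1, h2, h3, h4, h5⟩ := exists_psi M
  have hJ : (2 ^ J : ℂ) ≠ 0 := pow_ne_zero _ two_ne_zero
  have hn : ‖(2 ^ J : ℂ)‖ = 2 ^ J := by simp
  refine ⟨fun z => (2 ^ J : ℂ)⁻¹ * ψ (2 ^ J * z), by fun_prop, ?_, ?_, ?_, ?_⟩
  · intro l
    beta_reduce
    rw [mul_div_cancel₀ _ hJ, h2]; field_simp
  · intro l hl
    have hd : deriv (fun z => (2 ^ J : ℂ)⁻¹ * ψ (2 ^ J * z)) = (deriv ψ) ∘ (fun z => 2 ^ J * z) := by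
      funext z
      have : HasDerivAt (fun z => (2 ^ J : ℂ)⁻¹ * ψ (2 ^ J * z))
          ((2 ^ J : ℂ)⁻¹ * (deriv ψ (2 ^ J * z) * (2 ^ J * 1))) z := by
        apply HasDerivAt.const_mul
        exact (h1 (2 ^ J * z)).hasDerivAt.comp z ((hasDerivAt_id z).const_mul _)
      rw [this.deriv]
      simp only [Function.comp]
      field_simp
    rw [hd, analyticOrderAt_comp_of_deriv_ne_zero]
    · rw [mul_div_cancel₀ _ hJ]; exact h3 l hl
    · fun_prop
    · rw [deriv_const_mul _ differentiableAt_id]; simp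
  · intro z
    rw [norm_mul, norm_inv, hn]
    have := h4 (2 ^ J * z)
    rw [norm_mul, hn] at this
    calc _ ≤ (2 ^ J : ℝ)⁻¹ * (2 ^ J * ‖z‖ * (2 ^ M * Real.exp (Real.pi * M * (2 ^ J * ‖z‖)))) := by gcongr
      _ = _ := by field_simp
  · intro y
    rw [norm_mul, norm_inv, hn]
    have := h5 (2 ^ J * y)
    push_cast at this
    rw [abs_mul, abs_of_pos (by positivity : (0 : ℝ) < 2 ^ J)] at this
    calc _ ≤ (2 ^ J : ℝ)⁻¹ * (2 ^ J * |y| * 2 ^ M) := by gcongr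
      _ = _ := by field_simp

/-- All the data of the transcendence construction. -/
structure Setup (P : Type) [Fintype P] (m k : ℕ) where
  Λ : Lat P m
  γ : Fin k → (P → ℤ) →+ ℤ
  cc : Fin k → ℝ
  κ : (P → ℤ) → ℝ
  lam : ℝ
  hθ : ∀ l ∈ Λ.lat, theta Λ.pr l = ∑ i, cc i * γ i l + κ l * lam
  L : ℝ
  hL : 0 < L
  t1 : ℝ
  ht1 : 0 ≤ t1
  κ0 : ℝ
  hγ : ∀ l ∈ Λ.box L, ∀ i, |(γ i l : ℝ)| ≤ Real.exp t1
  hκ : ∀ l ∈ Λ.box L, |κ l| ≤ κ0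
  k0 : ℕ
  hk0 : 0 < k0
  d : ℕ
  hd0 : 0 < d
  hd : ∀ i, 1 ≤ i → i ≤ k0 → i ∣ d
  hdt : (d : ℝ) ≤ Real.exp t1
  L0 : ℕ
  u : ℝ
  pc : (P → ℤ) → ℕ → ℤ
  hu : ∀ l ∈ Λ.box L, ∀ r < L0, |(pc l r : ℝ)| ≤ Real.exp u

namespace Setup
variable {P : Type} [Fintype P] {m k : ℕ} (S : Setup P m k)

/-- the polynomials -/
noncomputable def Pl (l : P → ℤ) : ℚ[X] := ∑ r ∈ range S.L0, C (S.pc l r : ℚ) * Bp S.k0 r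

/-- bound for polynomials -/
noncomputable def bd (ρ : ℝ) : ℝ := S.L0 * Real.exp S.u * ((1 + (ρ + 1) / S.k0) ^ S.L0 *
  Real.exp (S.L0 + S.k0))

lemma Pl_le {l : P → ℤ} (hl : l ∈ S.Λ.box S.L) (j : ℕ) (z : ℂ) (ρ : ℝ) (hz : ‖z‖ ≤ ρ) :
    ‖aeval z (hasseDeriv j (S.Pl l))‖ ≤ S.bd ρ := by
  have hρ : 0 ≤ ρ := (norm_nonneg z).trans hz
  rw [Pl, map_sum, map_sum]
  refine (norm_sum_le _ _).trans ?_
  have : ∀ r ∈ range S.L0, ‖aeval z (hasseDeriv j (C (S.pc l r : ℚ) * Bp S.k0 r))‖ ≤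
      Real.exp S.u * ((1 + (ρ + 1) / S.k0) ^ S.L0 * Real.exp (S.L0 + S.k0)) := by
    intro r hr
    rw [mem_range] at hr
    rw [← smul_eq_C_mul, map_smul, map_smul, norm_smul]
    have h1 := S.hu l hl r hr
    have h2 := hasse_Bp_le S.k0 r j S.hk0 z ρ hz
    have hk : (0 : ℝ) < S.k0 := by exact_mod_cast S.hk0
    have h3 : (1 + (ρ + 1) / S.k0) ^ r * Real.exp (r + S.k0) ≤
        (1 + (ρ + 1) / S.k0) ^ S.L0 * Real.exp (S.L0 + S.k0) := by
      have : (r : ℝ) ≤ S.L0 := by exact_mod_cast hr.le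
      have h4 : (1 : ℝ) ≤ 1 + (ρ + 1) / S.k0 := by
        have : 0 ≤ (ρ + 1) / (S.k0 : ℝ) := by positivity
        linarith
      gcongr
    refine mul_le_mul ?_ (h2.trans h3) (norm_nonneg _) (by positivity)
    have h5 : ‖(S.pc l r : ℚ)‖ = |(S.pc l r : ℝ)| := by
      rw [← Rat.norm_cast_real, Rat.cast_intCast, Real.norm_eq_abs]
    rw [h5]; exact h1
  refine (sum_le_card_nsmul _ _ _ this).trans ?_
  simp [bd]; linarith

lemma Pl_int (l : P → ℤ) (J : ℕ) (x : ℤ) (j : ℕ) : ∃ A : ℤ,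
    ((2 ^ (J + 1) : ℕ) : ℚ) ^ S.L0 * (S.d : ℚ) ^ j * (hasseDeriv j (S.Pl l)).eval ((x : ℚ) / 2 ^ J) = A := by
  have h : ∀ r, r < S.L0 → ∃ A : ℤ, ((2 ^ (J + 1) : ℕ) : ℚ) ^ S.L0 * (S.d : ℚ) ^ j *
      (hasseDeriv j (C (S.pc l r : ℚ) * Bp S.k0 r)).eval ((x : ℚ) / 2 ^ J) = A := by
    intro r hr
    obtain ⟨A, hA⟩ := Bp_integral S.k0 S.d S.hd S.hk0 (2 ^ (J + 1)) ((x : ℚ) / 2 ^ J)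
      (choose_half J x) r j
    refine ⟨(2 ^ (J + 1)) ^ (S.L0 - r) * S.pc l r * A, ?_⟩
    rw [← smul_eq_C_mul, map_smul, eval_smul, smul_eq_mul]
    push_cast at hA ⊢
    rw [← hA]
    have : S.L0 = (S.L0 - r) + r := by omega
    conv_lhs => rw [this, pow_add]
    ring
  choose! A hA using h
  refine ⟨∑ r ∈ range S.L0, A r, ?_⟩
  rw [Pl, map_sum, eval_finsetSum, mul_sum]
  push_cast
  refine sum_congr rfl fun r hr => ?_
  rw [← hA r (mem_range.mp hr)]
  push_cast; ring

/-- the interpolation function -/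
noncomputable def F (ψ : ℂ → ℂ) (I : Finset (P → ℤ)) (j : ℕ) (τ : Fin k → ℕ) (z : ℂ) : ℂ :=
  ∑ l ∈ I, aeval z (hasseDeriv j (S.Pl l)) * (qm S.γ τ l : ℂ) *
    Complex.exp (((theta S.Λ.pr l - S.κ l * S.lam : ℝ) : ℂ) * z + ((S.κ l * S.lam : ℝ) : ℂ) * ψ z)

/-- auxiliary function for the derivative -/
noncomputable def G (ψ : ℂ → ℂ) (I : Finset (P → ℤ)) (j : ℕ) (τ : Fin k → ℕ) (z : ℂ) : ℂ :=
  ∑ l ∈ I, ((S.κ l * S.lam : ℝ) : ℂ) * (aeval z (hasseDeriv j (S.Pl l)) * (qm S.γ τ l : ℂ) *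
    Complex.exp (((theta S.Λ.pr l - S.κ l * S.lam : ℝ) : ℂ) * z + ((S.κ l * S.lam : ℝ) : ℂ) * ψ z))

lemma F_diff {ψ : ℂ → ℂ} (hψ : Differentiable ℂ ψ) (I : Finset (P → ℤ)) (j : ℕ) (τ : Fin k → ℕ) :
    Differentiable ℂ (S.F ψ I j τ) := by
  unfold F
  refine Differentiable.fun_sum fun l _ => ?_
  have := Polynomial.differentiable_aeval (𝕜 := ℂ) (hasseDeriv j (S.Pl l))
  fun_prop

lemma G_diff {ψ : ℂ → ℂ} (hψ : Differentiable ℂ ψ) (I : Finset (P → ℤ)) (j : ℕ) (τ : Fin k → ℕ) :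
    Differentiable ℂ (S.G ψ I j τ) := by
  unfold G
  refine Differentiable.fun_sum fun l _ => ?_
  have := Polynomial.differentiable_aeval (𝕜 := ℂ) (hasseDeriv j (S.Pl l))
  fun_prop

lemma qm_succ (γ : Fin k → (P → ℤ) →+ ℤ) (τ : Fin k → ℕ) (i : Fin k) (l : P → ℤ) :
    qm γ (τ + Pi.single i 1) l = γ i l * qm γ τ l := by
  classical
  simp only [qm, Pi.add_apply, pow_add, prod_mul_distrib]
  rw [mul_comm]; congr 1
  rw [Finset.prod_eq_single i]
  · simp
  · intro j _ hj; simp [hj]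
  · simp

lemma F_deriv {ψ : ℂ → ℂ} (hψ : Differentiable ℂ ψ) (I : Finset (P → ℤ)) (hI : I ⊆ S.Λ.box S.L)
    (j : ℕ) (τ : Fin k → ℕ) :
    deriv (S.F ψ I j τ) = (fun z => ((j + 1 : ℕ) : ℂ) * S.F ψ I (j + 1) τ z) +
      (fun z => ∑ i, (S.cc i : ℂ) * S.F ψ I j (τ + Pi.single i 1) z) +
      (deriv ψ) * (S.G ψ I j τ) := by
  funext z
  have hd : HasDerivAt (S.F ψ I j τ) (∑ l ∈ I,
      ((((j + 1 : ℕ) : ℂ) * aeval z (hasseDeriv (j + 1) (S.Pl l)) * (qm S.γ τ l : ℂ)) *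
      Complex.exp (((theta S.Λ.pr l - S.κ l * S.lam : ℝ) : ℂ) * z + ((S.κ l * S.lam : ℝ) : ℂ) * ψ z)
      + aeval z (hasseDeriv j (S.Pl l)) * (qm S.γ τ l : ℂ) *
      (Complex.exp (((theta S.Λ.pr l - S.κ l * S.lam : ℝ) : ℂ) * z + ((S.κ l * S.lam : ℝ) : ℂ) * ψ z) *
      (((theta S.Λ.pr l - S.κ l * S.lam : ℝ) : ℂ) * 1 + ((S.κ l * S.lam : ℝ) : ℂ) * deriv ψ z)))) z := by
    unfold F
    refine HasDerivAt.fun_sum fun l _ => ?_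
    refine HasDerivAt.mul (HasDerivAt.mul_const ?_ _) ?_
    · have h1 := Polynomial.hasDerivAt_aeval (hasseDeriv j (S.Pl l)) z
      have h2 : derivative (hasseDeriv j (S.Pl l)) = (j + 1 : ℕ) • hasseDeriv (j + 1) (S.Pl l) := by
        have := congrArg (fun f => f (S.Pl l)) (hasseDeriv_comp (R := ℚ) 1 j)
        simp only [LinearMap.comp_apply, LinearMap.smul_apply, hasseDeriv_one, Nat.choose_one_right] at this
        rw [this, add_comm 1 j]
      rw [h2] at h1
      simpa using h1
    · refine HasDerivAt.cexp (HasDerivAt.add ?_ ?_)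
      · exact (hasDerivAt_id z).const_mul _
      · exact (hψ z).hasDerivAt.const_mul _
  rw [hd.deriv]
  simp only [Pi.add_apply, Pi.mul_apply, F, G, mul_sum]
  rw [sum_comm, ← sum_add_distrib, ← sum_add_distrib]
  refine sum_congr rfl fun l hl => ?_
  have hθ := S.hθ l ((S.Λ.mem_box.mp (hI hl)).1)
  have h3 : ((theta S.Λ.pr l - S.κ l * S.lam : ℝ) : ℂ) = ∑ i, (S.cc i : ℂ) * (S.γ i l : ℂ) := by
    rw [hθ]; push_cast; ring
  simp only [qm_succ]
  set e := Complex.exp (((theta S.Λ.pr l - S.κ l * S.lam : ℝ) : ℂ) * z + ((S.κ l * S.lam : ℝ) : ℂ) * ψ z)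
  have h4 : ∑ i, (S.cc i : ℂ) * (aeval z (hasseDeriv j (S.Pl l)) * ((S.γ i l * qm S.γ τ l : ℤ) : ℂ) * e)
      = (∑ i, (S.cc i : ℂ) * (S.γ i l : ℂ)) * (aeval z (hasseDeriv j (S.Pl l)) * (qm S.γ τ l : ℂ) * e) := by
    rw [sum_mul]
    refine sum_congr rfl fun i _ => ?_
    push_cast; ring
  rw [h4, ← h3]
  ring

lemma order_sum_le {ι : Type} (s : Finset ι) (f : ι → ℂ → ℂ) (z : ℂ) (n : ℕ∞)
    (h : ∀ i ∈ s, n ≤ analyticOrderAt (f i) z) : n ≤ analyticOrderAt (∑ i ∈ s, f i) z := by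
  classical
  induction s using Finset.induction_on with
  | empty =>
    have : analyticOrderAt (∑ i ∈ (∅ : Finset ι), f i) z = ⊤ := by
      rw [analyticOrderAt_eq_top]; simp
    rw [this]; exact le_top
  | insert a s ha ih =>
    rw [sum_insert ha]
    refine le_trans (le_min ?_ ?_) le_analyticOrderAt_add
    · exact h a (mem_insert_self _ _)
    · exact ih fun i hi => h i (mem_insert_of_mem hi)

lemma order_mul_le {f g : ℂ → ℂ} (hf : Differentiable ℂ f) (hg : Differentiable ℂ g) (z : ℂ)
    (n : ℕ∞) (h : n ≤ analyticOrderAt f z) : n ≤ analyticOrderAt (g * f) z := by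
  rw [analyticOrderAt_mul (hg.analyticAt z) (hf.analyticAt z)]
  exact h.trans le_add_self

lemma F_order {ψ : ℂ → ℂ} (hψ : Differentiable ℂ ψ) (I : Finset (P → ℤ)) (hI : I ⊆ S.Λ.box S.L)
    (z : ℂ) (M : ℕ) (hM : ((2 * M : ℕ) : ℕ∞) ≤ analyticOrderAt (deriv ψ) z) (n : ℕ)
    (hn : n ≤ 2 * M + 1) : ∀ (j : ℕ) (τ : Fin k → ℕ),
    (∀ j' τ', j' + ∑ i, τ' i < j + ∑ i, τ i + n → S.F ψ I j' τ' z = 0) →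
    (n : ℕ∞) ≤ analyticOrderAt (S.F ψ I j τ) z := by
  induction n with
  | zero => intro j τ _; simp
  | succ n ih =>
    intro j τ h
    have hF := (S.F_diff hψ I j τ).analyticAt z
    have h0 : S.F ψ I j τ z = 0 := h j τ (by omega)
    have h1 := hF.analyticOrderAt_deriv_add_one
    simp only [h0, sub_zero] at h1
    have h2 : analyticOrderAt (S.F ψ I j τ) z = analyticOrderAt (deriv (S.F ψ I j τ)) z + 1 := h1.symm
    rw [h2]
    push_cast
    gcongr
    rw [S.F_deriv hψ I hI]
    refine le_trans (le_min (le_trans (le_min ?_ ?_) le_analyticOrderAt_add) ?_) le_analyticOrderAt_add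
    · have := ih (by omega) (j + 1) τ (fun j' τ' hh => h j' τ' (by omega))
      exact order_mul_le (S.F_diff hψ I (j + 1) τ) (g := fun _ => ((j + 1 : ℕ) : ℂ)) (by fun_prop) z _ this
    · have e : (fun z => ∑ i, (S.cc i : ℂ) * S.F ψ I j (τ + Pi.single i 1) z) =
          ∑ i, (fun _ => (S.cc i : ℂ)) * S.F ψ I j (τ + Pi.single i 1) := by
        funext z; simp
      rw [e]
      refine order_sum_le _ _ _ _ fun i _ => ?_
      refine order_mul_le (S.F_diff hψ I _ _) (by fun_prop) z _ (ih (by omega) _ _ ?_)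
      intro j' τ' hh
      refine h j' τ' ?_
      simp only [Pi.add_apply, sum_add_distrib, sum_pi_single', Finset.mem_univ, if_true] at hh
      omega
    · rw [mul_comm]
      refine order_mul_le ?_ (S.G_diff hψ I j τ) z _ (le_trans ?_ hM)
      · exact hψ.deriv
      · exact_mod_cast (by omega : n ≤ 2 * M)

end Setup
end BW


namespace BW
open Finset Polynomial
namespace Setup
variable {P : Type} [Fintype P] {m k : ℕ} (S : Setup P m k)

/-- the real sums -/
noncomputable def X (I : Finset (P → ℤ)) (j : ℕ) (τ : Fin k → ℕ) (y : ℚ) : ℝ :=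
  ∑ l ∈ I, (((hasseDeriv j (S.Pl l)).eval y : ℚ) : ℝ) * (qm S.γ τ l : ℝ) *
    Real.exp (theta S.Λ.pr l * (y : ℝ))

/-- vanishing predicate -/
def VV (J Sn : ℕ) (T' : ℝ) (I : Finset (P → ℤ)) : Prop :=
  ∀ l : ℤ, Odd l → |l| < 2 ^ (J + 1) * Sn → ∀ j τ, ((j + ∑ i, τ i : ℕ) : ℝ) < T' →
    S.X I j τ ((l : ℚ) / 2 ^ J) = 0

lemma aeval_rat (p : ℚ[X]) (y : ℚ) : aeval ((y : ℝ) : ℂ) p = (((p.eval y : ℚ) : ℝ) : ℂ) := by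
  have : ((y : ℝ) : ℂ) = algebraMap ℚ ℂ y := by simp
  rw [this, aeval_algebraMap_apply]
  simp

lemma F_eq_X {ψ : ℂ → ℂ} (I : Finset (P → ℤ)) (j : ℕ) (τ : Fin k → ℕ) (y : ℚ)
    (h : ψ ((y : ℝ) : ℂ) = ((y : ℝ) : ℂ)) : S.F ψ I j τ ((y : ℝ) : ℂ) = (S.X I j τ y : ℂ) := by
  unfold F X
  rw [h]
  push_cast
  refine sum_congr rfl fun l _ => ?_
  have := aeval_rat (hasseDeriv j (S.Pl l)) y
  push_cast at this
  rw [this]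
  congr 2
  ring

lemma qm_le {l : P → ℤ} (hl : l ∈ S.Λ.box S.L) (τ : Fin k → ℕ) :
    |(qm S.γ τ l : ℝ)| ≤ Real.exp (S.t1 * (∑ i, τ i : ℕ)) := by
  unfold qm
  push_cast
  rw [abs_prod, mul_sum, Real.exp_sum]
  refine prod_le_prod (fun _ _ => abs_nonneg _) fun i _ => ?_
  rw [abs_pow, mul_comm, Real.exp_nat_mul]
  exact pow_le_pow_left₀ (abs_nonneg _) (S.hγ l hl i) _

lemma bd_nonneg (ρ : ℝ) (hρ : 0 ≤ ρ) : 0 ≤ S.bd ρ := by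
  unfold bd; positivity

lemma F_bound {ψ : ℂ → ℂ} (I : Finset (P → ℤ)) (hI : I ⊆ S.Λ.box S.L) (j : ℕ) (τ : Fin k → ℕ)
    (z : ℂ) (R : ℝ) (hz : ‖z‖ = R) (h1 : S.κ0 * |S.lam| * R ≤ 1) (h2 : S.κ0 * |S.lam| * ‖ψ z‖ ≤ 1) :
    ‖S.F ψ I j τ z‖ ≤ #I * S.bd R * Real.exp (S.t1 * (∑ i, τ i : ℕ)) *
      Real.exp (S.L * S.Λ.w * R + 2) := by
  have hR : 0 ≤ R := hz ▸ norm_nonneg z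
  unfold F
  refine (norm_sum_le _ _).trans ?_
  have : ∀ l ∈ I, ‖aeval z (hasseDeriv j (S.Pl l)) * (qm S.γ τ l : ℂ) *
    Complex.exp (((theta S.Λ.pr l - S.κ l * S.lam : ℝ) : ℂ) * z + ((S.κ l * S.lam : ℝ) : ℂ) * ψ z)‖ ≤
      S.bd R * Real.exp (S.t1 * (∑ i, τ i : ℕ)) * Real.exp (S.L * S.Λ.w * R + 2) := by
    intro l hl
    rw [norm_mul, norm_mul]
    have b1 := S.Pl_le (hI hl) j z R hz.le
    have b2 := S.qm_le (hI hl) τ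
    have b3 : ‖(qm S.γ τ l : ℂ)‖ = |(qm S.γ τ l : ℝ)| := by
      rw [← Complex.ofReal_intCast, Complex.norm_real, Real.norm_eq_abs]
    rw [b3]
    refine mul_le_mul (mul_le_mul b1 b2 (abs_nonneg _) (S.bd_nonneg R hR)) ?_ (norm_nonneg _)
      (mul_nonneg (S.bd_nonneg R hR) (Real.exp_pos _).le)
    rw [Complex.norm_exp, Real.exp_le_exp]
    refine (Complex.re_le_norm _).trans ((norm_add_le _ _).trans ?_)
    rw [norm_mul, norm_mul, Complex.norm_real, Complex.norm_real, Real.norm_eq_abs, Real.norm_eq_abs, hz]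
    have hκ := S.hκ l (hI hl)
    have e1 : |S.κ l * S.lam| ≤ S.κ0 * |S.lam| := by
      rw [abs_mul]; gcongr
    have e2 : |theta S.Λ.pr l - S.κ l * S.lam| ≤ S.L * S.Λ.w + S.κ0 * |S.lam| :=
      (abs_sub _ _).trans (add_le_add (S.Λ.theta_le (hI hl)) e1)
    have e3 := mul_le_mul_of_nonneg_right e2 hR
    have e4 := mul_le_mul_of_nonneg_right e1 (norm_nonneg (ψ z))
    linarith
  refine (sum_le_card_nsmul _ _ _ this).trans ?_
  rw [nsmul_eq_mul]
  exact le_of_eq (by ring)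

lemma F_sub_X {ψ : ℂ → ℂ} (I : Finset (P → ℤ)) (hI : I ⊆ S.Λ.box S.L) (j : ℕ) (τ : Fin k → ℕ)
    (y : ℚ) (Y δ : ℝ) (hy : |(y : ℝ)| ≤ Y) (hδ : S.κ0 * |S.lam| * ‖ψ ((y : ℝ) : ℂ) - ((y : ℝ) : ℂ)‖ ≤ δ)
    (hδ1 : δ ≤ 1) :
    ‖S.F ψ I j τ ((y : ℝ) : ℂ) - (S.X I j τ y : ℂ)‖ ≤ #I * S.bd Y * Real.exp (S.t1 * (∑ i, τ i : ℕ)) *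
      Real.exp (S.L * S.Λ.w * Y) * (2 * δ) := by
  have hY : 0 ≤ Y := (abs_nonneg _).trans hy
  have hX : (S.X I j τ y : ℂ) = ∑ l ∈ I, aeval ((y : ℝ) : ℂ) (hasseDeriv j (S.Pl l)) * (qm S.γ τ l : ℂ) *
      Complex.exp ((theta S.Λ.pr l * (y : ℝ) : ℝ) : ℂ) := by
    unfold X
    rw [Complex.ofReal_sum]
    refine sum_congr rfl fun l _ => ?_
    rw [aeval_rat]; push_cast; rfl
  rw [hX]
  unfold F
  rw [← sum_sub_distrib]
  refine (norm_sum_le _ _).trans ?_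
  have : ∀ l ∈ I, ‖aeval ((y : ℝ) : ℂ) (hasseDeriv j (S.Pl l)) * (qm S.γ τ l : ℂ) *
      Complex.exp (((theta S.Λ.pr l - S.κ l * S.lam : ℝ) : ℂ) * ((y : ℝ) : ℂ) +
        ((S.κ l * S.lam : ℝ) : ℂ) * ψ ((y : ℝ) : ℂ)) -
      aeval ((y : ℝ) : ℂ) (hasseDeriv j (S.Pl l)) * (qm S.γ τ l : ℂ) *
      Complex.exp ((theta S.Λ.pr l * (y : ℝ) : ℝ) : ℂ)‖ ≤
      S.bd Y * Real.exp (S.t1 * (∑ i, τ i : ℕ)) * (Real.exp (S.L * S.Λ.w * Y) * (2 * δ)) := by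
    intro l hl
    rw [← mul_sub, norm_mul, norm_mul]
    have b1 := S.Pl_le (hI hl) j ((y : ℝ) : ℂ) Y (by rwa [Complex.norm_real, Real.norm_eq_abs])
    have b2 := S.qm_le (hI hl) τ
    have b3 : ‖(qm S.γ τ l : ℂ)‖ = |(qm S.γ τ l : ℝ)| := by
      rw [← Complex.ofReal_intCast, Complex.norm_real, Real.norm_eq_abs]
    rw [b3]
    refine mul_le_mul (mul_le_mul b1 b2 (abs_nonneg _) (S.bd_nonneg Y hY)) ?_ (norm_nonneg _)
      (mul_nonneg (S.bd_nonneg Y hY) (Real.exp_pos _).le)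
    have hκ := S.hκ l (hI hl)
    have e1 : |S.κ l * S.lam| ≤ S.κ0 * |S.lam| := by
      rw [abs_mul]; gcongr
    set D := ((S.κ l * S.lam : ℝ) : ℂ) * (ψ ((y : ℝ) : ℂ) - ((y : ℝ) : ℂ)) with hD
    have hDn : ‖D‖ ≤ δ := by
      rw [hD, norm_mul, Complex.norm_real, Real.norm_eq_abs]
      exact (mul_le_mul_of_nonneg_right e1 (norm_nonneg _)).trans hδ
    have e5 : (((theta S.Λ.pr l - S.κ l * S.lam : ℝ) : ℂ) * ((y : ℝ) : ℂ) +
        ((S.κ l * S.lam : ℝ) : ℂ) * ψ ((y : ℝ) : ℂ)) = ((theta S.Λ.pr l * (y : ℝ) : ℝ) : ℂ) + D := by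
      rw [hD]; push_cast; ring
    rw [e5, Complex.exp_add]
    have e6 : Complex.exp ((theta S.Λ.pr l * (y : ℝ) : ℝ) : ℂ) * Complex.exp D -
        Complex.exp ((theta S.Λ.pr l * (y : ℝ) : ℝ) : ℂ) =
        Complex.exp ((theta S.Λ.pr l * (y : ℝ) : ℝ) : ℂ) * (Complex.exp D - 1) := by ring
    rw [e6, norm_mul]
    refine mul_le_mul ?_ ((Complex.norm_exp_sub_one_le (hDn.trans hδ1)).trans (by linarith))
      (norm_nonneg _) (Real.exp_pos _).le
    rw [Complex.norm_exp, Complex.ofReal_re, Real.exp_le_exp]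
    refine (le_abs_self _).trans ?_
    rw [abs_mul]
    exact mul_le_mul (S.Λ.theta_le (hI hl)) hy (abs_nonneg _)
      (mul_nonneg S.hL.le S.Λ.w_nonneg)
  refine (sum_le_card_nsmul _ _ _ this).trans ?_
  rw [nsmul_eq_mul]
  exact le_of_eq (by ring)

/-- the interpolation points -/
noncomputable def Zp (J N : ℕ) : Finset ℝ := (range N).image fun i : ℕ => (((2 * (i : ℤ) + 1 - N : ℤ) : ℝ) / 2 ^ J)

lemma Zp_card (J N : ℕ) : #(Zp J N) = N := by
  unfold Zp
  rw [card_image_of_injective, card_range]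
  intro a b h
  have h2 : (2 ^ J : ℝ) ≠ 0 := by positivity
  have h3 := (div_left_inj' h2).mp h
  have h4 : (2 * (a : ℤ) + 1 - N) = 2 * (b : ℤ) + 1 - N := by exact_mod_cast h3
  omega

lemma mem_Zp {J N : ℕ} (hN : Even N) {x : ℝ} : x ∈ Zp J N ↔
    ∃ l : ℤ, Odd l ∧ |l| < N ∧ (x = (l : ℝ) / 2 ^ J) := by
  unfold Zp
  rw [mem_image]
  obtain ⟨M, hM⟩ := hN
  constructor
  · rintro ⟨i, hi, rfl⟩
    rw [mem_range] at hi
    refine ⟨2 * i + 1 - N, ⟨(i : ℤ) - M, by subst hM; push_cast; ring⟩, ?_, rfl⟩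
    rw [abs_lt]; omega
  · rintro ⟨l, ⟨r, hr⟩, hl, rfl⟩
    rw [abs_lt] at hl
    refine ⟨(r + M).toNat, ?_, ?_⟩
    · rw [mem_range]; omega
    · congr 2
      rw [Int.toNat_of_nonneg (by omega)]
      subst hM; push_cast; omega

/-- Schwarz lemma part -/
lemma F_schwarz (I : Finset (P → ℤ)) (hI : I ⊆ S.Λ.box S.L) (J Sn Mn M' : ℕ)
    (hM : Mn ≤ 2 * M' + 1) (T' : ℝ) (hV : S.VV J Sn T' I) {ψ : ℂ → ℂ} (hψ : Differentiable ℂ ψ)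
    (hψ1 : ∀ l : ℤ, ψ ((l : ℂ) / 2 ^ J) = (l : ℂ) / 2 ^ J)
    (hψ2 : ∀ l : ℤ, Odd l → ((2 * M' : ℕ) : ℕ∞) ≤ analyticOrderAt (deriv ψ) ((l : ℂ) / 2 ^ J))
    (j : ℕ) (τ : Fin k → ℕ) (hjτ : ((j + ∑ i, τ i : ℕ) : ℝ) + Mn < T' + 1) (R Q g y H : ℝ)
    (hR : 2 * Sn < R) (hy : |y| ≤ R) (hyQ : y ^ 2 ≤ Q) (hQ : (2 * Sn) ^ 2 ≤ Q)
    (hg : Q ≤ Real.exp (-2 * g) * (R ^ 2 - (2 * Sn) ^ 2))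
    (hH : ∀ z, ‖z‖ = R → ‖S.F ψ I j τ z‖ ≤ H) :
    ‖S.F ψ I j τ y‖ ≤ H * Real.exp (-(g * (Mn * (2 ^ (J + 1) * Sn)))) := by
  have hN : Even (2 ^ (J + 1) * Sn) := by
    rw [pow_succ, mul_assoc, mul_comm, mul_assoc]; exact even_two_mul _
  have hR0 : 0 ≤ R := le_trans (by positivity) hR.le
  have hH0 : 0 ≤ H := (norm_nonneg _).trans (hH R (by rw [Complex.norm_real, Real.norm_eq_abs, abs_of_nonneg hR0]))
  have key := schwarz (S.F_diff hψ I j τ) Mn (Zp J (2 ^ (J + 1) * Sn)) ?_ (2 * Sn) R H Q y ?_ (by positivity)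
    hR ?_ hH hy hyQ hQ
  · rw [Zp_card] at key
    set n := Mn * (2 ^ (J + 1) * Sn) with hn
    have hpos : 0 < R ^ 2 - (2 * (Sn : ℝ)) ^ 2 := by
      have : (2 * (Sn : ℝ)) ^ 2 < R ^ 2 := by gcongr
      linarith
    have hQ0 : 0 ≤ Q := (sq_nonneg _).trans hyQ
    have h1 : Q ^ n ≤ Real.exp (-2 * g) ^ n * (R ^ 2 - (2 * (Sn : ℝ)) ^ 2) ^ n := by
      rw [← mul_pow]; exact pow_le_pow_left₀ hQ0 hg _
    have h2 : ‖S.F ψ I j τ y‖ ^ 2 ≤ H ^ 2 * Real.exp (-2 * g) ^ n := by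
      have h3 : 0 < (R ^ 2 - (2 * (Sn : ℝ)) ^ 2) ^ n := pow_pos hpos _
      refine le_of_mul_le_mul_right (key.trans ?_) h3
      calc H ^ 2 * Q ^ n ≤ H ^ 2 * (Real.exp (-2 * g) ^ n * (R ^ 2 - (2 * (Sn : ℝ)) ^ 2) ^ n) := by gcongr
        _ = _ := by ring
    refine le_of_sq_le_sq (h2.trans (le_of_eq ?_)) (by positivity)
    rw [mul_pow, ← Real.exp_nat_mul, ← Real.exp_nat_mul]
    congr 2
    rw [hn]; push_cast; ring
  · intro x hx
    rw [mem_Zp hN] at hx ⊢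
    obtain ⟨l, h1, h2, h3⟩ := hx
    exact ⟨-l, h1.neg, by rwa [abs_neg], by rw [h3]; push_cast; ring⟩
  · intro x hx
    rw [mem_Zp hN] at hx
    obtain ⟨l, h1, h2, h3⟩ := hx
    have h2' : |(l : ℝ)| ≤ 2 ^ (J + 1) * Sn := by exact_mod_cast h2.le
    rw [h3, abs_div, abs_of_pos (by positivity : (0 : ℝ) < 2 ^ J), div_le_iff₀ (by positivity)]
    exact h2'.trans (le_of_eq (by ring))
  · intro x hx
    rw [mem_Zp hN] at hx
    obtain ⟨l, h1, h2, h3⟩ := hx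
    have hx' : (x : ℂ) = (l : ℂ) / 2 ^ J := by rw [h3]; push_cast; rfl
    have hx2 : (x : ℂ) = (((l : ℚ) / 2 ^ J : ℚ) : ℝ) := by rw [hx']; push_cast; rfl
    rw [hx']
    refine S.F_order hψ I hI _ M' (hψ2 l h1) Mn hM j τ ?_
    intro j' τ' hh
    have h4 := hV l h1 (by exact_mod_cast h2) j' τ' (by
      have h5 : ((j' + ∑ i, τ' i : ℕ) : ℝ) + 1 ≤ ((j + ∑ i, τ i : ℕ) : ℝ) + Mn := by exact_mod_cast hh
      linarith)
    rw [← hx', hx2, S.F_eq_X I j' τ' _ (by rw [← hx2, hx', hψ1]), h4]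
    simp

end Setup
end BW


namespace BW
open Finset Polynomial
namespace Setup
variable {P : Type} [Fintype P] {m k : ℕ} (S : Setup P m k)

lemma abs_coord_le {l : P → ℤ} (hl : l ∈ S.Λ.box S.L) (p : P) :
    |(l p : ℝ)| ≤ S.L * ∑ i, |(S.Λ.v i p : ℝ)| := by
  obtain ⟨h1, h2⟩ := S.Λ.mem_box.mp hl
  rw [h1 p, mul_sum]
  refine (abs_sum_le_sum_abs _ _).trans (sum_le_sum fun i _ => ?_)
  rw [abs_mul]
  exact mul_le_mul_of_nonneg_right (h2 i) (abs_nonneg _)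

lemma X_liouville (I : Finset (P → ℤ)) (hI : I ⊆ S.Λ.box S.L) (l0 : P → ℤ) (hl0 : l0 ∈ I)
    (J' : ℕ) (x : ℤ) (y : ℚ) (hyx : y = (x : ℚ) / 2 ^ J') (Y : ℝ) (hy : |(y : ℝ)| ≤ Y)
    (𝓛 : AddSubgroup (P → ℤ)) (D : ℕ) (hD : 1 ≤ D) (rep : Fin D → P → ℤ)
    (hrep : ∀ μ ∈ 𝓛, ∃ i, ∃ ν, μ = rep i + 2 • ν) (μ : (P → ℤ) → P → ℤ)
    (hμ : ∀ l ∈ I, μ l ∈ 𝓛) (hμy : ∀ l ∈ I, ∀ p, (μ l p : ℝ) = 2 * y * (l p - l0 p))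
    (j : ℕ) (τ : Fin k → ℕ) (B1 bY : ℝ)
    (hB : (J' + 1) * S.L0 * Real.log 2 + S.t1 * ((j + ∑ i, τ i : ℕ) : ℝ) ≤ B1)
    (hbY : #I * S.bd Y ≤ Real.exp bY) (hX : S.X I j τ y ≠ 0) :
    1 ≤ Real.exp (B1 - S.t1 * (∑ i, τ i : ℕ)) * |S.X I j τ y| *
      Real.exp ((D - 1) * (B1 + bY + S.L * S.Λ.w * Y) + D * (Y * (S.L * S.Λ.h))) := by
  classical
  have hY : 0 ≤ Y := (abs_nonneg _).trans hy
  set c : ℝ := ((2 ^ (J' + 1) : ℕ) : ℝ) ^ S.L0 * (S.d : ℝ) ^ j with hc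
  have hc0 : 0 < c := by
    have : (0 : ℝ) < S.d := by exact_mod_cast S.hd0
    positivity
  have hcB : c ≤ Real.exp (B1 - S.t1 * (∑ i, τ i : ℕ)) := by
    have e1 : ((2 ^ (J' + 1) : ℕ) : ℝ) ^ S.L0 = Real.exp ((J' + 1) * S.L0 * Real.log 2) := by
      push_cast
      rw [← pow_mul, ← Real.exp_log (by norm_num : (0 : ℝ) < 2), ← Real.exp_nat_mul, Real.log_exp]
      push_cast; rfl
    have e2 : (S.d : ℝ) ^ j ≤ Real.exp (S.t1 * j) := by
      rw [mul_comm, Real.exp_nat_mul]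
      exact pow_le_pow_left₀ (by positivity) S.hdt _
    calc c ≤ Real.exp ((J' + 1) * S.L0 * Real.log 2) * Real.exp (S.t1 * j) := by
          rw [hc, e1]; gcongr
      _ ≤ _ := by
          rw [← Real.exp_add, Real.exp_le_exp]
          push_cast at hB ⊢
          linarith
  choose A0 hA0 using fun l => S.Pl_int l J' x j
  have hA0' : ∀ l, c * (((hasseDeriv j (S.Pl l)).eval y : ℚ) : ℝ) = A0 l := by
    intro l
    have := congrArg (fun q : ℚ => (q : ℝ)) (hA0 l)
    rw [← hyx] at this
    push_cast at this
    rw [hc]; push_cast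
    exact this
  set A : (P → ℤ) → ℤ := fun l => A0 l * qm S.γ τ l with hA
  have hsq : ∀ l ∈ I, sqt S.Λ.pr (μ l) = Real.exp (theta S.Λ.pr l * y) *
      Real.exp (-(theta S.Λ.pr l0 * y)) := by
    intro l hl
    unfold sqt
    rw [← Real.exp_add]
    congr 1
    unfold theta
    simp only [hμy l hl]
    rw [sum_div, sum_mul, sum_mul, ← sub_eq_add_neg, ← sum_sub_distrib]
    refine sum_congr rfl fun p _ => by ring
  have hsum : ∑ l ∈ I, (A l : ℝ) * sqt S.Λ.pr (μ l) =
      c * S.X I j τ y * Real.exp (-(theta S.Λ.pr l0 * y)) := by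
    unfold X
    rw [mul_sum, sum_mul]
    refine sum_congr rfl fun l hl => ?_
    rw [hsq l hl, hA]
    push_cast
    rw [← hA0' l]; ring
  obtain ⟨e, he1, he2⟩ : ∃ e : P → ℤ, (∀ l ∈ I, ∀ p, 0 ≤ e p + μ l p) ∧
      (∀ p, ∃ l ∈ I, e p = - μ l p) := by
    have hne : I.Nonempty := ⟨l0, hl0⟩
    refine ⟨fun p => I.sup' hne fun l => - μ l p, fun l hl p => ?_, fun p => ?_⟩
    · have := Finset.le_sup' (fun l => - μ l p) hl
      simp only at this ⊢
      linarith
    · exact Finset.exists_mem_eq_sup' hne _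
  have hse : sqt S.Λ.pr e ≤ Real.exp (theta S.Λ.pr l0 * y + Y * (S.L * S.Λ.h)) := by
    unfold sqt
    rw [Real.exp_le_exp]
    have h1 : ∀ p, (e p : ℝ) / 2 ≤ l0 p * y + Y * (S.L * ∑ i, |(S.Λ.v i p : ℝ)|) := by
      intro p
      obtain ⟨l, hl, h⟩ := he2 p
      have h2 := S.abs_coord_le (hI hl) p
      have h3 : |(y : ℝ) * l p| ≤ Y * (S.L * ∑ i, |(S.Λ.v i p : ℝ)|) := by
        rw [abs_mul]; exact mul_le_mul hy h2 (abs_nonneg _) hY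
      have h4 := (abs_le.mp h3).1
      rw [h]; push_cast
      rw [hμy l hl p]
      linarith
    unfold theta Lat.h
    rw [sum_comm, sum_div, sum_mul, mul_sum, mul_sum, ← sum_add_distrib]
    refine sum_le_sum fun p _ => ?_
    have h5 := mul_le_mul_of_nonneg_right (h1 p) (S.Λ.lg_pos' p).le
    rw [← sum_mul]
    nlinarith [h5]
  set Hs := Real.exp (B1 + bY + S.L * S.Λ.w * Y) with hHs
  have hH : ∑ l ∈ I, |(A l : ℝ)| * sqt S.Λ.pr (μ l) ≤ Hs * Real.exp (-(theta S.Λ.pr l0 * y)) := by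
    have h1 : ∀ l ∈ I, |(A l : ℝ)| * sqt S.Λ.pr (μ l) ≤
        Real.exp B1 * S.bd Y * Real.exp (S.L * S.Λ.w * Y) * Real.exp (-(theta S.Λ.pr l0 * y)) := by
      intro l hl
      have hp : |(((hasseDeriv j (S.Pl l)).eval y : ℚ) : ℝ)| ≤ S.bd Y := by
        have := S.Pl_le (hI hl) j ((y : ℝ) : ℂ) Y (by rwa [Complex.norm_real, Real.norm_eq_abs])
        rwa [aeval_rat, Complex.norm_real, Real.norm_eq_abs] at this
      rw [hsq l hl, hA]
      push_cast
      rw [← hA0' l, abs_mul, abs_mul, abs_of_pos hc0, ← mul_assoc]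
      refine mul_le_mul_of_nonneg_right ?_ (Real.exp_pos _).le
      have e3 : c * |(qm S.γ τ l : ℝ)| ≤ Real.exp B1 := by
        calc _ ≤ Real.exp (B1 - S.t1 * (∑ i, τ i : ℕ)) * Real.exp (S.t1 * (∑ i, τ i : ℕ)) :=
              mul_le_mul hcB (S.qm_le (hI hl) τ) (abs_nonneg _) (Real.exp_pos _).le
          _ = _ := by rw [← Real.exp_add]; congr 1; ring
      have e4 : Real.exp (theta S.Λ.pr l * y) ≤ Real.exp (S.L * S.Λ.w * Y) := by
        rw [Real.exp_le_exp]
        refine (le_abs_self _).trans ?_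
        rw [abs_mul]
        exact mul_le_mul (S.Λ.theta_le (hI hl)) hy (abs_nonneg _)
          (mul_nonneg S.hL.le S.Λ.w_nonneg)
      refine mul_le_mul ?_ e4 (Real.exp_pos _).le (mul_nonneg (Real.exp_pos _).le (S.bd_nonneg Y hY))
      calc _ = (c * |(qm S.γ τ l : ℝ)|) * |(((hasseDeriv j (S.Pl l)).eval y : ℚ) : ℝ)| := by ring
        _ ≤ _ := mul_le_mul e3 hp (abs_nonneg _) (Real.exp_pos _).le
    refine (sum_le_card_nsmul _ _ _ h1).trans ?_
    rw [nsmul_eq_mul, hHs, Real.exp_add, Real.exp_add]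
    calc _ = (#I * S.bd Y) * (Real.exp B1 * Real.exp (S.L * S.Λ.w * Y) *
          Real.exp (-(theta S.Λ.pr l0 * y))) := by ring
      _ ≤ Real.exp bY * (Real.exp B1 * Real.exp (S.L * S.Λ.w * Y) *
          Real.exp (-(theta S.Λ.pr l0 * y))) := mul_le_mul_of_nonneg_right hbY (by positivity)
      _ = _ := by ring
  have key := liouville S.Λ.hp 𝓛 D rep hrep I A μ hμ e he1 (by
    rw [hsum]
    exact mul_ne_zero (mul_ne_zero hc0.ne' hX) (Real.exp_pos _).ne') _ hH
  rw [hsum] at key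
  refine key.trans ?_
  have e5 : |c * S.X I j τ y * Real.exp (-(theta S.Λ.pr l0 * y))| =
      c * |S.X I j τ y| * Real.exp (-(theta S.Λ.pr l0 * y)) := by
    rw [abs_mul, abs_mul, abs_of_pos hc0, Real.abs_exp]
  rw [e5]
  have e6 : sqt S.Λ.pr e ^ D ≤ Real.exp (D * (theta S.Λ.pr l0 * y + Y * (S.L * S.Λ.h))) := by
    rw [Real.exp_nat_mul]
    exact pow_le_pow_left₀ (sqt_pos _).le hse _
  have e7 : (Hs * Real.exp (-(theta S.Λ.pr l0 * y))) ^ (D - 1) =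
      Real.exp ((D - 1) * (B1 + bY + S.L * S.Λ.w * Y - theta S.Λ.pr l0 * y)) := by
    rw [hHs, ← Real.exp_add, ← Real.exp_nat_mul, Nat.cast_sub hD]
    congr 1; push_cast; ring
  rw [e7]
  calc _ ≤ Real.exp (B1 - S.t1 * (∑ i, τ i : ℕ)) * |S.X I j τ y| * Real.exp (-(theta S.Λ.pr l0 * y)) *
        Real.exp ((D - 1) * (B1 + bY + S.L * S.Λ.w * Y - theta S.Λ.pr l0 * y)) *
        Real.exp (D * (theta S.Λ.pr l0 * y + Y * (S.L * S.Λ.h))) := by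
        have := (sqt_pos (pr := S.Λ.pr) e).le
        gcongr
    _ = _ := by
        rw [mul_assoc, mul_assoc, ← Real.exp_add, ← Real.exp_add]
        congr 2; ring

set_option maxHeartbeats 1000000 in
/-- The generic extrapolation step. -/
lemma step (I : Finset (P → ℤ)) (hI : I ⊆ S.Λ.box S.L) (l0 : P → ℤ) (hl0 : l0 ∈ I)
    (J Sn Mn M' : ℕ) (hMn : 1 ≤ Mn) (hM : Mn ≤ 2 * M' + 1) (T' Tn : ℝ) (hT : T' ≤ Tn) (hV : S.VV J Sn T' I)
    (J' : ℕ) (x : ℤ) (y : ℚ) (hyx : y = (x : ℚ) / 2 ^ J') (Y : ℝ) (hy : |(y : ℝ)| ≤ Y)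
    (𝓛 : AddSubgroup (P → ℤ)) (D : ℕ) (hD : 1 ≤ D) (rep : Fin D → P → ℤ)
    (hrep : ∀ μ ∈ 𝓛, ∃ i, ∃ ν, μ = rep i + 2 • ν) (μ : (P → ℤ) → P → ℤ)
    (hμ : ∀ l ∈ I, μ l ∈ 𝓛) (hμy : ∀ l ∈ I, ∀ p, (μ l p : ℝ) = 2 * y * (l p - l0 p))
    (j : ℕ) (τ : Fin k → ℕ) (hjτ : ((j + ∑ i, τ i : ℕ) : ℝ) + Mn < T' + 1)
    (R Q g B1 bY bR q V : ℝ) (hR : 2 * Sn < R) (hYR : Y ≤ R) (hyQ : Y ^ 2 ≤ Q)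
    (hQ : (2 * Sn) ^ 2 ≤ Q)
    (hg : Q ≤ Real.exp (-2 * g) * (R ^ 2 - (2 * Sn) ^ 2))
    (hB : (J' + 1) * S.L0 * Real.log 2 + S.t1 * Tn ≤ B1)
    (hbY : #I * S.bd Y ≤ Real.exp bY) (hbR : #I * S.bd R ≤ Real.exp bR)
    (hq : m * S.L * S.Λ.s ≤ q)
    (hκ1 : S.κ0 * |S.lam| * R * 2 ^ (M' + 2) * Real.exp (Real.pi * M' * (2 ^ J * R)) ≤ 1)
    (hκ2 : S.κ0 * |S.lam| * R * 2 ^ (M' + 2) ≤ Real.exp (-V))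
    (hV2 : D * (B1 + bY + 2 * q * Y) + 1 ≤ V)
    (hC1 : B1 + bR + q * (R + Y) + 3 + (D - 1) * (B1 + bY + 2 * q * Y) ≤
      g * (Mn * (2 ^ (J + 1) * Sn))) :
    S.X I j τ y = 0 := by
  by_contra hX
  have hY : 0 ≤ Y := (abs_nonneg _).trans hy
  have hR0 : 0 ≤ R := hY.trans hYR
  have hκ0 : 0 ≤ S.κ0 := (abs_nonneg _).trans (S.hκ l0 (hI hl0))
  have hlio := S.X_liouville I hI l0 hl0 J' x y hyx Y hy 𝓛 D hD rep hrep μ hμ hμy j τ B1 bY (by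
    refine le_trans ?_ hB
    have h1 : ((j + ∑ i, τ i : ℕ) : ℝ) ≤ Tn := by
      have : (1 : ℝ) ≤ Mn := by exact_mod_cast hMn
      linarith
    have := mul_le_mul_of_nonneg_left h1 S.ht1
    linarith) hbY hX
  obtain ⟨ψ, hψ, hψ1, hψ2, hψ3, hψ4⟩ := exists_psiJ M' J
  have hkl : 0 ≤ S.κ0 * |S.lam| := by positivity
  have h2M : (1 : ℝ) ≤ 2 ^ M' := one_le_pow₀ (by norm_num)
  have hexp1 : 1 ≤ Real.exp (Real.pi * M' * (2 ^ J * R)) := by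
    rw [Real.one_le_exp_iff]; have := Real.pi_pos; positivity
  -- smallness facts
  have s0 : S.κ0 * |S.lam| * R * (2 ^ M' * 4) * 1 ≤ 1 := by
    refine le_trans ?_ hκ1
    rw [pow_add]
    have : (2 : ℝ) ^ 2 = 4 := by norm_num
    rw [this]
    gcongr
  have s1 : S.κ0 * |S.lam| * R ≤ 1 := by
    have : 0 ≤ S.κ0 * |S.lam| * R := by positivity
    nlinarith
  have s2 : ∀ z : ℂ, ‖z‖ = R → S.κ0 * |S.lam| * ‖ψ z‖ ≤ 1 := by
    intro z hz
    have h1 := hψ3 z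
    rw [hz] at h1
    refine le_trans (mul_le_mul_of_nonneg_left h1 hkl) (le_trans ?_ hκ1)
    rw [pow_add]
    have : 0 ≤ S.κ0 * |S.lam| * R * (2 ^ M' * Real.exp (Real.pi * M' * (2 ^ J * R))) := by positivity
    linarith
  have hF := S.F_schwarz I hI J Sn Mn M' hM T' hV hψ hψ1 hψ2 j τ hjτ R Q g y _ hR (hy.trans hYR)
    (by rw [← sq_abs]; exact (pow_le_pow_left₀ (abs_nonneg _) hy 2).trans hyQ) hQ hg
    (fun z hz => S.F_bound I hI j τ z R hz s1 (s2 z hz))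
  set δ := S.κ0 * |S.lam| * (R * (2 ^ M' * 2)) with hδdef
  have hδ : S.κ0 * |S.lam| * ‖ψ ((y : ℝ) : ℂ) - ((y : ℝ) : ℂ)‖ ≤ δ := by
    refine mul_le_mul_of_nonneg_left ?_ hkl
    refine (norm_sub_le _ _).trans ?_
    have h1 := hψ4 y
    rw [Complex.norm_real, Real.norm_eq_abs]
    have h2 : |(y : ℝ)| ≤ R := hy.trans hYR
    have h3 : |(y : ℝ)| * 2 ^ M' ≤ R * 2 ^ M' := mul_le_mul_of_nonneg_right h2 (by positivity)
    have h4 : R * 1 ≤ R * 2 ^ M' := mul_le_mul_of_nonneg_left h2M hR0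
    linarith
  have hδ1 : δ ≤ 1 := by
    have : 0 ≤ S.κ0 * |S.lam| * (R * (2 ^ M' * 2)) := by positivity
    rw [hδdef]
    linarith
  have hδ2 : 2 * δ ≤ Real.exp (-V) := by
    refine le_trans (le_of_eq ?_) hκ2
    rw [hδdef, pow_add]; ring
  have hsub := S.F_sub_X I hI j τ y Y δ hy hδ hδ1
  set Tτ : ℝ := S.t1 * (∑ i, τ i : ℕ) with hTτ
  have hXle : |S.X I j τ y| ≤ Real.exp bR * Real.exp Tτ * Real.exp (S.L * S.Λ.w * R + 2) *
      Real.exp (-(g * (Mn * (2 ^ (J + 1) * Sn)))) +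
      Real.exp bY * Real.exp Tτ * Real.exp (S.L * S.Λ.w * Y) * Real.exp (-V) := by
    have h1 : |S.X I j τ y| = ‖(S.X I j τ y : ℂ)‖ := by rw [Complex.norm_real, Real.norm_eq_abs]
    have h2 : (S.X I j τ y : ℂ) = S.F ψ I j τ ((y : ℝ) : ℂ) -
      (S.F ψ I j τ ((y : ℝ) : ℂ) - (S.X I j τ y : ℂ)) := by ring
    rw [h1, h2]
    refine (norm_sub_le _ _).trans (add_le_add (hF.trans ?_) (hsub.trans ?_))
    · gcongr
    · have := (Real.exp_pos bY).le
      gcongr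
  -- exponents
  have hw := S.Λ.w_le
  have hwh := S.Λ.wh_le
  have hw0 := S.Λ.w_nonneg
  have hh0 := S.Λ.h_nonneg
  have hL := S.hL
  have q1 : S.L * S.Λ.w ≤ q := by
    refine le_trans ?_ hq
    nlinarith
  have q2 : S.L * S.Λ.w + S.L * S.Λ.h ≤ 2 * q := by
    refine le_trans ?_ (mul_le_mul_of_nonneg_left hq (by norm_num))
    nlinarith
  set W := S.L * S.Λ.w with hW
  set Hh := S.L * S.Λ.h with hHh
  have hD1 : (0 : ℝ) ≤ (D : ℝ) - 1 := by
    have : (1 : ℝ) ≤ D := by exact_mod_cast hD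
    linarith
  have q3 : (W + Hh) * Y ≤ 2 * q * Y := mul_le_mul_of_nonneg_right q2 hY
  have q4 : ((D : ℝ) - 1) * ((W + Hh) * Y) ≤ (D - 1) * (2 * q * Y) := mul_le_mul_of_nonneg_left q3 hD1
  have q5 : W * (R - Y) ≤ q * (R - Y) := mul_le_mul_of_nonneg_right q1 (by linarith)
  set Eg := g * (Mn * (2 ^ (J + 1) * Sn)) with hEg
  have f1 : Real.exp (B1 - Tτ) * (Real.exp bR * Real.exp Tτ * Real.exp (W * R + 2) * Real.exp (-Eg)) *
      Real.exp ((D - 1) * (B1 + bY + W * Y) + D * (Y * Hh)) ≤ Real.exp (-1) := by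
    simp only [← Real.exp_add]
    rw [Real.exp_le_exp]
    linarith
  have f2 : Real.exp (B1 - Tτ) * (Real.exp bY * Real.exp Tτ * Real.exp (W * Y) * Real.exp (-V)) *
      Real.exp ((D - 1) * (B1 + bY + W * Y) + D * (Y * Hh)) ≤ Real.exp (-1) := by
    simp only [← Real.exp_add]
    rw [Real.exp_le_exp]
    linarith
  have f3 : Real.exp (-1) < 1 / 2 := by
    rw [Real.exp_neg, inv_lt_comm₀ (Real.exp_pos _) (by norm_num)]
    have := Real.exp_one_gt_d9
    norm_num; linarith
  have f4 : Real.exp (B1 - Tτ) * |S.X I j τ y| *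
      Real.exp ((D - 1) * (B1 + bY + W * Y) + D * (Y * Hh)) ≤ Real.exp (-1) + Real.exp (-1) := by
    refine le_trans ?_ (add_le_add f1 f2)
    rw [← add_mul, ← mul_add]
    gcongr
  linarith
end Setup
end BW


namespace BW
open Finset Polynomial
namespace Setup
variable {P : Type} [Fintype P] {m k : ℕ} (S : Setup P m k)

lemma smul_pow_cancel {J : ℕ} {a b : P → ℤ} (h : (2 ^ J : ℤ) • a = (2 ^ J : ℤ) • b) : a = b := by
  funext p
  have := congrFun h p
  simp only [Pi.smul_apply, smul_eq_mul] at this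
  exact mul_left_cancel₀ (by positivity) this

open Classical in
lemma split (I : Finset (P → ℤ)) (J Sn : ℕ) (T' : ℝ) (hV : S.VV (J + 1) Sn T' I) (l1 : P → ℤ)
    (hdiff : ∀ l ∈ I, ∃ ν : P → ℤ, l - l1 = (2 ^ J : ℤ) • ν) (hl1 : l1 ∈ I) :
    S.VV (J + 1) Sn T' (I.filter fun l => ∃ ν : P → ℤ, l - l1 = (2 ^ (J + 1) : ℤ) • ν) := by
  intro x hx hxl j τ hjτ
  have h0 := hV x hx hxl j τ hjτ
  choose! ν hν using hdiff
  set y : ℚ := (x : ℚ) / 2 ^ (J + 1) with hy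
  set μ : (P → ℤ) → P → ℤ := fun l => x • ν l with hμ
  have hν1 : ν l1 = 0 := by
    apply smul_pow_cancel (J := J)
    rw [← hν l1 hl1]; simp
  have hsq : ∀ l ∈ I, Real.exp (theta S.Λ.pr l * y) =
      sqt S.Λ.pr (μ l) * Real.exp (theta S.Λ.pr l1 * y) := by
    intro l hl
    unfold sqt
    rw [← Real.exp_add]
    congr 1
    have h1 : theta S.Λ.pr l - theta S.Λ.pr l1 = 2 ^ J * theta S.Λ.pr (ν l) := by
      rw [← theta_sub, hν l hl, theta_smul]; push_cast; rfl
    have h2 : theta S.Λ.pr l = theta S.Λ.pr l1 + 2 ^ J * theta S.Λ.pr (ν l) := by linarith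
    rw [h2, hμ, theta_smul, hy]
    push_cast
    rw [pow_succ]
    field_simp
    ring
  set A : (P → ℤ) → ℚ := fun l => (hasseDeriv j (S.Pl l)).eval y * (qm S.γ τ l : ℚ) with hA
  have hX : ∀ I' ⊆ I, S.X I' j τ y = (∑ l ∈ I', (A l : ℝ) * sqt S.Λ.pr (μ l)) *
      Real.exp (theta S.Λ.pr l1 * y) := by
    intro I' hI'
    unfold X
    rw [sum_mul]
    refine sum_congr rfl fun l hl => ?_
    rw [hsq l (hI' hl), hA]; push_cast; ring
  rw [hX I (Subset.refl _)] at h0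
  have h1 := (mul_eq_zero.mp h0).resolve_right (Real.exp_pos _).ne'
  have h2 := sqrt_indep S.Λ.hp S.Λ.hinj I A μ h1 l1
  rw [hX _ (filter_subset _ _)]
  have h3 : (I.filter fun l => ∃ ν : P → ℤ, l - l1 = (2 ^ (J + 1) : ℤ) • ν) =
      I.filter fun l => ∃ ν, μ l - μ l1 = 2 • ν := by
    refine filter_congr fun l hl => ?_
    have h4 : μ l1 = 0 := by simp only [hμ]; rw [hν1, smul_zero]
    rw [h4, sub_zero]
    obtain ⟨r, hr⟩ := hx
    constructor
    · rintro ⟨n, hn⟩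
      refine ⟨x • n, ?_⟩
      rw [hν l hl, pow_succ, mul_smul] at hn
      have h5 := smul_pow_cancel hn
      simp only [hμ]
      rw [h5]
      funext p
      simp only [Pi.smul_apply, smul_eq_mul, nsmul_eq_mul]
      push_cast; ring
    · rintro ⟨n, hn⟩
      refine ⟨n - r • ν l, ?_⟩
      rw [hν l hl, pow_succ, mul_smul]
      congr 1
      funext p
      have h5 := congrFun hn p
      simp only [hμ, hr, Pi.smul_apply, smul_eq_mul, nsmul_eq_mul, Pi.sub_apply] at h5 ⊢
      push_cast at h5
      linarith
  rw [h3, h2, zero_mul]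

/-- numerical parameters of the descent -/
structure Par (S : Setup P m k) where
  S0 : ℕ
  kk : ℕ
  J1 : ℕ
  T : ℝ
  E : ℝ
  E' : ℝ
  g : ℝ
  g' : ℝ
  x : ℝ
  e : ℝ
  zB : ℝ
  w0 : ℝ
  z : ℝ
  α : ℝ
  β : ℝ
  η : ℝ
  μh : ℝ
  ηh : ℝ
  ϕ : ℝ
  Um : ℝ
  Usm : ℝ
  U : ℝ
  hS0 : 1 ≤ S0
  hkk : kk + 2 = m
  hT : 0 ≤ T
  hE : 1 ≤ E
  hEE : E ≤ E'
  hE' : 1 < E'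
  hg0 : 0 < g
  hg0' : 0 < g'
  hg : Real.exp (2 * g) ≤ E ^ 2 - 1 / 4
  hg' : Real.exp (2 * g') ≤ E' ^ 2 - 1
  hx0 : 0 ≤ x
  hq : m * S.L * S.Λ.s ≤ x * T
  he : S.L0 * Real.log 2 ≤ e * (S0 * T)
  hzB : S.L0 * Real.log 2 + S.t1 * T ≤ zB * (S0 * T)
  hw : #(S.Λ.box S.L) * S.bd (2 * E' * 2 ^ kk * S0) ≤ Real.exp (w0 * (S0 * T))
  hz : (zB + e + w0) * (S0 * T) + 3 ≤ z * (S0 * T)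
  hz0 : 0 ≤ z
  he0 : 0 ≤ e
  hα : z ≤ 2 * g * α
  hη : e ≤ 2 * g * η
  hβ : 4 * (E + 1) * x ≤ 2 * g * β
  hμh : 4 * z + (16 + 2 * E') * x ≤ 2 * g' * μh
  hηh : 4 * e ≤ 2 * g' * ηh
  hϕ : 0 ≤ ϕ
  hsum : ϕ + 2 * (((2 - 2 / 2 ^ kk) * α + kk * β + μh) + ((2 - 2 / 2 ^ kk) * η + ηh)) ≤ 1
  hU1 : 4 * E * Real.pi * (α + η * J1 + 2 ^ kk * β) ≤ Um
  hU2 : 2 * E' * 2 ^ kk * Real.pi * (μh + ηh * J1) ≤ Um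
  hV : 2 ^ m * (z + e * J1 + 4 * x) * (S0 * T) + 1 ≤ U - Usm
  hUsm : Real.log (4 * (2 * E' * 2 ^ kk * S0)) + T * Real.log 2 ≤ Usm
  hU : Um * (S0 * T) + Usm ≤ U
  hlam : S.κ0 * |S.lam| ≤ Real.exp (-U)

namespace Par
variable {S} (A : Par S)

lemma α_nonneg : 0 ≤ A.α := by
  have h1 := A.hα; have h2 := A.hg0; have h3 := A.hz0
  by_contra h; push Not at h; nlinarith
lemma β_nonneg : 0 ≤ A.β := by
  have h1 := A.hβ; have h2 := A.hg0; have h3 := A.hx0; have h4 := A.hE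
  have h5 : 0 ≤ 4 * (A.E + 1) * A.x := by positivity
  by_contra h; push Not at h; nlinarith
lemma η_nonneg : 0 ≤ A.η := by
  have h1 := A.hη; have h2 := A.hg0; have h3 := A.he0
  by_contra h; push Not at h; nlinarith
lemma μh_nonneg : 0 ≤ A.μh := by
  have h1 := A.hμh; have h2 := A.hg0'; have h3 := A.hz0; have h4 := A.hx0; have h5 := A.hE'
  have h6 : 0 ≤ 4 * A.z + (16 + 2 * A.E') * A.x := by positivity
  by_contra h; push Not at h; nlinarith
lemma ηh_nonneg : 0 ≤ A.ηh := by
  have h1 := A.hηh; have h2 := A.hg0'; have h3 := A.he0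
  by_contra h; push Not at h; nlinarith
lemma G_nonneg : 0 ≤ A.S0 * A.T := mul_nonneg (Nat.cast_nonneg _) A.hT

lemma bd_mono (S : Setup P m k) {a b : ℝ} (ha : 0 ≤ a) (h : a ≤ b) : S.bd a ≤ S.bd b := by
  unfold bd; gcongr

lemma card_bd (I : Finset (P → ℤ)) (hI : I ⊆ S.Λ.box S.L) (R : ℝ) (hR0 : 0 ≤ R)
    (hR : R ≤ 2 * A.E' * 2 ^ A.kk * A.S0) : #I * S.bd R ≤ Real.exp (A.w0 * (A.S0 * A.T)) := by
  refine le_trans ?_ A.hw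
  have h1 : (#I : ℝ) ≤ #(S.Λ.box S.L) := by exact_mod_cast card_le_card hI
  exact mul_le_mul h1 (bd_mono S hR0 hR) (S.bd_nonneg R hR0) (by positivity)

/-- the `κ` conditions of the step lemma -/
lemma kap (M' J : ℕ) (R V : ℝ) (hR0 : 0 < R) (hR : R ≤ 2 * A.E' * 2 ^ A.kk * A.S0) (hM : (M' : ℝ) ≤ A.T)
    (h1 : Real.pi * M' * (2 ^ J * R) ≤ A.Um * (A.S0 * A.T)) (hV : V ≤ A.U - A.Usm) :
    S.κ0 * |S.lam| * R * 2 ^ (M' + 2) * Real.exp (Real.pi * M' * (2 ^ J * R)) ≤ 1 ∧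
    S.κ0 * |S.lam| * R * 2 ^ (M' + 2) ≤ Real.exp (-V) := by
  have h2 : R * 2 ^ (M' + 2) ≤ Real.exp A.Usm := by
    refine le_trans ?_ (Real.exp_le_exp.mpr A.hUsm)
    rw [Real.exp_add, Real.exp_log (by linarith)]
    have e1 : (2 : ℝ) ^ M' ≤ Real.exp (A.T * Real.log 2) := by
      have : (2 : ℝ) ^ M' = Real.exp (M' * Real.log 2) := by
        rw [Real.exp_nat_mul, Real.exp_log (by norm_num)]
      rw [this, Real.exp_le_exp]
      exact mul_le_mul_of_nonneg_right hM (Real.log_pos (by norm_num)).le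
    calc R * 2 ^ (M' + 2) = (4 * R) * 2 ^ M' := by rw [pow_add]; ring
      _ ≤ _ := mul_le_mul (by linarith) e1 (by positivity) (by linarith)
  have h3 : S.κ0 * |S.lam| * R * 2 ^ (M' + 2) ≤ Real.exp (-A.U + A.Usm) := by
    rw [Real.exp_add, mul_assoc]
    exact mul_le_mul A.hlam h2 (by positivity) (Real.exp_pos _).le
  constructor
  · calc _ ≤ Real.exp (-A.U + A.Usm) * Real.exp (A.Um * (A.S0 * A.T)) := by gcongr
      _ = Real.exp (-A.U + A.Usm + A.Um * (A.S0 * A.T)) := (Real.exp_add _ _).symm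
      _ ≤ 1 := by rw [Real.exp_le_one_iff]; linarith [A.hU]
  · refine h3.trans (Real.exp_le_exp.mpr (by linarith))

lemma Bb (J' : ℕ) (c : ℝ) (hc : (J' : ℝ) ≤ c) : (J' + 1) * S.L0 * Real.log 2 + S.t1 * A.T ≤ (A.zB + A.e * c) * (A.S0 * A.T) := by
  have h1 := mul_le_mul_of_nonneg_left A.he (Nat.cast_nonneg (α := ℝ) J')
  have h2 := A.hzB
  have h3 : A.e * J' * (A.S0 * A.T) ≤ A.e * c * (A.S0 * A.T) :=
    mul_le_mul_of_nonneg_right (mul_le_mul_of_nonneg_left hc A.he0) A.G_nonneg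
  linarith

lemma floor_facts (Δ : ℝ) (hΔ : 0 ≤ Δ) : ∃ Mn M' : ℕ, 1 ≤ Mn ∧ Mn ≤ 2 * M' + 1 ∧ (Mn : ℝ) ≤ Δ + 1 ∧
    Δ ≤ Mn ∧ (M' : ℝ) ≤ Δ := by
  refine ⟨⌊Δ⌋₊ + 1, (⌊Δ⌋₊ + 1) / 2, by omega, by omega, ?_, ?_, ?_⟩
  · push_cast; linarith [Nat.floor_le hΔ]
  · push_cast; exact (Nat.lt_floor_add_one Δ).le
  · have h1 : (⌊Δ⌋₊ + 1) / 2 ≤ ⌊Δ⌋₊ := by omega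
    exact le_trans (by exact_mod_cast h1) (Nat.floor_le hΔ)

lemma two_pow_m : (2 : ℝ) ^ m = 4 * 2 ^ A.kk := by
  calc (2 : ℝ) ^ m = 2 ^ (A.kk + 2) := congrArg (fun n : ℕ => (2 : ℝ) ^ n) A.hkk.symm
    _ = _ := by rw [pow_add]; ring

set_option maxHeartbeats 1000000 in
/-- integer step -/
lemma int_step (I : Finset (P → ℤ)) (hI : I ⊆ S.Λ.box S.L) (l0 : P → ℤ) (hl0 : l0 ∈ I) (J : ℕ)
    (hJ : J < A.J1) (hdiff : ∀ l ∈ I, ∃ ν : P → ℤ, l - l0 = (2 ^ J : ℤ) • ν) (i : ℕ) (hi : i < A.kk)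
    (T' Δ : ℝ) (hT' : T' ≤ A.T) (hV : S.VV J (2 ^ i * A.S0) T' I)
    (hΔ : 2 ^ J * Δ = ((A.α + A.η * J) / 2 ^ i + A.β) * A.T) (hΔT : Δ ≤ A.T) :
    S.VV J (2 ^ (i + 1) * A.S0) (T' - Δ) I := by
  intro l hl hlS j τ hjτ
  have hα := A.α_nonneg
  have hβ := A.β_nonneg
  have hη := A.η_nonneg
  have hT := A.hT
  have hG := A.G_nonneg
  have h2i : (0 : ℝ) < 2 ^ i := by positivity
  have h2J : (0 : ℝ) < 2 ^ J := by positivity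
  have hΔ0 : 0 ≤ Δ := by
    have : 0 ≤ 2 ^ J * Δ := by rw [hΔ]; positivity
    exact nonneg_of_mul_nonneg_right this h2J
  obtain ⟨Mn, M', hMn, hM, hMn1, hMn2, hM'⟩ := floor_facts Δ hΔ0
  have hS0 : (1 : ℝ) ≤ A.S0 := by exact_mod_cast A.hS0
  have hE := A.hE
  have hEE := A.hEE
  have hik : (2 : ℝ) ^ (i + 1) ≤ 2 ^ A.kk := pow_le_pow_right₀ (by norm_num) hi
  rw [pow_succ] at hik
  have hJ' : (J : ℝ) ≤ A.J1 := by exact_mod_cast hJ.le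
  set s : ℝ := 2 ^ i * A.S0 with hs
  have hs0 : 0 < s := by positivity
  have hsk : 2 * s ≤ 2 ^ A.kk * A.S0 := by rw [hs]; nlinarith
  have hRle : 4 * A.E * s ≤ 2 * A.E' * 2 ^ A.kk * A.S0 := by
    have h1 : A.E * (2 * s) ≤ A.E' * (2 ^ A.kk * A.S0) := by
      apply mul_le_mul hEE hsk (by positivity) (by linarith)
    linarith
  choose! ν hν using hdiff
  have hπ := Real.pi_pos
  have hΔs : 2 ^ J * Δ * s = (A.α + A.η * J + 2 ^ i * A.β) * (A.S0 * A.T) := by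
    rw [hΔ, hs]; field_simp
  have hk := A.kap M' J (4 * A.E * s) (2 ^ m * (A.z + A.e * A.J1 + 4 * A.x) * (A.S0 * A.T) + 1)
    (by positivity) hRle (hM'.trans hΔT) (by
      calc Real.pi * M' * (2 ^ J * (4 * A.E * s)) ≤ Real.pi * Δ * (2 ^ J * (4 * A.E * s)) := by gcongr
        _ = 4 * A.E * Real.pi * (2 ^ J * Δ * s) := by ring
        _ = 4 * A.E * Real.pi * (A.α + A.η * J + 2 ^ i * A.β) * (A.S0 * A.T) := by rw [hΔs]; ring
        _ ≤ 4 * A.E * Real.pi * (A.α + A.η * A.J1 + 2 ^ A.kk * A.β) * (A.S0 * A.T) := by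
            have : (2 : ℝ) ^ i ≤ 2 ^ A.kk := pow_le_pow_right₀ (by norm_num) hi.le
            gcongr
        _ ≤ _ := mul_le_mul_of_nonneg_right A.hU1 hG) A.hV
  refine S.step I hI l0 hl0 J (2 ^ i * A.S0) Mn M' hMn hM T' A.T hT' hV J l ((l : ℚ) / 2 ^ J) rfl (4 * s)
    ?_ (AddMonoidHom.range (zsmulAddGroupHom (α := P → ℤ) 2)) 1 le_rfl (fun _ => 0) ?_
    (fun r => (2 : ℤ) • (l • ν r)) ?_ ?_ j τ (by linarith) (4 * A.E * s) (16 * s ^ 2) A.g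
    ((A.zB + A.e * J) * (A.S0 * A.T)) (A.w0 * (A.S0 * A.T)) (A.w0 * (A.S0 * A.T)) (A.x * A.T) _
    ?_ ?_ ?_ ?_ ?_ (A.Bb J J le_rfl) ?_ ?_ A.hq hk.1 hk.2 ?_ ?_
  · have h1 : |(l : ℝ)| ≤ 2 ^ (J + 1) * (2 ^ (i + 1) * A.S0) := by exact_mod_cast hlS.le
    push_cast
    rw [abs_div, abs_of_pos h2J, div_le_iff₀ h2J]
    refine h1.trans (le_of_eq ?_)
    rw [hs]; ring
  · rintro μ ⟨n, rfl⟩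
    refine ⟨0, n, ?_⟩
    simp
  · intro r _
    exact ⟨l • ν r, by simp⟩
  · intro r hr p
    have h1 := congrFun (hν r hr) p
    simp only [Pi.sub_apply, Pi.smul_apply, smul_eq_mul] at h1 ⊢
    have h2 : (r p : ℝ) - l0 p = 2 ^ J * ν r p := by exact_mod_cast h1
    rw [h2]
    push_cast
    field_simp
  · push_cast; rw [← hs]; nlinarith
  · nlinarith
  · exact le_of_eq (by ring)
  · push_cast; rw [← hs]; nlinarith
  · push_cast; rw [← hs]
    have h1 := A.hg
    have h2 : Real.exp (-2 * A.g) * Real.exp (2 * A.g) = 1 := by rw [← Real.exp_add]; simp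
    have h3 := mul_le_mul_of_nonneg_left h1 (Real.exp_pos (-2 * A.g)).le
    rw [h2] at h3
    have h4 := mul_le_mul_of_nonneg_right h3 (by positivity : 0 ≤ 16 * s ^ 2)
    linarith
  · refine A.card_bd I hI _ (by positivity) (le_trans ?_ hRle)
    nlinarith
  · exact A.card_bd I hI _ (by positivity) hRle
  · have hz := A.hz
    have he := A.he0
    have hx := A.hx0
    have hz0 := A.hz0
    have hD := A.two_pow_m
    have hk1 : (1 : ℝ) ≤ 2 ^ A.kk := one_le_pow₀ (by norm_num)
    set G := (A.S0 : ℝ) * A.T with hGdef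
    have e1 : A.e * J * G ≤ A.e * A.J1 * G := by gcongr
    have e2 : A.x * A.T * s * 2 ≤ A.x * (2 ^ A.kk * G) := by
      have := mul_le_mul_of_nonneg_left hsk (mul_nonneg hx hT)
      rw [hGdef]; linarith
    have e3 : (1 : ℝ) ≤ 4 * 2 ^ A.kk := by linarith
    have e4 : 0 ≤ (A.z + A.e * A.J1) * G := by positivity
    have e5 := mul_le_mul_of_nonneg_right e3 e4
    have e6 : 0 ≤ A.e * G := by positivity
    have e7 : 0 ≤ A.x * (2 ^ A.kk * G) := by positivity
    rw [hD]
    push_cast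
    linarith
  · have hz := A.hz
    have h1 : A.g * (Δ * (2 ^ (J + 1) * s)) ≤ A.g * (Mn * (2 ^ (J + 1) * s)) := by
      have := A.hg0.le
      gcongr
    have h2 : A.g * (Δ * (2 ^ (J + 1) * s)) = 2 * A.g * (2 ^ J * Δ * s) := by rw [pow_succ]; ring
    rw [hΔs] at h2
    have h3 := mul_le_mul_of_nonneg_right A.hα hG
    have h4 := mul_le_mul_of_nonneg_right A.hη (mul_nonneg (Nat.cast_nonneg (α := ℝ) J) hG)
    have h5 := mul_le_mul_of_nonneg_right A.hβ (mul_nonneg h2i.le hG)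
    have h6 : A.x * A.T * (4 * A.E * s + 4 * s) = 4 * (A.E + 1) * A.x * (2 ^ i * (A.S0 * A.T)) := by
      rw [hs]; ring
    have h7 : 0 ≤ A.e * (A.S0 * A.T) := mul_nonneg A.he0 hG
    push_cast
    rw [← hs]
    rw [h6]
    simp only [sub_self, zero_mul, add_zero]
    linarith
end Par
end Setup
end BW


namespace BW
open Finset Polynomial
namespace Setup
variable {P : Type} [Fintype P] {m k : ℕ} {S : Setup P m k}
namespace Par
variable (A : Par S)

lemma nu_mem (I : Finset (P → ℤ)) (hI : I ⊆ S.Λ.box S.L) (l0 : P → ℤ) (hl0 : l0 ∈ I) (J : ℕ)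
    {l : P → ℤ} (hl : l ∈ I) (ν : P → ℤ) (h : l - l0 = (2 ^ J : ℤ) • ν) : ν ∈ S.Λ.lat := by
  apply S.Λ.pure' (2 ^ J) (by positivity)
  have h1 : (2 ^ J : ℕ) • ν = (2 ^ J : ℤ) • ν := by
    rw [← natCast_zsmul]; push_cast; rfl
  rw [h1, ← h]
  exact sub_mem (S.Λ.mem_box.mp (hI hl)).1 (S.Λ.mem_box.mp (hI hl0)).1

set_option maxHeartbeats 1000000 in
/-- half-integer step -/
lemma half_step (I : Finset (P → ℤ)) (hI : I ⊆ S.Λ.box S.L) (l0 : P → ℤ) (hl0 : l0 ∈ I) (J : ℕ)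
    (hJ : J < A.J1) (hdiff : ∀ l ∈ I, ∃ ν : P → ℤ, l - l0 = (2 ^ J : ℤ) • ν)
    (T' Δ : ℝ) (hT' : T' ≤ A.T) (hV : S.VV J (2 ^ A.kk * A.S0) T' I)
    (hΔ : 2 ^ J * Δ = (A.μh + A.ηh * J) * A.T) (hΔT : Δ ≤ A.T) :
    S.VV (J + 1) A.S0 (T' - Δ) I := by
  intro l hl hlS j τ hjτ
  have hα := A.μh_nonneg
  have hη := A.ηh_nonneg
  have hT := A.hT
  have hG := A.G_nonneg
  have h2J : (0 : ℝ) < 2 ^ J := by positivity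
  have hΔ0 : 0 ≤ Δ := by
    have : 0 ≤ 2 ^ J * Δ := by rw [hΔ]; positivity
    exact nonneg_of_mul_nonneg_right this h2J
  obtain ⟨Mn, M', hMn, hM, hMn1, hMn2, hM'⟩ := floor_facts Δ hΔ0
  have hS0 : (1 : ℝ) ≤ A.S0 := by exact_mod_cast A.hS0
  have hE' := A.hE'
  have hk1 : (1 : ℝ) ≤ 2 ^ A.kk := one_le_pow₀ (by norm_num)
  have hJ' : (J : ℝ) ≤ A.J1 := by exact_mod_cast hJ.le
  set s : ℝ := 2 ^ A.kk * A.S0 with hs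
  have hs0 : 0 < s := by positivity
  have hS0s : A.S0 ≤ s := by rw [hs]; nlinarith
  have hRle : 2 * A.E' * s ≤ 2 * A.E' * 2 ^ A.kk * A.S0 := le_of_eq (by rw [hs]; ring)
  choose! ν hν using hdiff
  have hνm : ∀ r ∈ I, ν r ∈ S.Λ.lat := fun r hr => nu_mem I hI l0 hl0 J hr (ν r) (hν r hr)
  obtain ⟨rep, hrep⟩ := S.Λ.exists_reps
  have hπ := Real.pi_pos
  have hΔs : 2 ^ J * Δ * s = (A.μh + A.ηh * J) * (2 ^ A.kk * (A.S0 * A.T)) := by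
    rw [hΔ, hs]; ring
  have hk := A.kap M' J (2 * A.E' * s) (2 ^ m * (A.z + A.e * A.J1 + 4 * A.x) * (A.S0 * A.T) + 1)
    (by positivity) hRle (hM'.trans hΔT) (by
      calc Real.pi * M' * (2 ^ J * (2 * A.E' * s)) ≤ Real.pi * Δ * (2 ^ J * (2 * A.E' * s)) := by
            have : 0 ≤ A.E' := by linarith
            gcongr
        _ = 2 * A.E' * Real.pi * (2 ^ J * Δ * s) := by ring
        _ = 2 * A.E' * 2 ^ A.kk * Real.pi * (A.μh + A.ηh * J) * (A.S0 * A.T) := by rw [hΔs]; ring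
        _ ≤ 2 * A.E' * 2 ^ A.kk * Real.pi * (A.μh + A.ηh * A.J1) * (A.S0 * A.T) := by
            have : 0 ≤ A.E' := by linarith
            gcongr
        _ ≤ _ := mul_le_mul_of_nonneg_right A.hU2 hG) A.hV
  have hz := A.hz
  have he := A.he0
  have hx := A.hx0
  have hz0 := A.hz0
  have hD := A.two_pow_m
  refine S.step I hI l0 hl0 J (2 ^ A.kk * A.S0) Mn M' hMn hM T' A.T hT' hV (J + 1) l
    ((l : ℚ) / 2 ^ (J + 1)) rfl (2 * A.S0)
    ?_ S.Λ.lat (2 ^ m) Nat.one_le_two_pow rep hrep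
    (fun r => l • ν r) ?_ ?_ j τ (by linarith) (2 * A.E' * s) (4 * s ^ 2) A.g'
    ((A.zB + A.e * (J + 1)) * (A.S0 * A.T)) (A.w0 * (A.S0 * A.T)) (A.w0 * (A.S0 * A.T)) (A.x * A.T) _
    ?_ ?_ ?_ ?_ ?_ (A.Bb (J + 1) (J + 1) (by push_cast; exact le_rfl)) ?_ ?_ A.hq hk.1 hk.2 ?_ ?_
  · have h1 : |(l : ℝ)| ≤ 2 ^ (J + 1 + 1) * A.S0 := by exact_mod_cast hlS.le
    push_cast
    rw [abs_div, abs_of_pos (by positivity : (0:ℝ) < 2 ^ (J + 1)), div_le_iff₀ (by positivity)]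
    refine h1.trans (le_of_eq ?_)
    ring
  · intro r hr
    exact zsmul_mem (hνm r hr) l
  · intro r hr p
    have h1 := congrFun (hν r hr) p
    simp only [Pi.sub_apply, Pi.smul_apply, smul_eq_mul] at h1 ⊢
    have h2 : (r p : ℝ) - l0 p = 2 ^ J * ν r p := by exact_mod_cast h1
    rw [h2]
    push_cast
    rw [pow_succ]
    field_simp
  · push_cast; rw [← hs]; nlinarith
  · nlinarith
  · nlinarith
  · push_cast; rw [← hs]; exact le_of_eq (by ring)
  · push_cast; rw [← hs]
    have h1 := A.hg'
    have h2 : Real.exp (-2 * A.g') * Real.exp (2 * A.g') = 1 := by rw [← Real.exp_add]; simp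
    have h3 := mul_le_mul_of_nonneg_left h1 (Real.exp_pos (-2 * A.g')).le
    rw [h2] at h3
    have h4 := mul_le_mul_of_nonneg_right h3 (by positivity : 0 ≤ 4 * s ^ 2)
    linarith
  · refine A.card_bd I hI _ (by positivity) (le_trans ?_ hRle)
    nlinarith
  · exact A.card_bd I hI _ (by positivity) hRle
  · set G := (A.S0 : ℝ) * A.T with hGdef
    have e1 : A.e * J * G ≤ A.e * A.J1 * G := by gcongr
    have e2 : (A.zB + A.e * (J + 1)) * G + A.w0 * G + 2 * (A.x * A.T) * (2 * A.S0) ≤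
      (A.z + A.e * A.J1 + 4 * A.x) * G := by rw [hGdef] at *; linarith
    have e3 := mul_le_mul_of_nonneg_left e2 (by positivity : (0 : ℝ) ≤ 2 ^ m)
    push_cast
    linarith
  · set G := (A.S0 : ℝ) * A.T with hGdef
    have h1 : A.g' * (Δ * (2 ^ (J + 1) * s)) ≤ A.g' * (Mn * (2 ^ (J + 1) * s)) := by
      have := A.hg0'.le
      gcongr
    have h2 : A.g' * (Δ * (2 ^ (J + 1) * s)) = 2 * A.g' * (2 ^ J * Δ * s) := by rw [pow_succ]; ring
    rw [hΔs] at h2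
    have hkG : 0 ≤ 2 ^ A.kk * G := by positivity
    have h3 := mul_le_mul_of_nonneg_right A.hμh hkG
    have h4 := mul_le_mul_of_nonneg_right A.hηh (mul_nonneg (Nat.cast_nonneg (α := ℝ) J) hkG)
    have e2 : (A.zB + A.e * (J + 1)) * G + A.w0 * G + 2 * (A.x * A.T) * (2 * A.S0) + 3 ≤
      (A.z + A.e * J + 4 * A.x) * G := by rw [hGdef] at *; linarith
    have hD1 : (0 : ℝ) ≤ 2 ^ m - 1 := by rw [hD]; linarith
    have e3 := mul_le_mul_of_nonneg_left e2 hD1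
    have e4 : A.x * A.T * (2 * A.E' * s + 2 * A.S0) = 2 * A.E' * A.x * (2 ^ A.kk * G) + 2 * A.x * G := by
      rw [hs, hGdef]; ring
    have e5 : 0 ≤ A.x * G := by positivity
    push_cast
    rw [← hs, e4]
    have e6 : (2 : ℝ) ^ m * ((A.z + A.e * J + 4 * A.x) * G) =
      4 * A.z * (2 ^ A.kk * G) + 4 * A.e * (J * (2 ^ A.kk * G)) + 16 * A.x * (2 ^ A.kk * G) := by
      rw [hD]; ring
    have e7 : A.e * G * J = A.e * J * G := by ring
    linarith
end Par
end Setup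
end BW


namespace BW
open Finset Polynomial
namespace Setup
variable {P : Type} [Fintype P] {m k : ℕ} {S : Setup P m k}

lemma VV_mono {J Sn : ℕ} {T1 T2 : ℝ} {I : Finset (P → ℤ)} (h : T2 ≤ T1) (hV : S.VV J Sn T1 I) :
    S.VV J Sn T2 I := fun l hl hl2 j τ hjτ => hV l hl hl2 j τ (hjτ.trans_le h)

namespace Par
variable (A : Par S)

noncomputable def ca : ℝ := (2 - 2 / 2 ^ A.kk) * A.α + A.kk * A.β + A.μh
noncomputable def cb : ℝ := (2 - 2 / 2 ^ A.kk) * A.η + A.ηh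

lemma two_sub : 0 ≤ 2 - 2 / (2 : ℝ) ^ A.kk := by
  have hk1 : (1 : ℝ) ≤ 2 ^ A.kk := one_le_pow₀ (by norm_num)
  have : 2 / (2 : ℝ) ^ A.kk ≤ 2 := div_le_self (by norm_num) hk1
  linarith
lemma ca_nonneg : 0 ≤ A.ca := by
  have := A.two_sub; have := A.α_nonneg; have := A.β_nonneg; have := A.μh_nonneg
  unfold ca; positivity
lemma cb_nonneg : 0 ≤ A.cb := by
  have := A.two_sub; have := A.η_nonneg; have := A.ηh_nonneg
  unfold cb; positivity

lemma int_steps (I : Finset (P → ℤ)) (hI : I ⊆ S.Λ.box S.L) (l0 : P → ℤ) (hl0 : l0 ∈ I) (J : ℕ)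
    (hJ : J < A.J1) (hdiff : ∀ l ∈ I, ∃ ν : P → ℤ, l - l0 = (2 ^ J : ℤ) • ν)
    (T' : ℝ) (hT' : T' ≤ A.T) (hV : S.VV J A.S0 T' I) (i : ℕ) (hi : i ≤ A.kk) :
    S.VV J (2 ^ i * A.S0) (T' - A.T / 2 ^ J * ((2 - 2 / 2 ^ i) * (A.α + A.η * J) + i * A.β)) I := by
  have hα := A.α_nonneg
  have hβ := A.β_nonneg
  have hη := A.η_nonneg
  have hT := A.hT
  induction i with
  | zero => simpa using hV
  | succ i ih =>
    have h1 := ih (by omega)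
    have h2J : (0 : ℝ) < 2 ^ J := by positivity
    have hi1 : (1 : ℝ) ≤ 2 ^ i := one_le_pow₀ (by norm_num)
    have hX : 0 ≤ A.T / 2 ^ J * ((2 - 2 / 2 ^ i) * (A.α + A.η * J) + i * A.β) := by
      have : 0 ≤ 2 - 2 / (2 : ℝ) ^ i := by
        have : 2 / (2 : ℝ) ^ i ≤ 2 := div_le_self (by norm_num) hi1
        linarith
      positivity
    have h2 := A.int_step I hI l0 hl0 J hJ hdiff i (by omega) _
      (A.T / 2 ^ J * ((A.α + A.η * J) / 2 ^ i + A.β)) (by linarith) h1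
      (by field_simp) ?_
    · refine VV_mono (le_of_eq ?_) h2
      push_cast
      rw [pow_succ]
      field_simp
      ring
    · have hsum := A.hsum
      have hμ := A.μh_nonneg
      have hηh := A.ηh_nonneg
      have hϕ := A.hϕ
      have hkk : 1 ≤ A.kk := by omega
      have hk1 : (1 : ℝ) ≤ A.kk := by exact_mod_cast hkk
      have hk2 : (2 : ℝ) ≤ 2 ^ A.kk := by
        calc (2 : ℝ) = 2 ^ 1 := by norm_num
          _ ≤ _ := pow_le_pow_right₀ (by norm_num) hkk
      have h3 : (1 : ℝ) ≤ 2 - 2 / 2 ^ A.kk := by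
        have : 2 / (2 : ℝ) ^ A.kk ≤ 1 := (div_le_one (by positivity)).mpr hk2
        linarith
      have h4 := mul_le_mul_of_nonneg_right h3 hα
      have h5 := mul_le_mul_of_nonneg_right h3 hη
      have h6 := mul_le_mul_of_nonneg_right hk1 hβ
      have h7 : A.α + A.η + A.β ≤ 1 := by linarith
      have h8 : (J : ℝ) ≤ 2 ^ J := by exact_mod_cast (Nat.lt_two_pow_self).le
      have h9 : (1 : ℝ) ≤ 2 ^ J := one_le_pow₀ (by norm_num)
      have h10 : (A.α + A.η * J) / 2 ^ i ≤ A.α + A.η * J := div_le_self (by positivity) hi1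
      have h11 : (A.α + A.η * J) / 2 ^ i + A.β ≤ 2 ^ J := by
        have e1 := mul_le_mul_of_nonneg_left h9 hα
        have e2 := mul_le_mul_of_nonneg_left h9 hβ
        have e3 := mul_le_mul_of_nonneg_left h8 hη
        have e4 := mul_le_mul_of_nonneg_right h7 h2J.le
        linarith
      calc _ ≤ A.T / 2 ^ J * 2 ^ J := by gcongr
        _ = A.T := by field_simp

noncomputable def TJ (J : ℕ) : ℝ := A.ϕ * A.T + 2 * A.T / 2 ^ J * (A.ca + A.cb * (J + 1))

lemma TJ_le (J : ℕ) : A.TJ J ≤ A.T := by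
  have hT := A.hT
  have ha := A.ca_nonneg
  have hb := A.cb_nonneg
  have h2J : (0 : ℝ) < 2 ^ J := by positivity
  have h8 : (J : ℝ) + 1 ≤ 2 ^ J := by exact_mod_cast Nat.lt_two_pow_self
  have h9 : (1 : ℝ) ≤ 2 ^ J := one_le_pow₀ (by norm_num)
  have h10 : A.ca + A.cb * (J + 1) ≤ (A.ca + A.cb) * 2 ^ J := by
    have e1 := mul_le_mul_of_nonneg_left h9 ha
    have e3 := mul_le_mul_of_nonneg_left h8 hb
    linarith
  have hsum : A.ϕ + 2 * (A.ca + A.cb) ≤ 1 := A.hsum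
  calc A.TJ J ≤ A.ϕ * A.T + 2 * A.T / 2 ^ J * ((A.ca + A.cb) * 2 ^ J) := by unfold TJ; gcongr
    _ = (A.ϕ + 2 * (A.ca + A.cb)) * A.T := by field_simp
    _ ≤ 1 * A.T := by gcongr
    _ = A.T := one_mul _

lemma desc_step (I : Finset (P → ℤ)) (hI : I ⊆ S.Λ.box S.L) (l0 : P → ℤ) (hl0 : l0 ∈ I) (J : ℕ)
    (hJ : J < A.J1) (hdiff : ∀ l ∈ I, ∃ ν : P → ℤ, l - l0 = (2 ^ J : ℤ) • ν)
    (hV : S.VV J A.S0 (A.TJ J) I) : S.VV (J + 1) A.S0 (A.TJ (J + 1)) I := by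
  have hT := A.hT
  have hα := A.α_nonneg
  have hβ := A.β_nonneg
  have hη := A.η_nonneg
  have hts := A.two_sub
  have h1 := A.int_steps I hI l0 hl0 J hJ hdiff _ (A.TJ_le J) hV A.kk le_rfl
  have h2 := A.half_step I hI l0 hl0 J hJ hdiff _ (A.T / 2 ^ J * (A.μh + A.ηh * J)) (by
    have : 0 ≤ A.T / 2 ^ J * ((2 - 2 / 2 ^ A.kk) * (A.α + A.η * J) + A.kk * A.β) := by positivity
    linarith [A.TJ_le J]) h1 (by field_simp) (by
      have ha := A.hsum
      have hμ := A.μh_nonneg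
      have hηh := A.ηh_nonneg
      have hϕ := A.hϕ
      have h2J : (0 : ℝ) < 2 ^ J := by positivity
      have h8 : (J : ℝ) ≤ 2 ^ J := by exact_mod_cast (Nat.lt_two_pow_self).le
      have h9 : (1 : ℝ) ≤ 2 ^ J := one_le_pow₀ (by norm_num)
      have e1 : 0 ≤ (2 - 2 / 2 ^ A.kk) * A.α := by positivity
      have e2 : 0 ≤ (2 - 2 / 2 ^ A.kk) * A.η := by positivity
      have e3 : 0 ≤ A.kk * A.β := by positivity
      have h7 : A.μh + A.ηh ≤ 1 := by linarith
      have h11 : A.μh + A.ηh * J ≤ 2 ^ J := by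
        have e1 := mul_le_mul_of_nonneg_left h9 hμ
        have e3 := mul_le_mul_of_nonneg_left h8 hηh
        have e4 := mul_le_mul_of_nonneg_right h7 h2J.le
        linarith
      calc _ ≤ A.T / 2 ^ J * 2 ^ J := by gcongr
        _ = A.T := by field_simp)
  refine VV_mono (le_of_eq ?_) h2
  unfold TJ ca cb
  push_cast
  rw [pow_succ]
  field_simp
  ring

lemma descent (l0 : P → ℤ) (hl0 : l0 ∈ S.Λ.box S.L) (hV : S.VV 0 A.S0 A.T (S.Λ.box S.L)) (J : ℕ)
    (hJ : J ≤ A.J1) : ∃ I ⊆ S.Λ.box S.L, l0 ∈ I ∧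
      (∀ l ∈ I, ∃ ν : P → ℤ, l - l0 = (2 ^ J : ℤ) • ν) ∧ S.VV J A.S0 (A.TJ J) I := by
  classical
  induction J with
  | zero =>
    refine ⟨_, Subset.refl _, hl0, fun l _ => ⟨l - l0, by simp⟩, VV_mono (A.TJ_le 0) hV⟩
  | succ J ih =>
    obtain ⟨I, hI, h0, hd, hv⟩ := ih (by omega)
    have h1 := A.desc_step I hI l0 h0 J (by omega) hd hv
    have h2 := S.split I J A.S0 _ h1 l0 hd h0
    refine ⟨_, (filter_subset _ _).trans hI, ?_, ?_, h2⟩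
    · rw [mem_filter]; exact ⟨h0, 0, by simp⟩
    · intro l hl
      exact (mem_filter.mp hl).2
end Par

lemma poly_zero (p : ℚ[X]) (Y : Finset ℚ) (M N : ℕ) (h : ∀ y ∈ Y, ∀ j < M, (hasseDeriv j p).eval y = 0)
    (hd : p.natDegree < N) (hN : N ≤ #Y * M) : p = 0 := by
  by_contra hp
  have h1 : ∀ y ∈ Y, (Polynomial.X - C y) ^ M ∣ p := by
    intro y hy
    rw [X_sub_C_pow_dvd_iff, X_pow_dvd_iff]
    intro j hj
    rw [← h y hy j hj, ← taylor_coeff]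
    rfl
  have h2 : ∏ y ∈ Y, (Polynomial.X - C y) ^ M ∣ p := by
    refine Finset.prod_dvd_of_coprime ?_ h1
    intro a _ b _ hab
    exact ((pairwise_coprime_X_sub_C Function.injective_id hab)).pow
  have h3 := natDegree_le_of_dvd h2 hp
  rw [natDegree_prod_of_monic _ _ (fun y _ => (monic_X_sub_C y).pow M)] at h3
  simp at h3
  omega

lemma odd_points (J N : ℕ) : ∃ Y : Finset ℚ, #Y = N ∧ ∀ y ∈ Y, ∃ x : ℤ, Odd x ∧ |x| < N ∧ y = (x : ℚ) / 2 ^ J ∨ N % 2 = 1 := by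
  by_cases hN : N % 2 = 1
  · exact ⟨(range N).map ⟨fun n : ℕ => (n : ℚ), Nat.cast_injective⟩, by simp, fun y _ => ⟨0, Or.inr hN⟩⟩
  refine ⟨(range N).map ⟨fun n : ℕ => ((2 * n - N + 1 : ℤ) : ℚ) / 2 ^ J, fun a b hab => ?_⟩, by simp, ?_⟩
  · simp only at hab
    rw [div_left_inj' (by positivity)] at hab
    have : (2 * a - N + 1 : ℤ) = 2 * b - N + 1 := by exact_mod_cast hab
    omega
  · intro y hy
    simp only [mem_map, mem_range, Function.Embedding.coeFn_mk] at hy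
    obtain ⟨n, hn, rfl⟩ := hy
    refine ⟨2 * n - N + 1, Or.inl ⟨⟨n - N / 2, by omega⟩, ?_, rfl⟩⟩
    rw [abs_lt]; omega

lemma Pl_natDegree_lt (l : P → ℤ) (h : 0 < S.L0) : (S.Pl l).natDegree < S.L0 := by
  unfold Pl
  refine lt_of_le_of_lt (natDegree_sum_le_of_forall_le (n := S.L0 - 1) _ _ fun r hr => ?_) (by omega)
  refine (natDegree_C_mul_le _ _).trans ?_
  rw [Bp_natDegree]
  have := mem_range.mp hr
  omega

lemma endgame (J : ℕ) (I : Finset (P → ℤ)) (hI : I ⊆ S.Λ.box S.L) (l0 : P → ℤ) (hl0 : l0 ∈ I) (S0 : ℕ) (T' : ℝ)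
    (hV : S.VV J S0 (2 * T') I)
    (hdiff : ∀ l ∈ I, ∃ ν : P → ℤ, l - l0 = (2 ^ J : ℤ) • ν)
    (hB : ∀ c : (P → ℤ) → ℝ, (∀ τ : Fin k → ℕ, ((∑ i, τ i : ℕ) : ℝ) < T' →
      ∑ l ∈ S.Λ.box (2 * S.L / 2 ^ J), c l * qm S.γ τ l = 0) → ∀ l ∈ S.Λ.box (2 * S.L / 2 ^ J), c l = 0)
    (hL0 : (S.L0 : ℝ) ≤ 2 ^ (J + 1) * S0 * T') (hL00 : 0 < S.L0) (hP : S.Pl l0 ≠ 0) : False := by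
  classical
  choose! ν hν using hdiff
  have hνm : ∀ r ∈ I, ν r ∈ S.Λ.lat := fun r hr => Par.nu_mem I hI l0 hl0 J hr (ν r) (hν r hr)
  have h2J : (0 : ℝ) < 2 ^ J := by positivity
  have hνb : ∀ r ∈ I, ν r ∈ S.Λ.box (2 * S.L / 2 ^ J) := by
    intro r hr
    rw [Lat.mem_box]
    refine ⟨hνm r hr, fun i => ?_⟩
    have h1 := (S.Λ.mem_box.mp (hI hr)).2 i
    have h2 := (S.Λ.mem_box.mp (hI hl0)).2 i
    have h3 : S.Λ.c i r - S.Λ.c i l0 = 2 ^ J * S.Λ.c i (ν r) := by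
      rw [← map_sub, hν r hr, map_zsmul]; simp
    rw [le_div_iff₀ h2J]
    calc |S.Λ.c i (ν r)| * 2 ^ J = |2 ^ J * S.Λ.c i (ν r)| := by
          rw [abs_mul, abs_of_pos h2J, mul_comm]
      _ = |S.Λ.c i r - S.Λ.c i l0| := by rw [h3]
      _ ≤ _ := by linarith [abs_sub (S.Λ.c i r) (S.Λ.c i l0)]
  have hν1 : ν l0 = 0 := by
    apply smul_pow_cancel (J := J)
    rw [← hν l0 hl0]; simp
  have hνinj : Set.InjOn ν I := by
    intro a ha b hb hab
    have h1 := hν a ha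
    have h2 := hν b hb
    rw [hab, ← h2] at h1
    exact sub_left_injective h1
  have key : ∀ x : ℤ, Odd x → |x| < 2 ^ (J + 1) * S0 → ∀ j : ℕ, (j : ℝ) < T' →
      (hasseDeriv j (S.Pl l0)).eval ((x : ℚ) / 2 ^ J) = 0 := by
    intro x hx hxl j hj
    set y : ℚ := (x : ℚ) / 2 ^ J with hy
    set f : (P → ℤ) → ℝ := fun l => (((hasseDeriv j (S.Pl l)).eval y : ℚ) : ℝ) * Real.exp (theta S.Λ.pr l * y) with hf
    set c : (P → ℤ) → ℝ := fun n => if l0 + (2 ^ J : ℤ) • n ∈ I then f (l0 + (2 ^ J : ℤ) • n) else 0 with hc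
    have hcν : ∀ l ∈ I, c (ν l) = f l := by
      intro l hl
      have : l0 + (2 ^ J : ℤ) • ν l = l := by rw [← hν l hl]; abel
      simp only [hc, this, if_pos hl]
    have h0 := hB c ?_ 0 (S.Λ.zero_mem_box (by have := S.hL; positivity))
    · rw [← hν1, hcν l0 hl0] at h0
      have := (mul_eq_zero.mp h0).resolve_right (Real.exp_pos _).ne'
      exact_mod_cast this
    · intro τ hτ
      have h1 : ∑ l ∈ S.Λ.box (2 * S.L / 2 ^ J), c l * (qm S.γ τ l : ℝ) =
          ∑ l ∈ I.image ν, c l * (qm S.γ τ l : ℝ) := by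
        symm
        apply sum_subset
        · intro n hn
          obtain ⟨l, hl, rfl⟩ := mem_image.mp hn
          exact hνb l hl
        · intro n _ hn2
          have : l0 + (2 ^ J : ℤ) • n ∉ I := by
            intro h
            apply hn2
            rw [mem_image]
            refine ⟨_, h, ?_⟩
            apply smul_pow_cancel (J := J)
            rw [← hν _ h]; abel
          simp only [hc, if_neg this, zero_mul]
      rw [h1, sum_image hνinj]
      have h2 := kill_affine I f (fun l i => (S.γ i l : ℝ)) T' (fun τ' hτ' => by
        have h3 := hV x hx hxl j τ' (by push_cast at hτ' ⊢; linarith)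
        rw [← h3]
        unfold X qm
        refine sum_congr rfl fun l _ => ?_
        rw [hf, ← hy]; push_cast; ring) (1 / 2 ^ J) (fun i => -(S.γ i l0 : ℝ) / 2 ^ J) τ hτ
      rw [← h2]
      refine sum_congr rfl fun l hl => ?_
      rw [hcν l hl]
      unfold qm
      push_cast
      congr 1
      refine prod_congr rfl fun i _ => ?_
      congr 1
      have h4 : (S.γ i l : ℝ) - S.γ i l0 = 2 ^ J * S.γ i (ν l) := by
        have : S.γ i l - S.γ i l0 = 2 ^ J * S.γ i (ν l) := by
          rw [← map_sub, hν l hl, map_zsmul]; simp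
        exact_mod_cast this
      field_simp
      linarith
  obtain ⟨Y, hY, hY2⟩ := odd_points J (2 ^ (J + 1) * S0)
  apply hP
  refine poly_zero _ Y ⌈T'⌉₊ S.L0 ?_ (Pl_natDegree_lt l0 hL00) ?_
  · intro y hy j hj
    obtain ⟨x, h | h⟩ := hY2 y hy
    · rw [h.2.2]
      exact key x h.1 (by have := h.2.1; push_cast at this; exact this) j (Nat.lt_ceil.mp hj)
    · exfalso
      have : 2 ^ (J + 1) * S0 = 2 * (2 ^ J * S0) := by ring
      omega
  · rw [hY]
    have h1 : T' ≤ ⌈T'⌉₊ := Nat.le_ceil _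
    have h2 : (S.L0 : ℝ) ≤ 2 ^ (J + 1) * S0 * ⌈T'⌉₊ := hL0.trans (by gcongr)
    exact_mod_cast h2

/-- The full descent gives a contradiction. -/
theorem Par.contradiction (A : Par S) (hV : S.VV 0 A.S0 A.T (S.Λ.box S.L))
    (l0 : P → ℤ) (hl0 : l0 ∈ S.Λ.box S.L) (hP : S.Pl l0 ≠ 0)
    (hB : ∀ c : (P → ℤ) → ℝ, (∀ τ : Fin k → ℕ, ((∑ i, τ i : ℕ) : ℝ) < A.ϕ * A.T / 2 →
      ∑ l ∈ S.Λ.box (2 * S.L / 2 ^ A.J1), c l * qm S.γ τ l = 0) →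
        ∀ l ∈ S.Λ.box (2 * S.L / 2 ^ A.J1), c l = 0)
    (hL0 : (S.L0 : ℝ) ≤ 2 ^ A.J1 * A.ϕ * (A.S0 * A.T)) (hL00 : 0 < S.L0) : False := by
  obtain ⟨I, hI, h0, hd, hv⟩ := A.descent l0 hl0 hV A.J1 le_rfl
  refine endgame A.J1 I hI l0 h0 A.S0 (A.ϕ * A.T / 2) ?_ hd hB ?_ hL00 hP
  · refine VV_mono ?_ hv
    have hT := A.hT
    have ha := A.ca_nonneg
    have hb := A.cb_nonneg
    unfold Par.TJ
    have : 0 ≤ 2 * A.T / 2 ^ A.J1 * (A.ca + A.cb * (A.J1 + 1)) := by positivity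
    linarith
  · refine hL0.trans (le_of_eq ?_)
    rw [pow_succ]; ring
end Setup
end BW


namespace BW
open Finset Polynomial

section
attribute [local instance] Matrix.seminormedAddCommGroup

lemma siegel {α β : Type} [Fintype α] [Fintype β] (a : α → β → ℤ) (H : ℝ) (hH : 0 ≤ H)
    (ha : ∀ i j, |(a i j : ℝ)| ≤ Real.exp H) (hα : 0 < Fintype.card α) (ν : ℝ) (hν0 : 0 < ν)
    (hν : (Fintype.card α : ℝ) * (1 + ν) ≤ Fintype.card β * ν) :
    ∃ t : β → ℤ, t ≠ 0 ∧ (∀ i, ∑ j, a i j * t j = 0) ∧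
      ∀ j, |(t j : ℝ)| ≤ Real.exp (ν * (Real.log (Fintype.card β) + H)) := by
  classical
  have hM : (0 : ℝ) < Fintype.card α := by exact_mod_cast hα
  have hMN : (Fintype.card α : ℝ) < Fintype.card β := by
    by_contra h
    push Not at h
    have := mul_le_mul_of_nonneg_right h hν0.le
    linarith
  have hN : (1 : ℝ) ≤ Fintype.card β := by
    have h1 : Fintype.card α < Fintype.card β := by exact_mod_cast hMN
    have : 1 ≤ Fintype.card β := by omega
    exact_mod_cast this
  obtain ⟨t, h0, h1, h2⟩ := Int.Matrix.exists_ne_zero_int_vec_norm_le (Matrix.of a)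
    (by exact_mod_cast hMN) hα
  refine ⟨t, h0, fun i => ?_, fun j => ?_⟩
  · have := congrFun h1 i
    simpa [Matrix.mulVec, dotProduct] using this
  · have hb : ‖Matrix.of a‖ ≤ Real.exp H := by
      rw [Matrix.norm_le_iff (Real.exp_pos _).le]
      intro i j
      rw [Matrix.of_apply, Int.norm_eq_abs]
      exact ha i j
    have hmax : max 1 ‖Matrix.of a‖ ≤ Real.exp H := max_le (Real.one_le_exp hH) hb
    have e1 : |(t j : ℝ)| ≤ ‖t‖ := by
      rw [← Int.norm_eq_abs]; exact norm_le_pi_norm t j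
    refine e1.trans (h2.trans ?_)
    have hbase : (1 : ℝ) ≤ Fintype.card β * max 1 ‖Matrix.of a‖ := by
      have : (1 : ℝ) ≤ max 1 ‖Matrix.of a‖ := le_max_left _ _
      nlinarith
    have hexp : (Fintype.card α : ℝ) / (Fintype.card β - Fintype.card α) ≤ ν := by
      rw [div_le_iff₀ (by linarith)]; linarith
    calc _ ≤ ((Fintype.card β : ℝ) * max 1 ‖Matrix.of a‖) ^ ν := Real.rpow_le_rpow_of_exponent_le hbase hexp
      _ ≤ ((Fintype.card β : ℝ) * Real.exp H) ^ ν := by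
          refine Real.rpow_le_rpow (by linarith) ?_ hν0.le
          exact mul_le_mul_of_nonneg_left hmax (by linarith)
      _ = _ := by
          rw [Real.rpow_def_of_pos (by positivity), Real.log_mul (by positivity) (by positivity), Real.log_exp]
          congr 1; ring
end

variable {P : Type} [Fintype P] {m k : ℕ}

lemma rho_weight (Λ : Lat P m) (L : ℝ) : ∃ Ep : P → ℤ, (∀ p, ∀ l ∈ Λ.box L, |l p| ≤ Ep p) ∧
    ∑ p, (Ep p : ℝ) * Real.log (Λ.pr p) ≤ L * Λ.h ∨ ¬ 0 ≤ L := by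
  classical
  by_cases hL : 0 ≤ L
  swap
  · exact ⟨0, Or.inr hL⟩
  have hne : (Λ.box L).Nonempty := ⟨0, Λ.zero_mem_box hL⟩
  refine ⟨fun p => (Λ.box L).sup' hne fun l => |l p|, Or.inl ⟨fun p l hl => ?_, ?_⟩⟩
  · exact Finset.le_sup' (fun l : P → ℤ => |l p|) hl
  · unfold Lat.h
    rw [sum_comm, mul_sum]
    refine sum_le_sum fun p _ => ?_
    obtain ⟨l, hl, h⟩ := Finset.exists_mem_eq_sup' hne (fun l : P → ℤ => |l p|)
    beta_reduce
    rw [h, ← sum_mul, ← mul_assoc]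
    refine mul_le_mul_of_nonneg_right ?_ (Λ.lg_pos' p).le
    obtain ⟨h1, h2⟩ := Λ.mem_box.mp hl
    push_cast
    rw [h1 p, mul_sum]
    refine (abs_sum_le_sum_abs _ _).trans (sum_le_sum fun i _ => ?_)
    rw [abs_mul]
    exact mul_le_mul_of_nonneg_right (h2 i) (abs_nonneg _)

set_option maxHeartbeats 1000000 in
theorem aux_poly (Λ : Lat P m) (γ : Fin k → (P → ℤ) →+ ℤ) (L : ℝ) (hL : 0 < L) (t1 : ℝ) (ht1 : 0 ≤ t1)
    (hγ : ∀ l ∈ Λ.box L, ∀ i, |(γ i l : ℝ)| ≤ Real.exp t1)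
    (k0 : ℕ) (hk0 : 0 < k0) (d : ℕ) (hd : ∀ i, 1 ≤ i → i ≤ k0 → i ∣ d)
    (hdt : (d : ℝ) ≤ Real.exp t1) (hd0 : 0 < d) (L0 S0 T : ℕ) (hS0 : 1 ≤ S0) (hT : 1 ≤ T) (ε ν x : ℝ) (hν0 : 0 < ν)
    (hA : ∑ j ∈ range T, (rk γ (Λ.box L) (T - j) : ℝ) ≤ ε * T * #(Λ.box L))
    (hε : 2 * ε * (1 + ν) * (S0 * T) ≤ ν * L0) (hx : m * L * Λ.s ≤ x * T) :
    ∃ pc : (P → ℤ) → ℕ → ℤ, (∃ l ∈ Λ.box L, ∃ r < L0, pc l r ≠ 0) ∧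
      (∀ l ∈ Λ.box L, ∀ r < L0, |(pc l r : ℝ)| ≤ Real.exp (ν * (Real.log (#(Λ.box L) * L0) +
        (t1 * T + (L0 * Real.log (1 + (2 * S0 + 1) / k0) + (L0 + k0)) + 4 * x * (S0 * T))))) ∧
      ∀ y : ℤ, Odd y → |y| < 2 * S0 → ∀ (j : ℕ) (τ : Fin k → ℕ), j + ∑ i, τ i < T →
        ∑ l ∈ Λ.box L, (((hasseDeriv j (∑ r ∈ range L0, C (pc l r : ℚ) * Bp k0 r)).eval (y : ℚ) : ℚ) : ℝ) *
          qm γ τ l * Real.exp (theta Λ.pr l * y) = 0 := by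
  classical
  set B := Λ.box L with hB
  have hBne : B.Nonempty := ⟨0, Λ.zero_mem_box hL.le⟩
  choose Ts hTs1 hTs2 hTs3 using fun j : ℕ => exists_span γ B (T - j)
  obtain ⟨Ep, ⟨hEp1, hEp2⟩ | h⟩ := rho_weight Λ L
  swap
  · exact absurd hL.le h
  have hwt : ∀ (y : ℤ) (l : P → ℤ), l ∈ B → ∃ N : ℕ, (N : ℝ) = Real.exp (theta Λ.pr (y • l + |y| • Ep)) := by
    intro y l hl
    obtain ⟨N, hN⟩ := rt_nat (pr := Λ.pr) (y • l + |y| • Ep) (by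
      intro p
      simp only [Pi.add_apply, Pi.smul_apply, smul_eq_mul]
      have h1 := hEp1 p l hl
      have h2 : |y| * |l p| ≤ |y| * Ep p := mul_le_mul_of_nonneg_left h1 (abs_nonneg _)
      rw [← abs_mul] at h2
      have := neg_abs_le (y * l p)
      linarith)
    refine ⟨N, ?_⟩
    rw [exp_theta Λ.hp, hN]; simp
  choose! wt hwt using hwt
  have hBi : ∀ (j r : ℕ) (y : ℤ), ∃ b : ℤ, (d : ℚ) ^ j * (hasseDeriv j (Bp k0 r)).eval (y : ℚ) = b := by
    intro j r y
    obtain ⟨b, hb⟩ := Bp_integral k0 d hd hk0 1 (y : ℚ) (choose_int y) r j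
    exact ⟨b, by rw [← hb]; simp⟩
  choose bi hbi using hBi
  set yy : Fin (2 * S0) → ℤ := fun i => 2 * (i : ℤ) - 2 * S0 + 1 with hyy
  have hyyl : ∀ i, |yy i| < 2 * S0 := by
    intro i
    have := i.2
    rw [abs_lt]; simp only [hyy]; omega
  let α := Fin (2 * S0) × (Σ j : Fin T, Ts j)
  let β := B × Fin L0
  let a : α → β → ℤ := fun i b => bi i.2.1 b.2 (yy i.1) * qm γ i.2.2 b.1 * wt (yy i.1) b.1
  have hcα : (Fintype.card α : ℝ) = 2 * S0 * ∑ j ∈ range T, (rk γ B (T - j) : ℝ) := by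
    have : Fintype.card α = 2 * S0 * ∑ j ∈ range T, rk γ B (T - j) := by
      simp only [α, Fintype.card_prod, Fintype.card_fin, Fintype.card_sigma, Fintype.card_coe, hTs1]
      rw [sum_range]
    rw [this]; push_cast; ring
  have hcβ : (Fintype.card β : ℝ) = #B * L0 := by
    simp [β, Fintype.card_prod]
  have hc0 : 0 < Fintype.card α := by
    have h1 : ((rk γ B (T - 0) : ℕ) : ℝ) ≤ ∑ j ∈ range T, (rk γ B (T - j) : ℝ) :=
      single_le_sum (f := fun j => (rk γ B (T - j) : ℝ)) (fun _ _ => by positivity) (mem_range.mpr (by omega))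
    have h2 : 1 ≤ rk γ B (T - 0) := rk_pos γ B hBne _ (by omega)
    have h3 : (1 : ℝ) ≤ (rk γ B (T - 0) : ℝ) := by exact_mod_cast h2
    have h4 : (1 : ℝ) ≤ S0 := by exact_mod_cast hS0
    have : (0 : ℝ) < Fintype.card α := by rw [hcα]; nlinarith
    exact_mod_cast this
  set bb : ℝ := L0 * Real.log (1 + (2 * S0 + 1) / k0) + (L0 + k0) with hbb
  have hk0' : (0 : ℝ) < k0 := by exact_mod_cast hk0
  have h1k : (1 : ℝ) ≤ 1 + (2 * S0 + 1) / k0 := by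
    have : (0 : ℝ) ≤ (2 * S0 + 1) / k0 := by positivity
    linarith
  have hbb0 : 0 ≤ bb := by
    have := Real.log_nonneg h1k
    positivity
  have hwh := Λ.wh_le
  have hs := Λ.hs
  have hxT : 0 ≤ x * T := le_trans (by positivity) hx
  have hxG : 0 ≤ 4 * x * (S0 * T) := by
    have : 4 * x * (S0 * T) = 4 * S0 * (x * T) := by ring
    rw [this]; positivity
  have hab : ∀ i b, |(a i b : ℝ)| ≤ Real.exp (t1 * T + bb + 4 * x * (S0 * T)) := by
    rintro ⟨i, j, τ⟩ ⟨l, r⟩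
    simp only [a]
    push_cast
    have hy : |((yy i : ℤ) : ℝ)| ≤ 2 * S0 := by exact_mod_cast (hyyl i).le
    have e1 : |(bi j r (yy i) : ℝ)| ≤ Real.exp (t1 * j) * Real.exp bb := by
      have h1 : (bi j r (yy i) : ℝ) = (d : ℝ) ^ (j : ℕ) * (((hasseDeriv j (Bp k0 r)).eval (yy i : ℚ) : ℚ) : ℝ) := by
        have := congrArg (fun q : ℚ => (q : ℝ)) (hbi j r (yy i))
        push_cast at this
        rw [← this]
      rw [h1, abs_mul]
      refine mul_le_mul ?_ ?_ (abs_nonneg _) (Real.exp_pos _).le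
      · rw [abs_of_nonneg (by positivity), mul_comm, Real.exp_nat_mul]
        exact pow_le_pow_left₀ (by positivity) hdt _
      · have h2 := hasse_Bp_le k0 r j hk0 (((yy i : ℚ) : ℝ) : ℂ) (2 * S0) (by
          rw [Complex.norm_real, Real.norm_eq_abs]; push_cast; exact hy)
        rw [Setup.aeval_rat, Complex.norm_real, Real.norm_eq_abs] at h2
        refine h2.trans ?_
        have h3 : ((r : ℕ) : ℝ) ≤ L0 := by exact_mod_cast r.2.le
        calc (1 + (2 * (S0:ℝ) + 1) / k0) ^ (r : ℕ) * Real.exp (r + k0)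
            ≤ (1 + (2 * (S0:ℝ) + 1) / k0) ^ L0 * Real.exp (L0 + k0) := by
              have : (r : ℕ) ≤ L0 := r.2.le
              gcongr
          _ = _ := by
              rw [hbb, Real.exp_add (_ * _), Real.exp_nat_mul, Real.exp_log (by linarith)]
    have e2 : |(qm γ τ.1 l : ℝ)| ≤ Real.exp (t1 * (∑ i, τ.1 i : ℕ)) := by
      unfold qm
      push_cast
      rw [abs_prod, mul_sum, Real.exp_sum]
      refine prod_le_prod (fun _ _ => abs_nonneg _) fun n _ => ?_
      rw [abs_pow, mul_comm, Real.exp_nat_mul]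
      exact pow_le_pow_left₀ (abs_nonneg _) (hγ l l.2 n) _
    have e3 : |(wt (yy i) l : ℝ)| ≤ Real.exp (4 * x * (S0 * T)) := by
      rw [hwt _ _ l.2, abs_of_pos (Real.exp_pos _), Real.exp_le_exp, theta_add, theta_smul, theta_smul]
      have h1 := Λ.theta_le l.2
      have h2 : (yy i : ℝ) * theta Λ.pr l ≤ 2 * S0 * (L * Λ.w) := by
        refine (le_abs_self _).trans ?_
        rw [abs_mul]
        exact mul_le_mul hy h1 (abs_nonneg _) (by positivity)
      have h3 : ((|yy i| : ℤ) : ℝ) * theta Λ.pr Ep ≤ 2 * S0 * (L * Λ.h) := by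
        push_cast
        calc |((yy i : ℤ) : ℝ)| * theta Λ.pr Ep ≤ |((yy i : ℤ) : ℝ)| * (L * Λ.h) :=
              mul_le_mul_of_nonneg_left hEp2 (abs_nonneg _)
          _ ≤ _ := mul_le_mul_of_nonneg_right hy (mul_nonneg hL.le Λ.h_nonneg)
      have h4 := mul_le_mul_of_nonneg_left hwh (by positivity : 0 ≤ 2 * S0 * L)
      have h5 := mul_le_mul_of_nonneg_left hx (by positivity : (0:ℝ) ≤ 4 * S0)
      linarith
    have hjτ : ((j : ℕ) : ℝ) + ((∑ i, τ.1 i : ℕ) : ℝ) ≤ T := by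
      have h1 := hTs2 j τ.1 τ.2
      have h2 : (j : ℕ) + ∑ i, τ.1 i ≤ T := by omega
      exact_mod_cast h2
    have e4 := mul_le_mul_of_nonneg_left hjτ ht1
    rw [abs_mul, abs_mul]
    calc _ ≤ (Real.exp (t1 * j) * Real.exp bb) * Real.exp (t1 * (∑ i, τ.1 i : ℕ)) * Real.exp (4 * x * (S0 * T)) := by
          gcongr
      _ ≤ _ := by
          rw [← Real.exp_add, ← Real.exp_add, ← Real.exp_add, Real.exp_le_exp]
          linarith
  obtain ⟨t, ht0, hteq, htb⟩ := siegel a (t1 * T + bb + 4 * x * (S0 * T)) (by positivity) hab hc0 ν hν0 (by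
    rw [hcα, hcβ]
    have h1 := mul_le_mul_of_nonneg_left hA (by positivity : (0:ℝ) ≤ 2 * S0 * (1 + ν))
    have h2 := mul_le_mul_of_nonneg_left hε (by positivity : (0:ℝ) ≤ #B)
    linarith)
  refine ⟨fun l r => if h : l ∈ B ∧ r < L0 then t (⟨l, h.1⟩, ⟨r, h.2⟩) else 0, ?_, ?_, ?_⟩
  · obtain ⟨⟨l, r⟩, h⟩ := Function.ne_iff.mp ht0
    refine ⟨l, l.2, r, r.2, ?_⟩
    beta_reduce
    rw [dif_pos ⟨l.2, r.2⟩]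
    exact h
  · intro l hl r hr
    beta_reduce
    rw [dif_pos ⟨hl, hr⟩]
    have := htb (⟨l, hl⟩, ⟨r, hr⟩)
    rw [hcβ] at this
    exact this
  · intro y hy hyl j τ hjτ
    set pc : (P → ℤ) → ℕ → ℤ := fun l r => if h : l ∈ B ∧ r < L0 then t (⟨l, h.1⟩, ⟨r, h.2⟩) else 0 with hpc
    obtain ⟨i, hi⟩ : ∃ i, yy i = y := by
      obtain ⟨q, hq⟩ := hy
      rw [abs_lt] at hyl
      refine ⟨⟨(q + S0).toNat, by omega⟩, ?_⟩
      simp only [hyy]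
      omega
    have hjT : j < T := by omega
    set f : (P → ℤ) → ℝ := fun l => (((hasseDeriv j (∑ r ∈ range L0, C (pc l r : ℚ) * Bp k0 r)).eval (y : ℚ) : ℚ) : ℝ) *
      Real.exp (theta Λ.pr l * y) with hf
    have hfd : ∀ l ∈ B, (d : ℝ) ^ j * Real.exp (theta Λ.pr (|y| • Ep)) * f l =
        ∑ r ∈ range L0, (bi j r y : ℝ) * wt y l * pc l r := by
      intro l hl
      have h1 : (d : ℚ) ^ j * (hasseDeriv j (∑ r ∈ range L0, C (pc l r : ℚ) * Bp k0 r)).eval (y : ℚ) =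
          ∑ r ∈ range L0, (bi j r y : ℚ) * pc l r := by
        rw [map_sum, eval_finsetSum, mul_sum]
        refine sum_congr rfl fun r _ => ?_
        rw [← smul_eq_C_mul, map_smul, eval_smul, smul_eq_mul, ← hbi]; ring
      have h2 := congrArg (fun q : ℚ => (q : ℝ)) h1
      push_cast at h2
      have h3 : (wt y l : ℝ) = Real.exp (theta Λ.pr l * y) * Real.exp (theta Λ.pr (|y| • Ep)) := by
        rw [hwt y l hl, theta_add, Real.exp_add, theta_smul, mul_comm (y : ℝ)]
      have h4 : ∑ r ∈ range L0, (bi j r y : ℝ) * wt y l * pc l r =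
          wt y l * ∑ r ∈ range L0, (bi j r y : ℝ) * pc l r := by
        rw [mul_sum]; exact sum_congr rfl fun r _ => by ring
      rw [h4, ← h2, h3, hf]; ring
    have h1 : ∀ τ ∈ Ts j, ∑ l ∈ B, f l * qm γ τ l = 0 := by
      intro τ hτ
      have h2 := hteq (i, ⟨⟨j, hjT⟩, ⟨τ, hτ⟩⟩)
      have h3 : (0 : ℝ) = ∑ l ∈ B, ∑ r ∈ range L0, (bi j r y : ℝ) * qm γ τ l * wt y l * pc l r := by
        have h4 := congrArg (fun q : ℤ => (q : ℝ)) h2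
        simp only [a, hi, β] at h4
        rw [Fintype.sum_prod_type] at h4
        push_cast at h4
        rw [← h4, ← sum_attach B]
        refine sum_congr rfl fun l _ => ?_
        rw [sum_range]
        refine sum_congr rfl fun r _ => ?_
        simp only [hpc]
        rw [dif_pos ⟨l.2, r.2⟩]
      have h5 : (d : ℝ) ^ j * Real.exp (theta Λ.pr (|y| • Ep)) * ∑ l ∈ B, f l * qm γ τ l = 0 := by
        rw [h3, mul_sum]
        refine sum_congr rfl fun l hl => ?_
        rw [← mul_assoc, hfd l hl, sum_mul]
        exact sum_congr rfl fun r _ => by ring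
      refine (mul_eq_zero.mp h5).resolve_left ?_
      have : (0 : ℝ) < d := by exact_mod_cast hd0
      positivity
    have h6 := hTs3 j f h1 τ (by omega)
    rw [← h6]
    refine sum_congr rfl fun l _ => ?_
    rw [hf]; ring
end BW


namespace BW
open Finset Polynomial

noncomputable def Cst (n : ℕ) : ℝ :=
  18 * ((n + 1).factorial : ℝ) * (n : ℝ) ^ (n + 1) * 32 ^ (n + 2) * Real.log (2 * (n : ℝ))

lemma log_le_of {a b : ℝ} {p q : ℕ} (hq : 0 < q) (ha : 0 < a) (hb : b = p / q)
    (h : a ^ q ≤ (2.7182818283 : ℝ) ^ p) : Real.log a ≤ b := by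
  rw [Real.log_le_iff_le_exp ha]
  have h1 : (2.7182818283 : ℝ) ^ p ≤ Real.exp 1 ^ p :=
    pow_le_pow_left₀ (by norm_num) Real.exp_one_gt_d9.le _
  have h2 : Real.exp b ^ q = Real.exp 1 ^ p := by
    rw [← Real.exp_nat_mul, ← Real.exp_nat_mul, hb]
    congr 1
    have : (q : ℝ) ≠ 0 := by positivity
    field_simp
  refine le_of_not_gt fun hlt => ?_
  have := pow_lt_pow_left₀ hlt (Real.exp_pos _).le hq.ne'
  linarith

lemma exp_le_of {a b : ℝ} {p q : ℕ} (hq : 0 < q) (ha : 0 < a) (hb : b = p / q)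
    (h : (2.7182818286 : ℝ) ^ p ≤ a ^ q) : Real.exp b ≤ a := by
  have h1 : Real.exp 1 ^ p ≤ (2.7182818286 : ℝ) ^ p :=
    pow_le_pow_left₀ (Real.exp_pos _).le Real.exp_one_lt_d9.le _
  have h2 : Real.exp b ^ q = Real.exp 1 ^ p := by
    rw [← Real.exp_nat_mul, ← Real.exp_nat_mul, hb]
    congr 1
    have : (q : ℝ) ≠ 0 := by positivity
    field_simp
  refine le_of_not_gt fun hlt => ?_
  have := pow_lt_pow_left₀ hlt ha.le hq.ne'
  linarith

lemma exp_g : Real.exp (2 * (8 / 5)) ≤ (5 : ℝ) ^ 2 - 1 / 4 :=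
  exp_le_of (p := 16) (q := 5) (by norm_num) (by norm_num) (by norm_num) (by norm_num)
lemma exp_g' : Real.exp (2 * (207 / 100)) ≤ (8 : ℝ) ^ 2 - 1 :=
  exp_le_of (p := 207) (q := 50) (by norm_num) (by norm_num) (by norm_num) (by norm_num)
lemma log_174 : Real.log 174 ≤ 5.2 :=
  log_le_of (p := 26) (q := 5) (by norm_num) (by norm_num) (by norm_num) (by norm_num)
lemma log_345 : Real.log 345 ≤ 5.85 :=
  log_le_of (p := 117) (q := 20) (by norm_num) (by norm_num) (by norm_num) (by norm_num)
lemma log_4 : Real.log 4 = 2 * Real.log 2 := by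
  rw [show (4 : ℝ) = 2 ^ 2 by norm_num, Real.log_pow]; norm_num
lemma log_m (c m : ℝ) (hc : 0 < c) (hm : 0 < m) : Real.log (c * m) ≤ Real.log (c * 3) + m / 3 - 1 := by
  have h1 : c * m = (c * 3) * (m / 3) := by ring
  rw [h1, Real.log_mul (by positivity) (by positivity)]
  have := Real.log_le_sub_one_of_pos (by positivity : 0 < m / 3)
  linarith

lemma pow_ratio (m : ℕ) (hm : 2 ≤ m) : ((m : ℝ) + 1) ^ (m + 1) ≤ 4.5 * (m : ℝ) ^ (m + 1) := by
  have hm0 : (0 : ℝ) < m := by positivity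
  have hm2 : (2 : ℝ) ≤ m := by exact_mod_cast hm
  have h1 : ((m : ℝ) + 1) ≤ m * Real.exp (1 / m) := by
    have := Real.add_one_le_exp (1 / (m : ℝ))
    have h2 := mul_le_mul_of_nonneg_left this hm0.le
    have h3 : (m : ℝ) * (1 / m + 1) = m + 1 := by field_simp; ring
    linarith
  have h2 : ((m : ℝ) + 1) ^ m ≤ 3 * (m : ℝ) ^ m := by
    calc ((m : ℝ) + 1) ^ m ≤ (m * Real.exp (1 / m)) ^ m := pow_le_pow_left₀ (by positivity) h1 _
      _ = m ^ m * Real.exp 1 := by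
          rw [mul_pow, ← Real.exp_nat_mul]; congr 2; field_simp
      _ ≤ m ^ m * 3 := by
          have := Real.exp_one_lt_d9
          gcongr; linarith
      _ = _ := by ring
  rw [pow_succ, pow_succ]
  calc _ ≤ (3 * (m : ℝ) ^ m) * (1.5 * m) := by
        apply mul_le_mul h2 (by linarith) (by positivity) (by positivity)
    _ = _ := by ring

lemma Q_ineq (m : ℕ) (hm : 2 ≤ m) : 95000 * (m : ℝ) ^ (m + 1) * 20 ^ m ≤
    18432 * 1.386 * ((m + 1).factorial : ℝ) * (m.factorial : ℝ) * 32 ^ m := by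
  induction m, hm using Nat.le_induction with
  | base => norm_num [Nat.factorial]
  | succ m hm ih =>
    have hm2 : (2 : ℝ) ≤ m := by exact_mod_cast hm
    have h1 := pow_ratio m hm
    rw [Nat.factorial_succ (m + 1), Nat.factorial_succ m] at *
    push_cast at *
    have h3 : (0 : ℝ) < (m.factorial : ℝ) := by positivity
    calc 95000 * ((m : ℝ) + 1) ^ (m + 1 + 1) * 20 ^ (m + 1)
        = 95000 * 20 ^ m * 20 * ((m + 1) * ((m : ℝ) + 1) ^ (m + 1)) := by ring
      _ ≤ 95000 * 20 ^ m * 20 * ((m + 1) * (4.5 * (m : ℝ) ^ (m + 1))) := by gcongr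
      _ = 90 * (m + 1) * (95000 * (m : ℝ) ^ (m + 1) * 20 ^ m) := by ring
      _ ≤ 90 * (m + 1) * (18432 * 1.386 * (((m : ℝ) + 1) * m.factorial) * m.factorial * 32 ^ m) := by gcongr
      _ ≤ (32 * (m + 1 + 1)) * (m + 1) * (18432 * 1.386 * (((m : ℝ) + 1) * m.factorial) * m.factorial * 32 ^ m) := by
          gcongr; linarith
      _ = _ := by ring

lemma log_4_ge : 1.386 ≤ Real.log 4 := by
  rw [log_4]; linarith [Real.log_two_gt_d9]

lemma Cst_ge (m : ℕ) (hm : 2 ≤ m) : 95000 * (m : ℝ) ^ 2 * (20 * (m : ℝ) ^ 2) ^ m ≤ Cst m * m.factorial := by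
  have h1 := Q_ineq m hm
  have hm2 : (2 : ℝ) ≤ m := by exact_mod_cast hm
  have h2 : 1.386 ≤ Real.log (2 * (m : ℝ)) :=
    log_4_ge.trans (Real.log_le_log (by norm_num) (by linarith))
  have h3 : 0 < (m : ℝ) ^ (m + 1) := by positivity
  calc 95000 * (m : ℝ) ^ 2 * (20 * (m : ℝ) ^ 2) ^ m
      = (95000 * (m : ℝ) ^ (m + 1) * 20 ^ m) * (m : ℝ) ^ (m + 1) := by
        rw [mul_pow, ← pow_mul, pow_succ]; ring
    _ ≤ (18432 * 1.386 * ((m + 1).factorial : ℝ) * (m.factorial : ℝ) * 32 ^ m) * (m : ℝ) ^ (m + 1) := by gcongr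
    _ = 18 * ((m + 1).factorial : ℝ) * (m : ℝ) ^ (m + 1) * 32 ^ (m + 2) * 1.386 * m.factorial := by ring
    _ ≤ _ := by unfold Cst; gcongr

/-- bound of the final size -/
lemma final_size (m : ℕ) (hm : 2 ≤ m) (s t G T S0 : ℝ) (hs : 1 ≤ s) (ht : 23 ≤ t) (hS : S0 ≤ 20 * m * t + 1)
    (hT : T ≤ 560 * m * ((20 * m ^ 2 * s) ^ m / (m.factorial * 2 ^ m)) + 20 * m ^ 2 * s + 1)
    (hT0 : 0 ≤ T) (hG : G = S0 * T) : 7.4 * 2 ^ m * G ≤ Cst m * t * s ^ m := by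
  have hm2 : (2 : ℝ) ≤ m := by exact_mod_cast hm
  set K : ℝ := 20 * m ^ 2 * s with hK
  have hm4 : (4 : ℝ) ≤ m ^ 2 := by nlinarith
  have hK80 : 80 ≤ K := by rw [hK]; nlinarith
  have hf : (0 : ℝ) < m.factorial := by positivity
  have h1 : (m.factorial : ℝ) * 2 ^ m ≤ K ^ (m - 1) := by
    have e1 : (m.factorial : ℝ) ≤ (m : ℝ) ^ m := by exact_mod_cast Nat.factorial_le_pow m
    have e2 : (m : ℝ) ^ m ≤ ((m : ℝ) ^ 2) ^ (m - 1) := by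
      rw [← pow_mul]; exact pow_le_pow_right₀ (by linarith) (by omega)
    have e3 : (2 : ℝ) ^ m ≤ (4 : ℝ) ^ (m - 1) := by
      rw [show (4 : ℝ) = 2 ^ 2 by norm_num, ← pow_mul]
      exact pow_le_pow_right₀ (by norm_num) (by omega)
    calc _ ≤ ((m : ℝ) ^ 2) ^ (m - 1) * 4 ^ (m - 1) := by
          apply mul_le_mul (e1.trans e2) e3 (by positivity) (by positivity)
      _ = ((m : ℝ) ^ 2 * 4) ^ (m - 1) := (mul_pow _ _ _).symm
      _ ≤ _ := by
          apply pow_le_pow_left₀ (by positivity)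
          rw [hK]; nlinarith
  set Mn : ℝ := K ^ m / (m.factorial * 2 ^ m) with hMn
  have h2 : K ≤ Mn := by
    rw [hMn, le_div_iff₀ (by positivity)]
    calc K * (m.factorial * 2 ^ m) ≤ K * K ^ (m - 1) := by gcongr
      _ = K ^ m := by rw [← pow_succ']; congr 1; omega
  have h3 : T ≤ 1.002 * (560 * m * Mn) := by
    have : 2 * Mn ≤ m * Mn := by apply mul_le_mul_of_nonneg_right hm2; linarith
    linarith
  have h4 : S0 ≤ 20.04 * m * t := by nlinarith
  have hMn0 : 0 < Mn := by linarith
  have h5 : G ≤ (20.04 * m * t) * (1.002 * (560 * m * Mn)) := by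
    rw [hG]
    exact mul_le_mul h4 h3 hT0 (by positivity)
  have h6 := Cst_ge m hm
  have h7 : 2 ^ m * Mn * m.factorial = (20 * (m : ℝ) ^ 2) ^ m * s ^ m := by
    rw [hMn, ← mul_pow, ← hK]; field_simp
  have h8 : 7.4 * 2 ^ m * G * m.factorial ≤ Cst m * t * s ^ m * m.factorial := by
    calc 7.4 * 2 ^ m * G * m.factorial ≤ 7.4 * 2 ^ m * ((20.04 * m * t) * (1.002 * (560 * m * Mn))) * m.factorial := by gcongr
      _ = (7.4 * 20.04 * 1.002 * 560) * m ^ 2 * t * (2 ^ m * Mn * m.factorial) := by ring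
      _ ≤ 95000 * m ^ 2 * t * (2 ^ m * Mn * m.factorial) := by gcongr; norm_num
      _ = (95000 * m ^ 2 * (20 * (m : ℝ) ^ 2) ^ m) * (t * s ^ m) := by rw [h7]; ring
      _ ≤ (Cst m * m.factorial) * (t * s ^ m) := by gcongr
      _ = _ := by ring
  exact le_of_mul_le_mul_right h8 hf

lemma hsum_num (m : ℕ) (hm : 2 ≤ m) : (1 / 1024 : ℝ) + 2 * (((2 - 2 / 2 ^ (m - 2)) *
    ((0.486 + 0.0148 * m) / m / 3.2) + ((m - 2 : ℕ) : ℝ) * (7.5 * (1 / (20 * m))) +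
    (4 * ((0.486 + 0.0148 * m) / m) + 32 * (1 / (20 * m))) / 4.14) +
    ((2 - 2 / 2 ^ (m - 2)) * (0.009 / m / 3.2) + 4 * (0.009 / m) / 4.14)) ≤ 1 := by
  rcases (by omega : m = 2 ∨ m = 3 ∨ m = 4 ∨ 5 ≤ m) with rfl | rfl | rfl | h5
  · norm_num
  · norm_num
  · norm_num
  · have h5' : (5 : ℝ) ≤ m := by exact_mod_cast h5
    rw [Nat.cast_sub hm]
    have hm0 : (0 : ℝ) < m := by linarith
    have hq : 2 - 2 / (2 : ℝ) ^ (m - 2) ≤ 2 := by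
      have : 0 ≤ 2 / (2 : ℝ) ^ (m - 2) := by positivity
      linarith
    set y : ℝ := 1 / m with hy
    have hy0 : 0 ≤ y := by positivity
    have hy5 : y ≤ 1 / 5 := by rw [hy]; exact one_div_le_one_div_of_le (by norm_num) h5'
    have hym : (m : ℝ) * y = 1 := by rw [hy]; field_simp
    have e1 : (0.486 + 0.0148 * (m : ℝ)) / m = 0.486 * y + 0.0148 := by rw [hy]; field_simp
    have e2 : 1 / (20 * (m : ℝ)) = y / 20 := by rw [hy]; field_simp
    have e3 : 0.009 / (m : ℝ) = 0.009 * y := by rw [hy]; field_simp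
    rw [e1, e2, e3]
    have f1 := mul_le_mul_of_nonneg_right hq (by positivity : 0 ≤ (0.486 * y + 0.0148) / 3.2)
    have f2 := mul_le_mul_of_nonneg_right hq (by positivity : 0 ≤ 0.009 * y / 3.2)
    push_cast
    have f3 : ((m : ℝ) - 2) * (7.5 * (y / 20)) = 0.375 * (1 - 2 * y) := by linear_combination 0.375 * hym
    rw [f3]
    generalize 2 - 2 / (2 : ℝ) ^ (m - 2) = Q at *
    norm_num at f1 f2 ⊢
    linarith

lemma J_num (m : ℕ) (hm : 2 ≤ m) : 560 * m * (m * (14 * m - 10)) + 1 ≤ 2 ^ (14 * m - 12) := by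
  induction m, hm using Nat.le_induction with
  | base => norm_num
  | succ m hm ih =>
    have h1 : 2 ^ (14 * (m + 1) - 12) = 2 ^ (14 * m - 12) * 2 ^ 14 := by
      rw [← pow_add]; congr 1; omega
    rw [h1]
    have h2 : 14 * (m + 1) - 10 ≤ 4 * (14 * m - 10) := by omega
    have h3 : (m + 1) ≤ 2 * m := by omega
    calc 560 * (m + 1) * ((m + 1) * (14 * (m + 1) - 10)) + 1
        ≤ 560 * (2 * m) * ((2 * m) * (4 * (14 * m - 10))) + 1 := by gcongr
      _ ≤ (560 * m * (m * (14 * m - 10)) + 1) * 2 ^ 14 := by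
          have : 560 * (2 * m) * ((2 * m) * (4 * (14 * m - 10))) = 16 * (560 * m * (m * (14 * m - 10))) := by ring
          rw [this]
          generalize 560 * m * (m * (14 * m - 10)) = a
          omega
      _ ≤ _ := by gcongr

lemma sel_num (m : ℕ) (hm : 2 ≤ m) (ε : ℝ) (hε : ε = 1 / (560 * m)) :
    ((2 : ℝ) * (2 ^ (14 * m - 12) : ℕ) + 1) ^ m ≤ (1 + ε) ^ (2 ^ (14 * m - 12) - 1) := by
  have hm0 : (0 : ℝ) < m := by positivity
  have h1 : (2 : ℝ) ≤ (1 + ε) ^ (560 * m) := by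
    have := one_add_mul_le_pow (a := ε) (by rw [hε]; have : (0:ℝ) ≤ 1 / (560 * m) := by positivity
                                            linarith) (560 * m)
    have h2 : 1 + ((560 * m : ℕ) : ℝ) * ε = 2 := by rw [hε]; push_cast; field_simp; norm_num
    linarith
  have h2 := J_num m hm
  have h3 : (2 : ℝ) * (2 ^ (14 * m - 12) : ℕ) + 1 ≤ 2 ^ (14 * m - 10) := by
    have : 14 * m - 10 = (14 * m - 12) + 2 := by omega
    rw [this, pow_add]
    push_cast
    have : (1 : ℝ) ≤ 2 ^ (14 * m - 12) := one_le_pow₀ (by norm_num)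
    linarith
  have hε0 : 0 ≤ ε := by rw [hε]; positivity
  calc _ ≤ ((2 : ℝ) ^ (14 * m - 10)) ^ m := pow_le_pow_left₀ (by positivity) h3 _
    _ = 2 ^ (m * (14 * m - 10)) := by rw [← pow_mul, mul_comm]
    _ ≤ ((1 + ε) ^ (560 * m)) ^ (m * (14 * m - 10)) := pow_le_pow_left₀ (by norm_num) h1 _
    _ = (1 + ε) ^ (560 * m * (m * (14 * m - 10))) := (pow_mul _ _ _).symm
    _ ≤ _ := pow_le_pow_right₀ (by linarith) (by omega)
end BW


namespace BW
open Finset Polynomial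

lemma log_le_div4 {y : ℝ} (hy : 0 < y) : Real.log y ≤ y / 4 + 0.4 := by
  have h1 : y = 4 * (y / 4) := by ring
  have h2 := Real.log_le_sub_one_of_pos (by positivity : 0 < y / 4)
  rw [h1, Real.log_mul (by norm_num) (by positivity), log_4]
  have := Real.log_two_lt_d9
  rw [h1] at h2
  norm_num at h2 ⊢
  linarith

lemma log_le_div20 {y : ℝ} (hy : 0 < y) : Real.log y ≤ y / 20 + 2 := by
  have h1 : y = 20 * (y / 20) := by ring
  have h2 := Real.log_le_sub_one_of_pos (by positivity : 0 < y / 20)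
  have h3 : Real.log 20 ≤ 3 :=
    log_le_of (p := 3) (q := 1) (by norm_num) (by norm_num) (by norm_num) (by norm_num)
  have h4 : Real.log y = Real.log 20 + Real.log (y / 20) := by
    rw [← Real.log_mul (by norm_num) (by positivity)]; congr 1
  linarith

lemma card_log {P : Type} [Fintype P] {m : ℕ} (Λ : Lat P m) (hm : 2 ≤ m) (L : ℝ) (hL : 0 < L) (T : ℝ)
    (hT : 13.8 * m ≤ T) (hq : m * L * Λ.s ≤ 1 / (20 * m) * T) :
    Real.log (#(Λ.box L)) ≤ 0.65 * T := by
  have hm2 : (2 : ℝ) ≤ m := by exact_mod_cast hm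
  have hm0 : (0 : ℝ) < m := by linarith
  have hT0 : 0 < T := by linarith
  set N := ⌈T / m⌉₊ with hN
  have hN1 : T / m ≤ N := Nat.le_ceil _
  have hN2 : (N : ℝ) < T / m + 1 := Nat.ceil_lt_add_one (by positivity)
  have hTm : 0 < T / m := by positivity
  have hN0 : (0 : ℝ) < N := by linarith
  have h1 := Λ.card_box_cover N (x := L / N) (by positivity)
  have h2 : (N : ℝ) * (L / N) = L := by field_simp
  rw [h2] at h1
  have h3 : #(Λ.box (L / N)) ≤ 1 := by
    rw [card_le_one]
    have key : m * (L / N) * Λ.s < Real.log 2 := by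
      have e : m * (L / N) * Λ.s = m * L * Λ.s / N := by ring
      rw [e, div_lt_iff₀ hN0]
      have e2 : 1 / (20 * m) * T = (T / m) / 20 := by field_simp
      rw [e2] at hq
      have := Real.log_two_gt_d9
      nlinarith
    intro a ha b hb
    rw [Λ.box_trivial key ha, Λ.box_trivial key hb]
  have h4 : #(Λ.box L) ≤ (2 * N + 1) ^ m := h1.trans (by nlinarith [Nat.zero_le ((2 * N + 1) ^ m)])
  have h5 : 0 < #(Λ.box L) := card_pos.mpr ⟨0, Λ.zero_mem_box hL.le⟩
  have h6 : Real.log (#(Λ.box L)) ≤ m * Real.log (2 * N + 1) := by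
    rw [← Real.log_pow]
    exact Real.log_le_log (by positivity) (by exact_mod_cast h4)
  have h7 := log_le_div4 (y := 2 * N + 1) (by positivity)
  have h8 : (m : ℝ) * Real.log (2 * N + 1) ≤ m * ((2 * (T / m + 1) + 1) / 4 + 0.4) := by
    apply mul_le_mul_of_nonneg_left _ hm0.le
    linarith
  have h9 : (m : ℝ) * ((2 * (T / m + 1) + 1) / 4 + 0.4) = T / 2 + 1.15 * m := by
    field_simp; ring
  linarith

/-- the numerical facts about the parameters -/
lemma num_facts (m : ℕ) (hm : 2 ≤ m) (t1 : ℝ) (ht : 92 ≤ t1) (S0 k0 L0 T : ℕ)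
    (hS1 : 5 * m * t1 ≤ S0) (hS2 : (S0 : ℝ) ≤ 5 * m * t1 + 1)
    (hk1 : (k0 : ℝ) ≤ t1 / 5.39) (hk2 : t1 / 5.39 - 1 ≤ k0)
    (hT : 13.8 * m ≤ (T : ℝ)) (g0 : ℝ) (hg : (m : ℝ) * g0 = S0 * T)
    (hL1 : g0 / 80 ≤ L0) (hL2 : (L0 : ℝ) ≤ g0 / 80 + 1) :
    12690 ≤ g0 ∧ 460 * T ≤ g0 ∧ t1 * T ≤ 0.2 * g0 ∧ (L0 : ℝ) ≤ 0.01259 * g0 ∧ (k0 : ℝ) ≤ 0.00136 * g0 ∧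
    0 < (k0 : ℝ) ∧
    Real.log (1 + (2 * S0 + 1) / k0) ≤ 4.2 + m / 3 ∧
    Real.log (1 + (16 * 2 ^ (m - 2) * S0 + 1) / k0) ≤ 4.85 + 1.0266 * m ∧ Real.log L0 ≤ 0.0009 * g0 := by
  have hm2 : (2 : ℝ) ≤ m := by exact_mod_cast hm
  have hm0 : (0 : ℝ) < m := by linarith
  have hT0 : (0 : ℝ) < T := by linarith
  have hT27 : (27.6 : ℝ) ≤ T := by linarith
  have hg1 : 5 * t1 * T ≤ g0 := by
    have : m * (5 * t1 * T) ≤ m * g0 := by rw [hg]; nlinarith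
    exact le_of_mul_le_mul_left this hm0
  have hg2 : 460 * T ≤ g0 := by nlinarith
  have hg3 : 12690 ≤ g0 := by linarith
  have hg4 : 138 * t1 ≤ g0 := by nlinarith
  have hk3 : 0.17465 * t1 ≤ k0 := by
    have : t1 / 5.39 = t1 * (1 / 5.39) := by ring
    rw [this] at hk2
    have h2 : (0.18552 : ℝ) ≤ 1 / 5.39 := by norm_num
    nlinarith
  have hk4 : (16 : ℝ) ≤ k0 := by linarith
  have hk0 : (0 : ℝ) < k0 := by linarith
  have hmk : 0.17465 * t1 * m ≤ k0 * m := by nlinarith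
  have hL3 : (L0 : ℝ) ≤ 0.01259 * g0 := by linarith
  refine ⟨hg3, hg2, by linarith, hL3, ?_, hk0, ?_, ?_, ?_⟩
  · have : t1 / 5.39 ≤ 0.18553 * t1 := by
      rw [div_le_iff₀ (by norm_num)]; linarith
    linarith
  · have h1 : 1 + (2 * (S0 : ℝ) + 1) / k0 ≤ 58 * m := by
      have : (2 * (S0 : ℝ) + 1) / k0 ≤ 58 * m - 1 := by
        rw [div_le_iff₀ hk0]
        have : (58 * (m : ℝ) - 1) * k0 = 58 * (k0 * m) - k0 := by ring
        nlinarith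
      linarith
    have h2 := log_m 58 m (by norm_num) hm0
    have h3 := log_174
    norm_num at h2
    have h4 := Real.log_le_log (by positivity) h1
    norm_num at *
    linarith
  · set Q : ℝ := 2 ^ m with hQ
    have hQ2 : (2 : ℝ) ^ (m - 2) = Q / 4 := by
      have : m = (m - 2) + 2 := by omega
      rw [hQ]
      conv_rhs => rw [this, pow_add]
      norm_num
    have hQ4 : 4 ≤ Q := by
      have : (2 : ℝ) ^ 2 ≤ 2 ^ m := pow_le_pow_right₀ (by norm_num) hm
      norm_num at this; exact this
    rw [hQ2]
    have h1 : 1 + (16 * (Q / 4) * (S0 : ℝ) + 1) / k0 ≤ (115 * m) * Q := by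
      have : (16 * (Q / 4) * (S0 : ℝ) + 1) / k0 ≤ (115 * m) * Q - 1 := by
        rw [div_le_iff₀ hk0]
        have e1 : ((115 * m) * Q - 1) * (k0 : ℝ) = 115 * ((k0 * m) * Q) - k0 := by ring
        have e2 : 0.17465 * t1 * m * Q ≤ k0 * m * Q := mul_le_mul_of_nonneg_right hmk (by linarith)
        have e3 : Q * (S0 : ℝ) ≤ Q * (5 * m * t1 + 1) := mul_le_mul_of_nonneg_left hS2 (by linarith)
        have e4 : (k0 : ℝ) ≤ 0.18553 * t1 := by
          refine hk1.trans ?_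
          rw [div_le_iff₀ (by norm_num)]; linarith
        have e5 : t1 * (2 * 4) ≤ t1 * (m * Q) := by
          apply mul_le_mul_of_nonneg_left _ (by linarith)
          exact mul_le_mul hm2 hQ4 (by norm_num) hm0.le
        have e6 : Q * (92 * 2) ≤ Q * (t1 * m) := by
          apply mul_le_mul_of_nonneg_left _ (by linarith)
          exact mul_le_mul ht hm2 (by norm_num) (by linarith)
        rw [e1]
        have e7 : Q * (5 * m * t1 + 1) = 5 * (Q * (t1 * m)) + Q := by ring
        have e8 : 0.17465 * t1 * m * Q = 0.17465 * (Q * (t1 * m)) := by ring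
        have e9 : t1 * (m * Q) = Q * (t1 * m) := by ring
        have e10 : 16 * (Q / 4) * (S0 : ℝ) = 4 * (Q * S0) := by ring
        rw [e10]
        rw [e7] at e3; rw [e8] at e2; rw [e9] at e5
        generalize Q * (t1 * m) = Z at *
        generalize (k0 : ℝ) * m * Q = W at *
        generalize Q * (S0 : ℝ) = V at *
        linarith
      linarith
    have h2 := log_m 115 m (by norm_num) hm0
    have h3 := log_345
    have h4 := Real.log_le_log (by positivity) h1
    rw [Real.log_mul (by positivity) (by positivity), hQ, Real.log_pow] at h4
    have h5 := Real.log_two_lt_d9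
    have h6 : (m : ℝ) * Real.log 2 ≤ m * 0.6931471808 := mul_le_mul_of_nonneg_left h5.le hm0.le
    norm_num at *
    linarith
  · have : (0 : ℝ) < L0 := by linarith
    have := log_le_div20 this
    linarith
end BW


namespace BW
open Finset Polynomial

/-- numerical bound for `hw` -/
lemma num_w (m : ℕ) (hm : 2 ≤ m) (g0 lb ll tT L0 k0 l1 l2 : ℝ) (hL00 : 0 ≤ L0)
    (hb : lb ≤ 0.0015 * g0) (hl : ll ≤ 0.0009 * g0) (htT : tT ≤ 0.2 * g0) (hL0 : L0 ≤ 0.01259 * g0)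
    (hk0 : k0 ≤ 0.00136 * g0) (h1 : l1 ≤ 4.2 + m / 3) (h2 : l2 ≤ 4.85 + 1.0266 * m) (hg : 0 ≤ g0) :
    lb + (ll + (0.4 * (lb + ll + (tT + (L0 * l1 + (L0 + k0)) + 0.2 * g0)) + (L0 * l2 + (L0 + k0)))) ≤
      (0.267 + 0.0147 * m) * g0 := by
  have hm0 : (0 : ℝ) ≤ m := by positivity
  have e1 : L0 * l1 ≤ (0.01259 * g0) * (4.2 + m / 3) :=
    (mul_le_mul_of_nonneg_left h1 hL00).trans (mul_le_mul_of_nonneg_right hL0 (by positivity))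
  have e2 : L0 * l2 ≤ (0.01259 * g0) * (4.85 + 1.0266 * m) :=
    (mul_le_mul_of_nonneg_left h2 hL00).trans (mul_le_mul_of_nonneg_right hL0 (by positivity))
  have e3 : 0 ≤ g0 * m := by positivity
  nlinarith

lemma num_U (m : ℕ) (hm : 2 ≤ m) :
    4 * 5 * Real.pi * ((0.486 + 0.0148 * m) / m / 3.2 + 0.009 / m / 3.2 * (14 * m : ℕ) + 2 ^ (m - 2) * (7.5 * (1 / (20 * m))))
      ≤ 7.2 * 2 ^ m ∧
    2 * 8 * 2 ^ (m - 2) * Real.pi * ((4 * ((0.486 + 0.0148 * m) / m) + 32 * (1 / (20 * m))) / 4.14 +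
      4 * (0.009 / m) / 4.14 * (14 * m : ℕ)) ≤ 7.2 * 2 ^ m ∧
    (0.486 + 0.0148 * (m : ℝ)) / m + 0.009 / m * (14 * m : ℕ) + 4 * (1 / (20 * m)) ≤ 0.5 := by
  have hm2 : (2 : ℝ) ≤ m := by exact_mod_cast hm
  have hm0 : (0 : ℝ) < m := by linarith
  set Q : ℝ := 2 ^ m with hQ
  have hQ2 : (2 : ℝ) ^ (m - 2) = Q / 4 := by
    have : m = (m - 2) + 2 := by omega
    rw [hQ]
    conv_rhs => rw [this, pow_add]
    norm_num
  have hQ4 : 4 ≤ Q := by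
    have : (2 : ℝ) ^ 2 ≤ 2 ^ m := pow_le_pow_right₀ (by norm_num) hm
    norm_num at this; exact this
  rw [hQ2]
  push_cast
  set y : ℝ := 1 / m with hy
  have hy0 : 0 ≤ y := by positivity
  have hy5 : y ≤ 1 / 2 := by rw [hy]; exact one_div_le_one_div_of_le (by norm_num) hm2
  have hym : (m : ℝ) * y = 1 := by rw [hy]; field_simp
  have e1 : (0.486 + 0.0148 * (m : ℝ)) / m = 0.486 * y + 0.0148 := by rw [hy]; field_simp
  have e2 : 1 / (20 * (m : ℝ)) = y / 20 := by rw [hy]; field_simp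
  have e3 : 0.009 / (m : ℝ) = 0.009 * y := by rw [hy]; field_simp
  rw [e1, e2, e3]
  have hpi : Real.pi ≤ 3.1416 := Real.pi_lt_d4.le
  have hpi0 := Real.pi_pos
  refine ⟨?_, ?_, ?_⟩
  · have f1 : 0.009 * y / 3.2 * (14 * (m : ℝ)) = 0.039375 := by linear_combination (0.126 / 3.2) * hym
    rw [f1]
    have f2 : Q / 4 * (7.5 * (y / 20)) ≤ Q / 4 * (7.5 * (1 / 2 / 20)) := by gcongr
    have f3 : (0.486 * y + 0.0148) / 3.2 + 0.039375 + Q / 4 * (7.5 * (y / 20)) ≤ 0.08 * Q := by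
      norm_num at f2 ⊢; linarith
    calc _ ≤ 4 * 5 * Real.pi * (0.08 * Q) := by gcongr
      _ ≤ 4 * 5 * 3.1416 * (0.08 * Q) := by gcongr
      _ ≤ _ := by linarith
  · have f1 : 4 * (0.009 * y) / 4.14 * (14 * (m : ℝ)) = 0.504 / 4.14 := by linear_combination (0.504 / 4.14) * hym
    rw [f1]
    have f3 : (4 * (0.486 * y + 0.0148) + 32 * (y / 20)) / 4.14 + 0.504 / 4.14 ≤ 0.5645 := by
      norm_num; linarith
    calc _ ≤ 2 * 8 * (Q / 4) * Real.pi * 0.5645 := by gcongr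
      _ ≤ 2 * 8 * (Q / 4) * 3.1416 * 0.5645 := by gcongr
      _ ≤ _ := by linarith
  · have f1 : 0.009 * y * (14 * (m : ℝ)) = 0.126 := by linear_combination 0.126 * hym
    rw [f1]; norm_num; linarith

lemma num_Usm (m : ℕ) (hm : 2 ≤ m) (S0 T : ℕ) (hS : 920 ≤ (S0 : ℝ)) (hSm : (m : ℝ) ≤ S0) (hT : (27.6 : ℝ) ≤ T) :
    Real.log (4 * (2 * 8 * 2 ^ (m - 2) * S0)) + T * Real.log 2 ≤ 0.1 * 2 ^ m * (S0 * T) ∧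
    (T : ℝ) ≤ 0.1 * 2 ^ m * (S0 * T) ∧ (1 : ℝ) ≤ 0.1 * 2 ^ m * (S0 * T) := by
  have h5 := Real.log_two_lt_d9
  have hQ4 : (4 : ℝ) ≤ 2 ^ m := by
    have : (2 : ℝ) ^ 2 ≤ 2 ^ m := pow_le_pow_right₀ (by norm_num) hm
    norm_num at this; exact this
  have h1 : (4 * (2 * 8 * 2 ^ (m - 2) * (S0 : ℝ))) = 2 ^ (m + 4) * S0 := by
    have : m + 4 = (m - 2) + 6 := by omega
    rw [this, pow_add]; ring
  have hS0 : (0 : ℝ) < S0 := by linarith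
  rw [h1, Real.log_mul (by positivity) (by positivity), Real.log_pow]
  have h2 := Real.log_le_sub_one_of_pos hS0
  push_cast
  have h3 : ((m : ℝ) + 4) * Real.log 2 ≤ (m + 4) * 0.6931471808 := by gcongr
  have h4 : (T : ℝ) * Real.log 2 ≤ T * 0.6931471808 := by gcongr
  have h6 : (S0 : ℝ) * 27.6 ≤ S0 * T := by gcongr
  have h7 : 920 * (T : ℝ) ≤ S0 * T := by gcongr
  have h8 : 0.4 * ((S0 : ℝ) * T) ≤ 0.1 * 2 ^ m * (S0 * T) := by
    gcongr; linarith
  refine ⟨?_, ?_, ?_⟩ <;> linarith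

/-- Starting box. -/
lemma start_ok (m : ℕ) (hm : 2 ≤ m) (s K ε : ℝ) (hs : 1 ≤ s) (hK : K = 20 * m ^ 2 * s)
    (hε : ε = 1 / (560 * m)) (L : ℕ) (hL0 : 0 < L) (hL : 560 * m * (K ^ (m - 1) / (m.factorial * 2 ^ m)) ≤ L) :
    (K * L + m) ^ m ≤ m.factorial * ε * (K * L) * (2 * L + 1) ^ m := by
  have hm2 : (2 : ℝ) ≤ m := by exact_mod_cast hm
  have hm0 : (0 : ℝ) < m := by linarith
  have hK0 : 0 < K := by rw [hK]; positivity
  have h1 : K * L + m ≤ K / 2 * (2 * L + 1) := by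
    have : 2 * (m : ℝ) ≤ K := by
      rw [hK]
      have : (m : ℝ) * 1 ≤ m ^ 2 * s := by
        apply mul_le_mul _ hs (by norm_num) (by positivity)
        nlinarith
      linarith
    linarith
  have h2 : K ^ m / 2 ^ m ≤ m.factorial * ε * (K * L) := by
    have e1 : K ^ m = K * K ^ (m - 1) := by rw [← pow_succ']; congr 1; omega
    have hf : (0 : ℝ) < m.factorial := by positivity
    have e2 : m.factorial * ε * K * (560 * m * (K ^ (m - 1) / (m.factorial * 2 ^ m))) ≤ m.factorial * ε * K * L := by
      apply mul_le_mul_of_nonneg_left hL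
      rw [hε]; positivity
    have e3 : m.factorial * ε * K * (560 * m * (K ^ (m - 1) / (m.factorial * 2 ^ m))) = K ^ m / 2 ^ m := by
      rw [hε, e1]; field_simp
    rw [e3] at e2
    linarith
  calc _ ≤ (K / 2 * (2 * L + 1)) ^ m := pow_le_pow_left₀ (by positivity) h1 _
    _ = K ^ m / 2 ^ m * (2 * L + 1) ^ m := by rw [mul_pow, div_pow]
    _ ≤ _ := by gcongr
end BW


namespace BW
open Finset Polynomial

lemma hw_aux (m : ℕ) (hm : 2 ≤ m) (cb L0 k0 : ℕ) (S0 T : ℕ) (t1 u g0 : ℝ) (hcb : 0 < (cb : ℝ))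
    (hL0pos : 0 < (L0 : ℝ)) (hk0 : 0 < (k0 : ℝ)) (hg0pos : 0 ≤ g0)
    (hcl : Real.log cb ≤ 0.0015 * g0) (n3 : t1 * T ≤ 0.2 * g0) (n4 : (L0 : ℝ) ≤ 0.01259 * g0)
    (n5 : (k0 : ℝ) ≤ 0.00136 * g0) (n7 : Real.log (1 + (2 * S0 + 1) / k0) ≤ 4.2 + m / 3)
    (n8 : Real.log (1 + (16 * 2 ^ (m - 2) * S0 + 1) / k0) ≤ 4.85 + 1.0266 * m) (n9 : Real.log L0 ≤ 0.0009 * g0)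
    (hu : u = 0.4 * (Real.log (cb * L0) +
        (t1 * T + (L0 * Real.log (1 + (2 * S0 + 1) / k0) + (L0 + k0)) + 0.2 * g0))) :
    (cb : ℝ) * (L0 * Real.exp u *
        ((1 + (2 * 8 * 2 ^ (m - 2) * S0 + 1) / k0) ^ L0 * Real.exp (L0 + k0))) ≤
      Real.exp ((0.267 + 0.0147 * m) * g0) := by
  have hA0 : (0 : ℝ) < 1 + (16 * 2 ^ (m - 2) * S0 + 1) / k0 := by positivity
  rw [show (2 * 8 : ℝ) = 16 by norm_num]
  rw [← Real.log_le_iff_le_exp (by positivity), Real.log_mul (by positivity) (by positivity),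
    Real.log_mul (by positivity) (by positivity), Real.log_mul (by positivity) (by positivity),
    Real.log_mul (by positivity) (by positivity), Real.log_exp, Real.log_exp, Real.log_pow]
  have h1 := num_w m hm g0 (Real.log cb) (Real.log L0) (t1 * T) L0 k0
    (Real.log (1 + (2 * S0 + 1) / k0)) (Real.log (1 + (16 * 2 ^ (m - 2) * S0 + 1) / k0)) hL0pos.le
    hcl n9 n3 n4 n5 n7 n8 hg0pos
  rw [Real.log_mul (by positivity) (by positivity)] at hu
  rw [hu]
  linarith

set_option maxHeartbeats 1000000 in
lemma core {P : Type} [Fintype P] {m : ℕ} (S : Setup P m (m - 1)) (hm : 2 ≤ m) (S0 T : ℕ) (g0 : ℝ)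
    (hg : (m : ℝ) * g0 = S0 * T) (hS920 : 920 ≤ (S0 : ℝ)) (hSm : (m : ℝ) ≤ S0) (hT138 : 13.8 * m ≤ (T : ℝ))
    (hq : m * S.L * S.Λ.s ≤ 1 / (20 * m) * T)
    (n1 : 12690 ≤ g0) (n2 : 460 * T ≤ g0) (n3 : S.t1 * T ≤ 0.2 * g0) (n4 : (S.L0 : ℝ) ≤ 0.01259 * g0)
    (n5 : (S.k0 : ℝ) ≤ 0.00136 * g0) (n6 : 0 < (S.k0 : ℝ))
    (n7 : Real.log (1 + (2 * S0 + 1) / S.k0) ≤ 4.2 + m / 3)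
    (n8 : Real.log (1 + (16 * 2 ^ (m - 2) * S0 + 1) / S.k0) ≤ 4.85 + 1.0266 * m)
    (n9 : Real.log S.L0 ≤ 0.0009 * g0) (hL0N : 0 < S.L0)
    (hudef : S.u = 0.4 * (Real.log (#(S.Λ.box S.L) * S.L0) +
        (S.t1 * T + (S.L0 * Real.log (1 + (2 * S0 + 1) / S.k0) + (S.L0 + S.k0)) + 4 * (1 / (20 * m)) * (S0 * T))))
    (hlam : S.κ0 * |S.lam| ≤ Real.exp (-(7.3 * 2 ^ m * (S0 * T))))
    (hV : S.VV 0 S0 T (S.Λ.box S.L)) (l0 : P → ℤ) (hl0 : l0 ∈ S.Λ.box S.L) (hP : S.Pl l0 ≠ 0)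
    (hsB : ∀ c : (P → ℤ) → ℝ, (∀ τ : Fin (m - 1) → ℕ, ((∑ i, τ i : ℕ) : ℝ) < 1 / 1024 * T / 2 →
      ∑ l ∈ S.Λ.box (2 * S.L / 2 ^ (14 * m)), c l * qm S.γ τ l = 0) →
        ∀ l ∈ S.Λ.box (2 * S.L / 2 ^ (14 * m)), c l = 0) : False := by
  have hm2 : (2 : ℝ) ≤ m := by exact_mod_cast hm
  have hm0 : (0 : ℝ) < m := by linarith
  have hl2' := Real.log_two_lt_d9
  have hL0pos : (0 : ℝ) < S.L0 := by exact_mod_cast hL0N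
  have hT27 : (27.6 : ℝ) ≤ T := by linarith
  have hT0 : (0 : ℝ) < T := by linarith
  have hS00 : (0 : ℝ) < S0 := by linarith
  have hS0N : 1 ≤ S0 := by
    have : (1 : ℝ) ≤ S0 := by linarith
    exact_mod_cast this
  have hg0pos : 0 ≤ g0 := by linarith
  have hcl := card_log S.Λ hm S.L S.hL T hT138 hq
  have hcard : 0 < #(S.Λ.box S.L) := card_pos.mpr ⟨0, S.Λ.zero_mem_box S.hL.le⟩
  have hcardR : (0 : ℝ) < #(S.Λ.box S.L) := by exact_mod_cast hcard
  obtain ⟨u1, u2, u3⟩ := num_U m hm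
  obtain ⟨v1, v2, v3⟩ := num_Usm m hm S0 T hS920 hSm hT27
  have hGg : ∀ a : ℝ, a / m * (S0 * T) = a * g0 := by
    intro a; rw [← hg]; field_simp
  have hw : (#(S.Λ.box S.L) : ℝ) * S.bd (2 * 8 * 2 ^ (m - 2) * S0) ≤
      Real.exp ((0.267 + 0.0147 * m) / m * (S0 * T)) := by
    rw [hGg, Setup.bd]
    apply hw_aux m hm _ S.L0 S.k0 S0 T S.t1 S.u g0 hcardR hL0pos n6 hg0pos (by linarith) n3 n4 n5 n7 n8 n9
    rw [hudef]
    have : 4 * (1 / (20 * (m : ℝ))) * (S0 * T) = 0.2 * g0 := by rw [← hg]; field_simp; norm_num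
    rw [this]
  have hG0 : (0 : ℝ) < S0 * T := by positivity
  have hL0l : (S.L0 : ℝ) * Real.log 2 ≤ 0.01259 * g0 * 0.6931471808 :=
    mul_le_mul n4 hl2'.le (Real.log_pos (by norm_num)).le (by positivity)
  let A : Setup.Par S := {
    S0 := S0, kk := m - 2, J1 := 14 * m, T := T, E := 5, E' := 8, g := 8 / 5, g' := 207 / 100
    x := 1 / (20 * m), e := 0.009 / m, zB := 0.209 / m, w0 := (0.267 + 0.0147 * m) / m
    z := (0.486 + 0.0148 * m) / m, α := (0.486 + 0.0148 * m) / m / 3.2, β := 7.5 * (1 / (20 * m))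
    η := 0.009 / m / 3.2, μh := (4 * ((0.486 + 0.0148 * m) / m) + 32 * (1 / (20 * m))) / 4.14
    ηh := 4 * (0.009 / m) / 4.14, ϕ := 1 / 1024
    Um := 7.2 * 2 ^ m, Usm := 0.1 * 2 ^ m * (S0 * T), U := 7.3 * 2 ^ m * (S0 * T)
    hS0 := hS0N
    hkk := by omega
    hT := hT0.le
    hE := by norm_num
    hEE := by norm_num
    hE' := by norm_num
    hg0 := by norm_num
    hg0' := by norm_num
    hg := exp_g
    hg' := exp_g'
    hx0 := by positivity
    hq := hq
    he := by
      rw [hGg]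
      show (S.L0 : ℝ) * Real.log 2 ≤ _
      linarith
    hzB := by
      rw [hGg]
      show (S.L0 : ℝ) * Real.log 2 + S.t1 * T ≤ _
      linarith
    hw := hw
    hz := by
      rw [← add_div, ← add_div, hGg, hGg]
      have : 0 ≤ m * g0 := by positivity
      linarith
    hz0 := by positivity
    he0 := by positivity
    hα := by apply le_of_eq; ring
    hη := by apply le_of_eq; ring
    hβ := by apply le_of_eq; ring
    hμh := by apply le_of_eq; ring
    hηh := by apply le_of_eq; ring
    hϕ := by norm_num
    hsum := hsum_num m hm
    hU1 := u1
    hU2 := u2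
    hV := by
      have h1 : 2 ^ m * ((0.486 + 0.0148 * (m : ℝ)) / m + 0.009 / m * (14 * m : ℕ) + 4 * (1 / (20 * m))) * (S0 * T)
          ≤ 2 ^ m * 0.5 * (S0 * T) := by gcongr
      have h2 : 0 ≤ 2 ^ m * ((S0 : ℝ) * T) := by positivity
      linarith
    hUsm := v1
    hU := by linarith
    hlam := hlam }
  refine A.contradiction hV l0 hl0 hP hsB ?_ hL0N
  show (S.L0 : ℝ) ≤ 2 ^ (14 * m) * (1 / 1024) * (S0 * T)
  have h1 : (2 : ℝ) ^ 10 ≤ 2 ^ (14 * m) := pow_le_pow_right₀ (by norm_num) (by omega)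
  have h2 : 1 * ((S0 : ℝ) * T) ≤ 2 ^ (14 * m) * (1 / 1024) * (S0 * T) := by
    apply mul_le_mul_of_nonneg_right _ hG0.le
    norm_num at h1 ⊢; linarith
  have h3 : g0 ≤ m * g0 := le_mul_of_one_le_left hg0pos (by linarith)
  linarith


set_option maxHeartbeats 2000000 in
/-- Main theorem. -/
theorem main_bound {P : Type} [Fintype P] {m : ℕ} (Λ : Lat P m) (hm : 2 ≤ m) (β : P → ℤ) (hβ : β ∈ Λ.lat)
    (hβ0 : theta Λ.pr β ≠ 0) (t B : ℝ) (ht : 23 ≤ t) (hB : ∀ p, |(β p : ℝ)| ≤ B)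
    (hCB : 2 * (Cst m * Λ.s ^ m) * B ≤ Real.exp (4 * t)) :
    Real.exp (-(Cst m * t * Λ.s ^ m)) ≤ |theta Λ.pr β| := by
  by_contra hcon
  push Not at hcon
  have hm2 : (2 : ℝ) ≤ m := by exact_mod_cast hm
  have hm0 : (0 : ℝ) < m := by linarith
  have hs := Λ.hs
  set s := Λ.s with hsdef
  obtain ⟨p0, hp0⟩ : ∃ p, β p ≠ 0 := by
    by_contra h
    push Not at h
    exact hβ0 (by simp [theta, h])
  obtain ⟨q, cc, hθ⟩ := Λ.exists_gam β hβ p0 hp0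
  set γ : Fin (m - 1) → (P → ℤ) →+ ℤ := fun i => Lat.gam β p0 (q i) with hγdef
  set K : ℝ := 20 * m ^ 2 * s with hK
  have hK0 : 0 < K := by rw [hK]; positivity
  set ε : ℝ := 1 / (560 * m) with hε
  have hε0 : 0 < ε := by rw [hε]; positivity
  have hε1 : ε < 1 := by
    rw [hε, div_lt_one (by positivity)]; linarith
  set Ls : ℕ := ⌈560 * m * (K ^ (m - 1) / (m.factorial * 2 ^ m))⌉₊ with hLs
  have hLs1 : 560 * m * (K ^ (m - 1) / (m.factorial * 2 ^ m)) ≤ (Ls : ℝ) := Nat.le_ceil _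
  have hLspos : 0 < 560 * m * (K ^ (m - 1) / (m.factorial * 2 ^ m)) := by positivity
  have hLs2 : (Ls : ℝ) < 560 * m * (K ^ (m - 1) / (m.factorial * 2 ^ m)) + 1 :=
    Nat.ceil_lt_add_one hLspos.le
  have hLs0 : 0 < Ls := Nat.ceil_pos.mpr hLspos
  have hstart := selA_start Λ γ (by omega) K ε hK0 Ls hLs0 (start_ok m hm s K ε hs hK hε Ls hLs0 hLs1) hε0
  obtain ⟨L, hL0, hLL, hA, hsB, hlow⟩ := selection Λ γ K ε (1 / 1024) hK0 hε0 hε1 (by norm_num) (by norm_num)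
    (2 ^ (14 * m - 12)) (14 * m) (by
      calc 2 = 2 ^ 1 := by norm_num
        _ ≤ _ := Nat.pow_le_pow_right (by norm_num) (by omega)) (by
      have : 14 * m = (14 * m - 12) + 12 := by omega
      conv_rhs => rw [this, pow_add]
      push_cast
      apply le_of_eq; ring) (sel_num m hm ε hε) Ls (by exact_mod_cast hLs0) hstart
  rw [selA] at hA
  rw [selB] at hsB
  set T : ℕ := ⌈K * L⌉₊ with hTdef
  have hT1 : K * L ≤ T := Nat.le_ceil _
  have hT2 : (T : ℝ) < K * L + 1 := Nat.ceil_lt_add_one (by positivity)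
  clear_value T Ls
  have hq : m * L * s ≤ 1 / (20 * m) * T := by
    have : m * L * s = 1 / (20 * m) * (K * L) := by rw [hK]; field_simp
    rw [this]; gcongr
  have hl2 := Real.log_two_gt_d9
  have hl2' := Real.log_two_lt_d9
  have hT138 : 13.8 * m ≤ (T : ℝ) := by
    have h1 := hlow.trans hq
    have h2 : 1 / (20 * m) * (T : ℝ) = T / (20 * m) := by ring
    rw [h2, le_div_iff₀ (by positivity)] at h1
    have h3 : (m : ℝ) * 0.6931471803 ≤ m * Real.log 2 := mul_le_mul_of_nonneg_left hl2.le hm0.le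
    linarith
  have hT27 : (27.6 : ℝ) ≤ T := by linarith
  have hT0 : (0 : ℝ) < T := by linarith
  have hTN : 1 ≤ T := by
    have : (1 : ℝ) ≤ T := by linarith
    exact_mod_cast this
  have hTbig : (T : ℝ) ≤ 560 * m * ((20 * m ^ 2 * s) ^ m / (m.factorial * 2 ^ m)) + 20 * m ^ 2 * s + 1 := by
    rw [← hK]
    have h1 : K * L ≤ K * (560 * m * (K ^ (m - 1) / (m.factorial * 2 ^ m)) + 1) :=
      mul_le_mul_of_nonneg_left (hLL.trans hLs2.le) hK0.le
    have e1 : K ^ m = K * K ^ (m - 1) := by rw [← pow_succ']; congr 1; omega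
    have h2 : K * (560 * m * (K ^ (m - 1) / (m.factorial * 2 ^ m)) + 1) =
        560 * m * (K ^ m / (m.factorial * 2 ^ m)) + K := by rw [e1]; ring
    linarith
  set t1 : ℝ := 4 * t with ht1def
  have ht1 : 92 ≤ t1 := by linarith
  set S0 : ℕ := ⌈5 * m * t1⌉₊ with hS0
  have hS1 : 5 * m * t1 ≤ S0 := Nat.le_ceil _
  have hS2 : (S0 : ℝ) < 5 * m * t1 + 1 := Nat.ceil_lt_add_one (by positivity)
  clear_value S0
  set k0 : ℕ := ⌊t1 / 5.39⌋₊ with hk0def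
  have hk1 : (k0 : ℝ) ≤ t1 / 5.39 := Nat.floor_le (by positivity)
  have hk2 : t1 / 5.39 - 1 ≤ k0 := by
    have : t1 / 5.39 < (k0 : ℝ) + 1 := Nat.lt_floor_add_one (t1 / 5.39)
    linarith
  clear_value k0
  set g0 : ℝ := S0 * T / m with hg0
  have hg : (m : ℝ) * g0 = S0 * T := by rw [hg0]; field_simp
  have hg0pos : 0 ≤ g0 := by rw [hg0]; positivity
  set L0 : ℕ := ⌈g0 / 80⌉₊ with hL0def
  have hL1 : g0 / 80 ≤ L0 := Nat.le_ceil _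
  have hL2 : (L0 : ℝ) < g0 / 80 + 1 := Nat.ceil_lt_add_one (by positivity)
  clear_value L0 g0 K ε
  obtain ⟨n1, n2, n3, n4, n5, n6, n7, n8, n9⟩ :=
    num_facts m hm t1 ht1 S0 k0 L0 T hS1 hS2.le hk1 hk2 hT138 g0 hg hL1 hL2.le
  have hk0 : 0 < k0 := by exact_mod_cast n6
  have hL0pos : (0 : ℝ) < L0 := by linarith
  have hL0N : 0 < L0 := by exact_mod_cast hL0pos
  obtain ⟨d, hd0, hd, hdl⟩ := exists_lcm k0
  have hdt : (d : ℝ) ≤ Real.exp t1 := by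
    rw [← Real.log_le_iff_le_exp (by exact_mod_cast hd0)]
    refine hdl.trans ?_
    rw [log_4]
    have h1 : (2 * Real.log 2 + 4) * (k0 : ℝ) ≤ 5.39 * (t1 / 5.39) := by
      apply mul_le_mul (by linarith) hk1 n6.le (by norm_num)
    have h2 : 5.39 * (t1 / 5.39) = t1 := by ring
    linarith
  have hmt : 2 * 92 ≤ m * t1 := by
    apply mul_le_mul hm2 ht1 (by norm_num) hm0.le
  have hS920 : 920 ≤ (S0 : ℝ) := by linarith
  have hSm : (m : ℝ) ≤ S0 := by
    have : (m : ℝ) * 1 ≤ m * t1 := mul_le_mul_of_nonneg_left (by linarith) hm0.le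
    linarith
  have hS0N : 1 ≤ S0 := by
    have : (1 : ℝ) ≤ S0 := by linarith
    exact_mod_cast this
  have hfin := final_size m hm s t (S0 * T) T S0 hs ht (by rw [ht1def] at hS2; linarith) hTbig hT0.le rfl
  have hQ4 : (4 : ℝ) ≤ 2 ^ m := by
    have : (2 : ℝ) ^ 2 ≤ 2 ^ m := pow_le_pow_right₀ (by norm_num) hm
    norm_num at this; exact this
  have hTC : (T : ℝ) ≤ Cst m * s ^ m := by
    have h1 : t * T ≤ t * (Cst m * s ^ m) := by
      refine le_trans ?_ (hfin.trans_eq (by ring))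
      have e1 : t ≤ S0 := by
        have : 2 * t1 ≤ m * t1 := mul_le_mul_of_nonneg_right hm2 (by linarith)
        linarith
      have e2 : t * T ≤ S0 * T := mul_le_mul_of_nonneg_right e1 hT0.le
      have e3 : 1 * ((S0 : ℝ) * T) ≤ 7.4 * 2 ^ m * (S0 * T) := by
        apply mul_le_mul_of_nonneg_right _ (by positivity); linarith
      linarith
    exact le_of_mul_le_mul_left h1 (by linarith)
  have hco : ∀ l ∈ Λ.box L, ∀ p, |(l p : ℝ)| ≤ T := by
    intro l hl p
    rw [Λ.mem_box] at hl
    have h1 := (Λ.coord_le hl.1 hl.2 p).trans hq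
    have h2 : 1 / (20 * m) * (T : ℝ) ≤ 1 / 40 * T := by
      gcongr; linarith
    have h3 : |(l p : ℝ)| * 0.6931471803 ≤ |(l p : ℝ)| * Real.log 2 :=
      mul_le_mul_of_nonneg_left hl2.le (abs_nonneg _)
    linarith
  have hB0 : 0 ≤ B := (abs_nonneg _).trans (hB p0)
  have hγ : ∀ l ∈ Λ.box L, ∀ i, |(γ i l : ℝ)| ≤ Real.exp t1 := by
    intro l hl i
    refine le_trans ?_ hCB
    have e1 : ((γ i l : ℤ) : ℝ) = l (q i) * β p0 - l p0 * β (q i) := by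
      simp only [hγdef, Lat.gam_apply]; push_cast; ring
    rw [e1]
    have a1 : |(l (q i) : ℝ) * β p0| ≤ T * B := by
      rw [abs_mul]; exact mul_le_mul (hco l hl _) (hB _) (abs_nonneg _) hT0.le
    have a2 : |(l p0 : ℝ) * β (q i)| ≤ T * B := by
      rw [abs_mul]; exact mul_le_mul (hco l hl _) (hB _) (abs_nonneg _) hT0.le
    have a3 : (T : ℝ) * B ≤ Cst m * s ^ m * B := mul_le_mul_of_nonneg_right hTC hB0
    have a4 := abs_sub ((l (q i) : ℝ) * β p0) (l p0 * β (q i))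
    linarith
  have hκ : ∀ l ∈ Λ.box L, |((l p0 : ℝ) / β p0)| ≤ T := by
    intro l hl
    rw [abs_div]
    have : (1 : ℝ) ≤ |(β p0 : ℝ)| := by
      have := Int.one_le_abs hp0
      exact_mod_cast this
    exact (div_le_self (abs_nonneg _) this).trans (hco l hl p0)
  obtain ⟨pc, ⟨l0, hl0, r0, hr0, hpc0⟩, hu, hvan⟩ := aux_poly Λ γ L hL0 t1 (by linarith) hγ k0 hk0 d hd hdt hd0
    L0 S0 T hS0N hTN ε 0.4 (1 / (20 * m)) (by norm_num) hA (by
      rw [← hg]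
      have : 2 * ε * (1 + 0.4) * (m * g0) = 0.4 * (g0 / 80) := by
        rw [hε]; field_simp; norm_num
      rw [this]; linarith) hq
  obtain ⟨v1, v2, v3⟩ := num_Usm m hm S0 T hS920 hSm hT27
  have hlam : (T : ℝ) * |theta Λ.pr β| ≤ Real.exp (-(7.3 * 2 ^ m * (S0 * T))) := by
    have h1 : (T : ℝ) ≤ Real.exp T := by
      have := Real.add_one_le_exp (T : ℝ); linarith
    calc (T : ℝ) * |theta Λ.pr β| ≤ Real.exp T * Real.exp (-(Cst m * t * s ^ m)) :=
          mul_le_mul h1 hcon.le (abs_nonneg _) (Real.exp_pos _).le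
      _ = Real.exp (T + -(Cst m * t * s ^ m)) := (Real.exp_add _ _).symm
      _ ≤ _ := by
          apply Real.exp_le_exp.mpr
          linarith
  refine core (P := P) {
    Λ := Λ, γ := γ, cc := cc, κ := fun l => (l p0 : ℝ) / β p0, lam := theta Λ.pr β, hθ := hθ, L := L, hL := hL0
    t1 := t1, ht1 := by linarith
    κ0 := T, hγ := hγ, hκ := hκ, k0 := k0, hk0 := hk0, d := d, hd0 := hd0, hd := hd, hdt := hdt, L0 := L0, u := _
    pc := pc, hu := hu } hm S0 T g0 hg hS920 hSm hT138 hq n1 n2 n3 n4 n5 n6 n7 n8 n9 hL0N rfl hlam ?_ l0 hl0 ?_ hsB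
  · intro l hlo hl j τ hj
    have := hvan l hlo (by simpa using hl) j τ (by exact_mod_cast hj)
    rw [Setup.X]
    simp only [Setup.Pl]
    simpa using this
  · exact Bp_combo_ne k0 L0 (fun r => (pc l0 r : ℚ)) ⟨r0, hr0, by simpa using hpc0⟩
end BW


namespace BW
open Finset

lemma exp_nat_gap {a b : ℝ} {N1 N2 : ℕ} (h1 : Real.exp a = N1) (h2 : Real.exp b = N2) (hab : b < a) :
    Real.exp (-a) ≤ a - b := by
  have h3 := Real.exp_lt_exp.mpr hab
  rw [h1, h2] at h3
  have h4 : N2 + 1 ≤ N1 := by exact_mod_cast h3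
  have h5 : (N2 : ℝ) + 1 ≤ N1 := by exact_mod_cast h4
  have h6 := Real.add_one_le_exp (-(a - b))
  have h7 : Real.exp (-(a - b)) = Real.exp b * Real.exp (-a) := by rw [← Real.exp_add]; congr 1; ring
  have h8 : Real.exp a * Real.exp (-a) = 1 := by rw [← Real.exp_add]; simp
  rw [h1] at h8
  rw [h7, h2] at h6
  have h9 := Real.exp_pos (-a)
  have h10 := mul_le_mul_of_nonneg_right h5 h9.le
  linarith

lemma theta_lower {P : Type} [Fintype P] {pr : P → ℕ} (hp : ∀ p, (pr p).Prime) (β : P → ℤ)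
    (h0 : theta pr β ≠ 0) (H : ℝ) (h1 : ∑ p, max (β p : ℝ) 0 * Real.log (pr p) ≤ H)
    (h2 : ∑ p, max (-(β p : ℝ)) 0 * Real.log (pr p) ≤ H) : Real.exp (-H) ≤ |theta pr β| := by
  set a : P → ℤ := fun p => max (β p) 0 with ha
  set b : P → ℤ := fun p => max (-β p) 0 with hb
  have hab : β = a - b := by
    funext p
    simp only [ha, hb, Pi.sub_apply]
    omega
  obtain ⟨N1, hN1⟩ := rt_nat (pr := pr) a (fun p => le_max_right _ _)
  obtain ⟨N2, hN2⟩ := rt_nat (pr := pr) b (fun p => le_max_right _ _)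
  have e1 := exp_theta hp a
  have e2 := exp_theta hp b
  rw [hN1] at e1
  rw [hN2] at e2
  have e1' : Real.exp (theta pr a) = N1 := by rw [e1]; norm_cast
  have e2' : Real.exp (theta pr b) = N2 := by rw [e2]; norm_cast
  have f1 : theta pr a ≤ H := by
    refine le_trans (le_of_eq ?_) h1
    rw [theta]; refine sum_congr rfl fun p _ => ?_
    simp only [ha]; push_cast; rfl
  have f2 : theta pr b ≤ H := by
    refine le_trans (le_of_eq ?_) h2
    rw [theta]; refine sum_congr rfl fun p _ => ?_
    simp only [hb]; push_cast; rfl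
  have hth : theta pr β = theta pr a - theta pr b := by rw [← theta_sub, ← hab]
  rw [hth] at h0 ⊢
  rcases lt_or_gt_of_ne (sub_ne_zero.mp h0) with h | h
  · rw [abs_sub_comm, abs_of_pos (by linarith)]
    exact (Real.exp_le_exp.mpr (by linarith)).trans (exp_nat_gap e2' e1' h)
  · rw [abs_of_pos (by linarith)]
    exact (Real.exp_le_exp.mpr (by linarith)).trans (exp_nat_gap e1' e2' h)

/-- Build the lattice. -/
lemma exists_lat {P : Type} [Fintype P] (pr : P → ℕ) (hp : ∀ p, (pr p).Prime) (hinj : Function.Injective pr)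
    {n : ℕ} (v : Fin n → P → ℤ) (s : ℝ) (hs : 1 ≤ s)
    (hpos : ∀ i, ∑ p, max (v i p : ℝ) 0 * Real.log (pr p) ≤ s)
    (hneg : ∀ i, ∑ p, max (-(v i p : ℝ)) 0 * Real.log (pr p) ≤ s) :
    ∃ m ≤ n, ∃ Λ : Lat P m, Λ.pr = pr ∧ Λ.s = s ∧ ∀ b : Fin n → ℤ, ∑ i, b i • v i ∈ Λ.lat := by
  classical
  let w : Fin n → P → ℝ := fun i p => (v i p : ℝ)
  obtain ⟨κ, a, hainj, hspan, hli⟩ := exists_linearIndependent' ℝ w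
  have : Finite κ := Finite.of_injective a hainj
  obtain ⟨m, ⟨e⟩⟩ := Finite.exists_equiv_fin κ
  have hmn : m ≤ n := by
    have := Fintype.card_le_of_injective (a ∘ e.symm) (hainj.comp e.symm.injective)
    simpa using this
  set f : Fin m → Fin n := a ∘ e.symm with hf
  have hli2 : LinearIndependent ℝ (w ∘ f) := by
    have := hli.comp e.symm e.symm.injective
    exact this
  have hspan2 : Submodule.span ℝ (Set.range (w ∘ f)) = Submodule.span ℝ (Set.range w) := by
    rw [← hspan, hf, ← Function.comp_assoc, e.symm.surjective.range_comp]
  set φ := Fintype.linearCombination ℝ (w ∘ f) with hφ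
  have hφapp : ∀ (x : Fin m → ℝ) (p : P), φ x p = ∑ i, x i * (v (f i) p : ℝ) := by
    intro x p
    rw [hφ, Fintype.linearCombination_apply, Finset.sum_apply]
    simp [w]
  have hker : LinearMap.ker φ = ⊥ := by
    rw [LinearMap.ker_eq_bot]
    exact linearIndependent_iff_injective_fintypeLinearCombination.mp hli2
  obtain ⟨g, hg⟩ := LinearMap.exists_leftInverse_of_injective φ hker
  have hgφ : ∀ x, g (φ x) = x := fun x => by
    have := LinearMap.congr_fun hg x
    simpa using this
  let cast : (P → ℤ) →+ (P → ℝ) :=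
    { toFun := fun l p => (l p : ℝ)
      map_zero' := by funext p; simp
      map_add' := by intro x y; funext p; simp }
  have hcv : ∀ j, cast (v (f j)) = φ (Pi.single j 1) := by
    intro j
    funext p
    rw [hφapp]
    simp [cast, Pi.single_apply]
  let Λ : Lat P m := {
    pr := pr, hp := hp, hinj := hinj, v := fun i => v (f i)
    c := fun i => ((LinearMap.proj i).comp g).toAddMonoidHom.comp cast
    hc := by
      intro i j
      show g (cast (v (f j))) i = _
      rw [hcv, hgφ, Pi.single_apply]
    s := s, hs := hs, hpos := fun i => hpos (f i), hneg := fun i => hneg (f i) }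
  refine ⟨m, hmn, Λ, rfl, rfl, fun b => ?_⟩
  have hmem : ∀ i, v i ∈ Λ.lat := by
    intro i
    rw [Λ.mem_lat]
    have h1 : w i ∈ Submodule.span ℝ (Set.range (w ∘ f)) := by
      rw [hspan2]; exact Submodule.subset_span ⟨i, rfl⟩
    obtain ⟨x, hx⟩ : ∃ x, φ x = w i := by
      have : w i ∈ LinearMap.range φ := by
        rw [hφ, Fintype.range_linearCombination]; exact h1
      exact this
    have h2 : ∀ k, Λ.c k (v i) = x k := by
      intro k
      show g (w i) k = x k
      rw [← hx, hgφ]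
    intro p
    have h3 : ((v i p : ℤ) : ℝ) = w i p := rfl
    rw [h3, ← hx, hφapp]
    refine sum_congr rfl fun k _ => ?_
    rw [h2]
  exact Λ.lat.sum_mem fun i _ => Λ.lat.zsmul_mem (hmem i) _

lemma Cst_mono {m n : ℕ} (hm : 1 ≤ m) (h : m ≤ n) : Cst m ≤ Cst n := by
  have hm1 : (1 : ℝ) ≤ m := by exact_mod_cast hm
  have hmn : (m : ℝ) ≤ n := by exact_mod_cast h
  unfold Cst
  have h1 : ((m + 1).factorial : ℝ) ≤ (n + 1).factorial := by
    exact_mod_cast Nat.factorial_le (by omega)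
  have h2 : (m : ℝ) ^ (m + 1) ≤ (n : ℝ) ^ (n + 1) :=
    (pow_le_pow_left₀ (by linarith) hmn _).trans (pow_le_pow_right₀ (by linarith) (by omega))
  have h3 : (32 : ℝ) ^ (m + 2) ≤ 32 ^ (n + 2) := pow_le_pow_right₀ (by norm_num) (by omega)
  have h4 : Real.log (2 * (m : ℝ)) ≤ Real.log (2 * n) := Real.log_le_log (by linarith) (by linarith)
  have h5 : 0 ≤ Real.log (2 * (m : ℝ)) := Real.log_nonneg (by linarith)
  gcongr

lemma Cst_one : 3 ≤ Cst 1 := by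
  unfold Cst
  have := Real.log_two_gt_d9
  norm_num [Nat.factorial]
  linarith

lemma Cst_two {n : ℕ} (h : 2 ≤ n) : (627000000 : ℝ) * n ≤ Cst n ∧ (n : ℝ) ^ 2 ≤ Cst n := by
  have hn : (2 : ℝ) ≤ n := by exact_mod_cast h
  have h1 : ((3).factorial : ℝ) ≤ (n + 1).factorial := by
    exact_mod_cast Nat.factorial_le (by omega)
  have h2 : (n : ℝ) ^ 3 ≤ (n : ℝ) ^ (n + 1) := pow_le_pow_right₀ (by linarith) (by omega)
  have h3 : (32 : ℝ) ^ 4 ≤ 32 ^ (n + 2) := pow_le_pow_right₀ (by norm_num) (by omega)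
  have h4 : 1.386 ≤ Real.log (2 * (n : ℝ)) :=
    log_4_ge.trans (Real.log_le_log (by norm_num) (by linarith))
  have h5 : 18 * ((3).factorial : ℝ) * (n : ℝ) ^ 3 * 32 ^ 4 * 1.386 ≤ Cst n := by
    unfold Cst; gcongr
  norm_num [Nat.factorial] at h5
  have h6 : (4 : ℝ) * n ≤ n ^ 3 := by
    have : (4 : ℝ) ≤ n ^ 2 := by nlinarith
    nlinarith
  have h7 : (n : ℝ) ^ 2 ≤ n ^ 3 := pow_le_pow_right₀ (by linarith) (by norm_num)
  have h8 : (0 : ℝ) ≤ n ^ 3 := by positivity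
  constructor
  · linarith
  · linarith

lemma t_ge {t D : ℝ} (h1 : 1 ≤ t) (hD : 627000000 ≤ D) (h : D * t < Real.exp t) : 23 ≤ t := by
  by_contra hlt
  push Not at hlt
  have h2 := Real.add_one_le_exp (23 - t)
  have h3 : Real.exp t * Real.exp (23 - t) = Real.exp 23 := by rw [← Real.exp_add]; congr 1; ring
  have h4 : Real.exp 23 ≤ 1.0e10 :=
    exp_le_of (p := 23) (q := 1) (by norm_num) (by norm_num) (by norm_num) (by norm_num)
  have h5 : Real.exp t * (24 - t) ≤ Real.exp 23 := by
    rw [← h3]; apply mul_le_mul_of_nonneg_left _ (Real.exp_pos _).le; linarith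
  have h6 : 23 ≤ t * (24 - t) := by nlinarith
  have h7 : Real.exp t * 23 ≤ Real.exp t * (t * (24 - t)) := mul_le_mul_of_nonneg_left h6 (Real.exp_pos _).le
  have h8 : t * (Real.exp t * (24 - t)) ≤ t * 1.0e10 := mul_le_mul_of_nonneg_left (h5.trans h4) (by linarith)
  have h9 : 627000000 * t ≤ D * t := mul_le_mul_of_nonneg_right hD (by linarith)
  norm_num at *
  linarith
end BW


namespace BW
open Finset

/-- the trivial size bound -/
lemma tri_bound {P : Type} [Fintype P] (pr : P → ℕ) {n : ℕ} (v : Fin n → P → ℤ) (s B : ℝ) (hs : 0 ≤ s)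
    (hpos : ∀ i, ∑ p, max (v i p : ℝ) 0 * Real.log (pr p) ≤ s)
    (hneg : ∀ i, ∑ p, max (-(v i p : ℝ)) 0 * Real.log (pr p) ≤ s)
    (b : Fin n → ℝ) (hb : ∀ i, |b i| ≤ B) :
    ∑ p, max (∑ i, b i * (v i p : ℝ)) 0 * Real.log (pr p) ≤ n * (B * s) := by
  have hlg : ∀ p, 0 ≤ Real.log (pr p) := fun p => Real.log_natCast_nonneg _
  have h1 : ∀ i, ∑ p, max (b i * (v i p : ℝ)) 0 * Real.log (pr p) ≤ B * s := by
    intro i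
    have hB := hb i
    rcases le_total 0 (b i) with h | h
    · have e : ∀ p, max (b i * (v i p : ℝ)) 0 * Real.log (pr p) = b i * (max (v i p : ℝ) 0 * Real.log (pr p)) := by
        intro p
        rw [← mul_assoc, mul_max_of_nonneg _ _ h, mul_zero]
      simp only [e, ← mul_sum]
      rw [abs_of_nonneg h] at hB
      exact (mul_le_mul_of_nonneg_left (hpos i) h).trans (mul_le_mul_of_nonneg_right hB hs)
    · have h' : 0 ≤ -b i := by linarith
      have e : ∀ p, max (b i * (v i p : ℝ)) 0 * Real.log (pr p) = -b i * (max (-(v i p : ℝ)) 0 * Real.log (pr p)) := by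
        intro p
        rw [← mul_assoc, mul_max_of_nonneg _ _ h', mul_zero, neg_mul_neg]
      simp only [e, ← mul_sum]
      rw [abs_of_nonpos h] at hB
      exact (mul_le_mul_of_nonneg_left (hneg i) h').trans (mul_le_mul_of_nonneg_right hB hs)
  calc ∑ p, max (∑ i, b i * (v i p : ℝ)) 0 * Real.log (pr p)
      ≤ ∑ p, ∑ i, max (b i * (v i p : ℝ)) 0 * Real.log (pr p) := by
        refine sum_le_sum fun p _ => ?_
        rw [← sum_mul]
        refine mul_le_mul_of_nonneg_right ?_ (hlg p)
        exact max_le (sum_le_sum fun i _ => le_max_left _ _) (sum_nonneg fun i _ => le_max_right _ _)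
    _ = ∑ i, ∑ p, max (b i * (v i p : ℝ)) 0 * Real.log (pr p) := sum_comm
    _ ≤ ∑ _i : Fin n, B * s := sum_le_sum fun i _ => h1 i
    _ = _ := by simp

/-- abstract form over an exponent lattice -/
theorem abstract_bound {P : Type} [Fintype P] (pr : P → ℕ) (hp : ∀ p, (pr p).Prime)
    (hinj : Function.Injective pr) {n : ℕ} (v : Fin n → P → ℤ) (s t : ℝ) (hs : 1 ≤ s) (ht : 1 ≤ t)
    (hpos : ∀ i, ∑ p, max (v i p : ℝ) 0 * Real.log (pr p) ≤ s)
    (hneg : ∀ i, ∑ p, max (-(v i p : ℝ)) 0 * Real.log (pr p) ≤ s)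
    (b : Fin n → ℤ) (hb : ∀ i, |(b i : ℝ)| ≤ Real.exp t)
    (h0 : theta pr (∑ i, b i • v i) ≠ 0) :
    Real.exp (-(Cst n * t * s ^ n)) ≤ |theta pr (∑ i, b i • v i)| := by
  obtain ⟨m, hmn, Λ, hΛpr, hΛs, hmem⟩ := exists_lat pr hp hinj v s hs hpos hneg
  set β := ∑ i, b i • v i with hβ
  have hβmem : β ∈ Λ.lat := hmem b
  have hl2 := Real.log_two_gt_d9
  have hlg : ∀ p, 0 ≤ Real.log (pr p) := fun p => Real.log_natCast_nonneg _
  have hβp : ∀ p, (β p : ℝ) = ∑ i, (b i : ℝ) * v i p := by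
    intro p; rw [hβ, Finset.sum_apply]; push_cast; simp
  rcases Nat.eq_zero_or_pos m with rfl | hm
  · exfalso
    apply h0
    rw [← hΛpr, Λ.theta_eq hβmem]; simp
  have hn1 : 1 ≤ n := by omega
  have hsn : s ≤ s ^ n := le_self_pow₀ hs (by omega)
  have hCn3 : 3 ≤ Cst n := Cst_one.trans (Cst_mono le_rfl hn1)
  rcases (by omega : m = 1 ∨ 2 ≤ m) with rfl | hm2
  · -- rank one
    have e1 := Λ.theta_eq hβmem
    rw [Fin.sum_univ_one, hΛpr] at e1
    have hc0 : Λ.c 0 β ≠ 0 := by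
      intro h; rw [h, zero_mul] at e1; exact h0 e1
    have hw0 : theta pr (Λ.v 0) ≠ 0 := by
      intro h; rw [h, mul_zero] at e1; exact h0 e1
    have hlow := theta_lower hp (Λ.v 0) hw0 s (by have := Λ.hpos 0; rwa [hΛpr, hΛs] at this)
      (by have := Λ.hneg 0; rwa [hΛpr, hΛs] at this)
    obtain ⟨p0, hp0⟩ : ∃ p, Λ.v 0 p ≠ 0 := by
      by_contra h; push Not at h; exact hw0 (by simp [theta, h])
    have e2 := (Λ.mem_lat.mp hβmem) p0
    rw [Fin.sum_univ_one] at e2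
    have hβ0 : β p0 ≠ 0 := by
      intro h
      rw [h] at e2
      have : (Λ.c 0 β) * (Λ.v 0 p0 : ℝ) = 0 := by rw [← e2]; simp
      rcases mul_eq_zero.mp this with h | h
      · exact hc0 h
      · exact hp0 (by exact_mod_cast h)
    have hβ1 : (1 : ℝ) ≤ |(β p0 : ℝ)| := by
      have := Int.one_le_abs hβ0
      exact_mod_cast this
    have hv := Λ.coord_le (Λ.v_mem 0) (x := 1) (by intro i; rw [Λ.hc]; split_ifs <;> simp) p0
    rw [hΛs] at hv
    rw [e2, abs_mul] at hβ1
    rw [e1, abs_mul]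
    have hc1 : Real.exp (-(2 * s)) ≤ |Λ.c 0 β| := by
      have a1 : |(Λ.v 0 p0 : ℝ)| ≤ 2 * s := by
        push_cast at hv
        have := mul_le_mul_of_nonneg_left hl2.le (abs_nonneg (Λ.v 0 p0 : ℝ))
        linarith
      have a2 : 2 * s ≤ Real.exp (2 * s) := by have := Real.add_one_le_exp (2 * s); linarith
      have a3 : 1 ≤ |Λ.c 0 β| * Real.exp (2 * s) :=
        hβ1.trans (mul_le_mul_of_nonneg_left (a1.trans a2) (abs_nonneg _))
      have a4 : Real.exp (-(2 * s)) * Real.exp (2 * s) = 1 := by rw [← Real.exp_add]; simp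
      rw [← a4] at a3
      exact le_of_mul_le_mul_right a3 (Real.exp_pos _)
    calc Real.exp (-(Cst n * t * s ^ n)) ≤ Real.exp (-(2 * s) + -s) := by
          apply Real.exp_le_exp.mpr
          have : 3 * s ≤ Cst n * t * s ^ n := by
            apply mul_le_mul _ hsn (by linarith) (by nlinarith)
            nlinarith
          linarith
      _ = Real.exp (-(2 * s)) * Real.exp (-s) := Real.exp_add _ _
      _ ≤ _ := mul_le_mul hc1 hlow (Real.exp_pos _).le (abs_nonneg _)
  · have hn2 : 2 ≤ n := hm2.trans hmn
    have hnR : (2 : ℝ) ≤ n := by exact_mod_cast hn2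
    have het := Real.exp_pos t
    have hHpos := tri_bound pr v s (Real.exp t) (by linarith) hpos hneg (fun i => (b i : ℝ)) hb
    have hHneg := tri_bound pr v s (Real.exp t) (by linarith) hpos hneg (fun i => -(b i : ℝ))
      (fun i => by rw [abs_neg]; exact hb i)
    simp only [neg_mul, sum_neg_distrib] at hHneg
    simp only [← hβp] at hHpos hHneg
    have htriv := theta_lower hp β h0 _ hHpos hHneg
    by_cases hbig : n * (Real.exp t * s) ≤ Cst n * t * s ^ n
    · exact (Real.exp_le_exp.mpr (by linarith)).trans htriv
    push Not at hbig
    obtain ⟨hC1, hC2⟩ := Cst_two hn2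
    have hs2 : s * s ≤ s ^ n := by
      rw [← sq]; exact pow_le_pow_right₀ hs hn2
    have hCt : 0 ≤ Cst n * t := by apply mul_nonneg <;> linarith
    -- C t s < n e^t
    have hkey : Cst n * t * s < n * Real.exp t := by
      have a1 : (Cst n * t * s) * s ≤ Cst n * t * s ^ n := by
        rw [mul_assoc]; exact mul_le_mul_of_nonneg_left hs2 hCt
      have a2 : (Cst n * t * s) * s < (n * Real.exp t) * s := by linarith
      exact lt_of_mul_lt_mul_right a2 (by linarith)
    have hD : 627000000 * t < Real.exp t := by
      have a1 : (627000000 * n) * t ≤ Cst n * t := mul_le_mul_of_nonneg_right hC1 (by linarith)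
      have a2 : Cst n * t * 1 ≤ Cst n * t * s := mul_le_mul_of_nonneg_left hs hCt
      have a3 : n * (627000000 * t) < n * Real.exp t := by linarith
      exact lt_of_mul_lt_mul_left a3 (by linarith)
    have ht23 : 23 ≤ t := t_ge ht le_rfl hD
    have hns : n * s ≤ Real.exp t := by
      have a1 : (n : ℝ) ^ 2 * s ≤ Cst n * s := mul_le_mul_of_nonneg_right hC2 (by linarith)
      have hCs : 0 ≤ Cst n * s := by apply mul_nonneg <;> linarith
      have a2 : Cst n * s * 1 ≤ Cst n * s * t := mul_le_mul_of_nonneg_left ht hCs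
      have a3 : n * (n * s) ≤ n * Real.exp t := by
        have : (n : ℝ) * (n * s) = n ^ 2 * s := by ring
        linarith
      exact le_of_mul_le_mul_left a3 (by linarith)
    have hmC : Cst m * s ^ m ≤ Cst n * s ^ n := by
      apply mul_le_mul (Cst_mono hm hmn) (pow_le_pow_right₀ hs hmn) (by positivity) (by linarith)
    have hB : ∀ p, |(β p : ℝ)| ≤ 1.5 * (n * (Real.exp t * s)) := by
      intro p
      have lp : Real.log 2 ≤ Real.log (pr p) :=
        Real.log_le_log (by norm_num) (by exact_mod_cast (hp p).two_le)
      have one : ∀ g : P → ℝ, ∑ p, max (g p) 0 * Real.log (pr p) ≤ n * (Real.exp t * s) →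
          g p ≤ 1.5 * (n * (Real.exp t * s)) := by
        intro g hg
        have a1 := single_le_sum (f := fun p => max (g p) 0 * Real.log (pr p))
          (fun p _ => mul_nonneg (le_max_right _ _) (hlg p)) (mem_univ p)
        have a2 : max (g p) 0 * 0.6931471803 ≤ max (g p) 0 * Real.log (pr p) :=
          mul_le_mul_of_nonneg_left (by linarith) (le_max_right _ _)
        have a3 := le_max_left (g p) 0
        have a4 : 0 ≤ n * (Real.exp t * s) := by positivity
        beta_reduce at a1
        linarith
      rw [abs_le]
      constructor
      · have := one (fun p => -(β p : ℝ)) hHneg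
        beta_reduce at this
        linarith
      · exact one (fun p => (β p : ℝ)) hHpos
    have hCB : 2 * (Cst m * s ^ m) * (1.5 * (n * (Real.exp t * s))) ≤ Real.exp (4 * t) := by
      have c1 : Cst n * s ^ n * t < n * (Real.exp t * s) := by linarith
      have c2 : Cst m * s ^ m * 23 ≤ n * (Real.exp t * s) := by
        have : Cst n * s ^ n * 23 ≤ Cst n * s ^ n * t := by
          apply mul_le_mul_of_nonneg_left ht23
          have : 0 ≤ Cst n := by linarith
          positivity
        have := mul_le_mul_of_nonneg_right hmC (by norm_num : (0 : ℝ) ≤ 23)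
        linarith
      have c3 : n * (Real.exp t * s) ≤ Real.exp t * Real.exp t := by
        have := mul_le_mul_of_nonneg_left hns het.le
        linarith
      have c4 : Real.exp (4 * t) = (Real.exp t * Real.exp t) * (Real.exp t * Real.exp t) := by
        rw [← Real.exp_add, ← Real.exp_add]; congr 1; ring
      have c0 : 0 ≤ n * (Real.exp t * s) := by positivity
      have cm : 0 ≤ Cst m := by
        have := Cst_mono le_rfl hm
        linarith [Cst_one]
      have c5 : 2 * (Cst m * s ^ m) * 1.5 ≤ Real.exp t * Real.exp t := by
        have : 0 ≤ Cst m * s ^ m := by positivity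
        linarith
      rw [c4]
      calc _ = (2 * (Cst m * s ^ m) * 1.5) * (n * (Real.exp t * s)) := by ring
        _ ≤ _ := mul_le_mul c5 c3 c0 (by positivity)
    have hmain := main_bound Λ hm2 β hβmem (by rw [hΛpr]; exact h0) t _ ht23 hB (by rw [hΛs]; exact hCB)
    rw [hΛpr, hΛs] at hmain
    refine le_trans (Real.exp_le_exp.mpr ?_) hmain
    have := mul_le_mul_of_nonneg_right hmC (by linarith : 0 ≤ t)
    linarith

/-- exponents of a natural number -/
lemma log_eq_sum {N : ℕ} (M : ℕ) (hM : M ≠ 0) (hNM : N ∣ M) :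
    Real.log N = ∑ p : {x // x ∈ M.primeFactors}, (N.factorization p : ℝ) * Real.log (p : ℕ) := by
  rw [Real.log_nat_eq_sum_factorization, Finsupp.sum,
    Finset.sum_coe_sort M.primeFactors (fun x => (N.factorization x : ℝ) * Real.log x)]
  apply sum_subset
  · rw [Nat.support_factorization]
    exact Nat.primeFactors_mono hNM hM
  · intro x _ hx
    rw [Finsupp.notMem_support_iff] at hx
    rw [hx]; simp
end BW

/-- The Baker–Wüstholz theorem on linear forms in logarithms, specialized to
rational numbers (Theorem 3 of the paper). -/
theorem baker_wustholz (n : ℕ) (s t : ℝ) (hs : 1 ≤ s) (ht : 1 ≤ t)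
    (p q : Fin n → ℕ) (b : Fin n → ℤ)
    (hp : ∀ i, 0 < p i) (hq : ∀ i, 0 < q i)
    (hpq : ∀ i, Real.log (max (p i : ℝ) (q i : ℝ)) ≤ s)
    (hb : ∀ i, Real.log |(b i : ℝ)| ≤ t)
    (Λ : ℝ) (hΛ : Λ = ∑ i, (b i : ℝ) * Real.log ((p i : ℝ) / (q i : ℝ)))
    (hΛ0 : Λ ≠ 0) :
    |Λ| ≥ Real.exp (-(18 * ((n + 1).factorial : ℝ) * (n : ℝ) ^ (n + 1) * 32 ^ (n + 2) *
      Real.log (2 * (n : ℝ))) * t * s ^ n) := by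
  set M : ℕ := ∏ i, p i * q i with hM
  have hM0 : M ≠ 0 := Finset.prod_ne_zero_iff.mpr fun i _ => Nat.mul_ne_zero (hp i).ne' (hq i).ne'
  have hpM : ∀ i, p i ∣ M := fun i =>
    (Dvd.intro _ rfl).trans (Finset.dvd_prod_of_mem (fun i => p i * q i) (Finset.mem_univ i))
  have hqM : ∀ i, q i ∣ M := fun i =>
    (Dvd.intro_left _ rfl).trans (Finset.dvd_prod_of_mem (fun i => p i * q i) (Finset.mem_univ i))
  let pr : {x // x ∈ M.primeFactors} → ℕ := fun x => x
  let v : Fin n → {x // x ∈ M.primeFactors} → ℤ := fun i x =>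
    ((p i).factorization x : ℤ) - ((q i).factorization x : ℤ)
  have hlp := fun i => BW.log_eq_sum M hM0 (hpM i)
  have hlq := fun i => BW.log_eq_sum M hM0 (hqM i)
  have hps : ∀ i, Real.log (p i) ≤ s := fun i =>
    (Real.log_le_log (by exact_mod_cast hp i) (le_max_left _ _)).trans (hpq i)
  have hqs : ∀ i, Real.log (q i) ≤ s := fun i =>
    (Real.log_le_log (by exact_mod_cast hq i) (le_max_right _ _)).trans (hpq i)
  have hlg : ∀ x, 0 ≤ Real.log (pr x) := fun x => Real.log_natCast_nonneg _
  have hθv : ∀ i, BW.theta pr (v i) = Real.log ((p i : ℝ) / (q i : ℝ)) := by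
    intro i
    rw [Real.log_div (by exact_mod_cast (hp i).ne') (by exact_mod_cast (hq i).ne'), hlp i, hlq i,
      ← Finset.sum_sub_distrib, BW.theta]
    refine Finset.sum_congr rfl fun x _ => ?_
    simp only [v, pr]
    push_cast
    ring
  have hΛθ : Λ = BW.theta pr (∑ i, b i • v i) := by
    rw [hΛ]
    simp only [← hθv, BW.theta, Finset.mul_sum, Finset.sum_apply, Pi.smul_apply, smul_eq_mul]
    rw [Finset.sum_comm]
    refine Finset.sum_congr rfl fun x _ => ?_
    push_cast
    rw [Finset.sum_mul]
    exact Finset.sum_congr rfl fun i _ => by ring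
  have hC : -(18 * ((n + 1).factorial : ℝ) * (n : ℝ) ^ (n + 1) * 32 ^ (n + 2) *
      Real.log (2 * (n : ℝ))) * t * s ^ n = -(BW.Cst n * t * s ^ n) := by
    unfold BW.Cst; ring
  rw [hC, hΛθ]
  refine BW.abstract_bound pr (fun x => Nat.prime_of_mem_primeFactors x.2) Subtype.val_injective v s t hs ht
    ?_ ?_ b ?_ (by rw [← hΛθ]; exact hΛ0)
  · intro i
    refine le_trans ?_ (hps i)
    rw [hlp i]
    refine Finset.sum_le_sum fun x _ => mul_le_mul_of_nonneg_right ?_ (hlg x)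
    simp only [v]
    push_cast
    refine max_le ?_ (by positivity)
    have : (0 : ℝ) ≤ ((q i).factorization x : ℝ) := by positivity
    linarith
  · intro i
    refine le_trans ?_ (hqs i)
    rw [hlq i]
    refine Finset.sum_le_sum fun x _ => mul_le_mul_of_nonneg_right ?_ (hlg x)
    simp only [v]
    push_cast
    refine max_le ?_ (by positivity)
    have : (0 : ℝ) ≤ ((p i).factorization x : ℝ) := by positivity
    linarith
  · intro i
    rcases eq_or_ne (b i) 0 with h | h
    · rw [h]; simp [(Real.exp_pos t).le]
    · rw [← Real.log_le_iff_le_exp (abs_pos.mpr (by exact_mod_cast h))]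
      exact hb i
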